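/- arXiv:1602.06996 — 6 statements merged into one kernel-verified Lean document; each statement's English description precedes it below -/
import Mathlib

section
/- Let Γ be a finitely generated group and let ρ₁, ρ₂: Γ → GL_n(𝔽_q) be two semisimple (reductive) representations. If ρ₂ = g ρ₁ g⁻¹ for some g ∈ GL_n(𝔽̄_q), then ρ₂ = h ρ₁ h⁻¹ for some h ∈ GL_n(𝔽_q). -/
/-- A representation `ρ : Γ → GL_n(F)` is semisimple (reductive): every invariant subspace
has an invariant complement (equivalently, it is a direct sum of irreducibles). -/
def IsSemisimpleRep {Γ F : Type} [Group Γ] [Field F] {n : ℕ}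
    (ρ : Γ →* GL (Fin n) F) : Prop :=
  ∀ W : Submodule F (Fin n → F), (∀ γ : Γ, ∀ v ∈ W, ((ρ γ).val).mulVec v ∈ W) →
    ∃ W' : Submodule F (Fin n → F),
      (∀ γ : Γ, ∀ v ∈ W', ((ρ γ).val).mulVec v ∈ W') ∧ IsCompl W W'

open Matrix in
/-- An intertwiner between semisimple representations has an intertwining pseudo-inverse. -/
lemma exists_pseudo_inverse {Γ F : Type} [Group Γ] [Field F] {n : ℕ}
    (ρ₁ ρ₂ : Γ →* GL (Fin n) F) (h₁ : IsSemisimpleRep ρ₁) (h₂ : IsSemisimpleRep ρ₂)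
    (h : Matrix (Fin n) (Fin n) F) (hh : ∀ γ, h * (ρ₁ γ).val = (ρ₂ γ).val * h) :
    ∃ k : Matrix (Fin n) (Fin n) F, h * k * h = h ∧ k * h * k = k ∧
      ∀ γ, k * (ρ₂ γ).val = (ρ₁ γ).val * k := by
  have hv : ∀ γ v, h *ᵥ ((ρ₁ γ).val *ᵥ v) = (ρ₂ γ).val *ᵥ (h *ᵥ v) := by
    intro γ v
    rw [mulVec_mulVec, hh, ← mulVec_mulVec]
  obtain ⟨C, hC, hKC⟩ := h₁ (LinearMap.ker h.mulVecLin) (by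
    intro γ v hvk
    rw [LinearMap.mem_ker, mulVecLin_apply] at hvk ⊢
    rw [hv, hvk, mulVec_zero])
  obtain ⟨D, hD, hRD⟩ := h₂ (LinearMap.range h.mulVecLin) (by
    rintro γ _ ⟨v, rfl⟩
    exact ⟨(ρ₁ γ).val *ᵥ v, by rw [mulVecLin_apply, hv, mulVecLin_apply]⟩)
  obtain ⟨l, hl⟩ := LinearMap.exists_leftInverse_of_injective
    (h.mulVecLin.comp C.subtype) (by
      rw [LinearMap.ker_eq_bot']
      intro c hc
      have : (c : Fin n → F) ∈ LinearMap.ker h.mulVecLin ⊓ C := ⟨hc, c.2⟩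
      rw [hKC.inf_eq_bot] at this
      exact Subtype.ext ((Submodule.mem_bot F).1 this))
  obtain ⟨k, hkC, hkD⟩ : ∃ k : Matrix (Fin n) (Fin n) F,
      (∀ c ∈ C, k *ᵥ (h *ᵥ c) = c) ∧ ∀ d ∈ D, k *ᵥ d = 0 := by
    refine ⟨LinearMap.toMatrix' (C.subtype ∘ₗ l ∘ₗ (LinearMap.range h.mulVecLin).subtype ∘ₗ
      (Submodule.projectionOnto _ _ hRD)), ?_, ?_⟩
    · intro c hc
      rw [LinearMap.toMatrix'_mulVec]
      have h1 := Submodule.projectionOnto_apply_left hRD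
        ⟨h *ᵥ c, ⟨c, by rw [mulVecLin_apply]⟩⟩
      have h2 := LinearMap.congr_fun hl ⟨c, hc⟩
      simp only [LinearMap.comp_apply] at h2 ⊢
      simp only at h1
      rw [h1]
      exact congrArg Subtype.val h2
    · intro d hd
      rw [LinearMap.toMatrix'_mulVec]
      simp only [LinearMap.comp_apply]
      rw [(Submodule.projectionOnto_apply_eq_zero_iff hRD).2 hd]
      simp
  have dec1 : ∀ v, ∃ c ∈ C, h *ᵥ v = h *ᵥ c := by
    intro v
    obtain ⟨y, hy, c, hc, rfl⟩ := Submodule.mem_sup.1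
      (show v ∈ LinearMap.ker h.mulVecLin ⊔ C by rw [hKC.sup_eq_top]; trivial)
    rw [LinearMap.mem_ker, mulVecLin_apply] at hy
    exact ⟨c, hc, by rw [mulVec_add, hy, zero_add]⟩
  have dec2 : ∀ w, ∃ c ∈ C, ∃ d ∈ D, w = h *ᵥ c + d := by
    intro w
    obtain ⟨y, ⟨v, rfl⟩, d, hd, rfl⟩ := Submodule.mem_sup.1
      (show w ∈ LinearMap.range h.mulVecLin ⊔ D by rw [hRD.sup_eq_top]; trivial)
    obtain ⟨c, hc, e⟩ := dec1 v
    exact ⟨c, hc, d, hd, by rw [mulVecLin_apply, e]⟩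
  refine ⟨k, ?_, ?_, ?_⟩
  · refine Matrix.ext_of_mulVec_single fun i => ?_
    obtain ⟨c, hc, e⟩ := dec1 (Pi.single i 1)
    rw [← mulVec_mulVec, ← mulVec_mulVec, e, hkC c hc]
  · refine Matrix.ext_of_mulVec_single fun i => ?_
    obtain ⟨c, hc, d, hd, e⟩ := dec2 (Pi.single i 1)
    rw [← mulVec_mulVec, ← mulVec_mulVec, e, mulVec_add, hkC c hc, hkD d hd, add_zero, hkC c hc]
  · intro γ
    refine Matrix.ext_of_mulVec_single fun i => ?_
    obtain ⟨c, hc, d, hd, e⟩ := dec2 (Pi.single i 1)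
    rw [← mulVec_mulVec, ← mulVec_mulVec, e, mulVec_add, mulVec_add, mulVec_add, hkC c hc,
      hkD d hd, add_zero, ← hv, hkC _ (hC γ c hc), hkD _ (hD γ d hd), add_zero]

open Matrix in
/-- Intertwiner of minimal kernel. -/
lemma exists_good {Γ F : Type} [Group Γ] [Field F] {n : ℕ}
    (ρ₁ ρ₂ : Γ →* GL (Fin n) F) (h₁ : IsSemisimpleRep ρ₁) (h₂ : IsSemisimpleRep ρ₂) :
    ∃ h k : Matrix (Fin n) (Fin n) F, (∀ γ, h * (ρ₁ γ).val = (ρ₂ γ).val * h) ∧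
      h * k * h = h ∧ k * h * k = k ∧ (∀ γ, k * (ρ₂ γ).val = (ρ₁ γ).val * k) ∧
      ∀ Y : Matrix (Fin n) (Fin n) F, (∀ γ, Y * (ρ₁ γ).val = (ρ₂ γ).val * Y) →
        (1 - h * k) * Y * (1 - k * h) = 0 := by
  let S : Set (Submodule F (Fin n → F)) := {K | ∃ h : Matrix (Fin n) (Fin n) F,
    (∀ γ, h * (ρ₁ γ).val = (ρ₂ γ).val * h) ∧ LinearMap.ker h.mulVecLin = K}
  obtain ⟨K, ⟨h, hh, rfl⟩, hmin⟩ := WellFounded.has_min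
    (wellFounded_lt (α := Submodule F (Fin n → F))) S ⟨_, 0, by simp, rfl⟩
  obtain ⟨k, e1, e2, hk⟩ := exists_pseudo_inverse ρ₁ ρ₂ h₁ h₂ h hh
  refine ⟨h, k, hh, e1, e2, hk, fun Y hY => ?_⟩
  set f := (1 - h * k) * Y * (1 - k * h) with hf
  have hQ : ∀ γ, (1 - h * k) * (ρ₂ γ).val = (ρ₂ γ).val * (1 - h * k) := by
    intro γ
    rw [sub_mul, mul_sub, one_mul, mul_one, mul_assoc, hk, ← mul_assoc, hh, mul_assoc]
  have hP : ∀ γ, (1 - k * h) * (ρ₁ γ).val = (ρ₁ γ).val * (1 - k * h) := by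
    intro γ
    rw [sub_mul, mul_sub, one_mul, mul_one, mul_assoc, hh, ← mul_assoc, hk, mul_assoc]
  have hfi : ∀ γ, f * (ρ₁ γ).val = (ρ₂ γ).val * f := by
    intro γ
    rw [hf, mul_assoc, hP, ← mul_assoc, mul_assoc _ Y, hY, ← mul_assoc, hQ]
    simp only [mul_assoc]
  have hQh : (1 - h * k) * h = 0 := by rw [sub_mul, one_mul, e1, sub_self]
  have hhP : h * (1 - k * h) = 0 := by rw [mul_sub, mul_one, ← mul_assoc, e1, sub_self]
  have hQQ : (1 - h * k) * (1 - h * k) = 1 - h * k := by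
    rw [mul_sub, ← mul_assoc, hQh, zero_mul, mul_one, sub_zero]
  have hPP : (1 - k * h) * (1 - k * h) = 1 - k * h := by
    rw [sub_mul, mul_assoc k, hhP, mul_zero, one_mul, sub_zero]
  have hQf : (1 - h * k) * f = f := by
    rw [hf, ← mul_assoc, ← mul_assoc, hQQ]
  have hfP : f * (1 - k * h) = f := by
    rw [hf, mul_assoc, hPP]
  have hker : ∀ v, (h + f) *ᵥ v = 0 → h *ᵥ v = 0 ∧ f *ᵥ v = 0 := by
    intro v hv
    have h3 : f *ᵥ v = 0 := by
      have : ((1 - h * k) * (h + f)) *ᵥ v = 0 := by rw [← mulVec_mulVec, hv, mulVec_zero]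
      rwa [mul_add, hQh, hQf, zero_add] at this
    rw [add_mulVec, h3, add_zero] at hv
    exact ⟨hv, h3⟩
  have hle : LinearMap.ker (h + f).mulVecLin ≤ LinearMap.ker h.mulVecLin := by
    intro v hv
    rw [LinearMap.mem_ker, mulVecLin_apply] at hv ⊢
    exact (hker v hv).1
  have heq : LinearMap.ker (h + f).mulVecLin = LinearMap.ker h.mulVecLin := by
    by_contra hne
    exact hmin _ ⟨h + f, fun γ => by rw [add_mul, mul_add, hh, hfi], rfl⟩ (lt_of_le_of_ne hle hne)
  refine Matrix.ext_of_mulVec_single fun i => ?_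
  have hm : (1 - k * h) *ᵥ (Pi.single i 1) ∈ LinearMap.ker h.mulVecLin := by
    rw [LinearMap.mem_ker, mulVecLin_apply, mulVec_mulVec, hhP, zero_mulVec]
  rw [← heq, LinearMap.mem_ker, mulVecLin_apply] at hm
  have := (hker _ hm).2
  rw [mulVec_mulVec, hfP] at this
  rw [this, zero_mulVec]

/-- Applying a linear functional entrywise commutes with multiplication by base matrices. -/
lemma map_dual_mul {F L : Type} [Field F] [Field L] [Algebra F L] {n : ℕ} (φ : L →ₗ[F] F)
    (A : Matrix (Fin n) (Fin n) F) (X : Matrix (Fin n) (Fin n) L) :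
    (A.map (algebraMap F L) * X).map φ = A * X.map φ := by
  ext i j
  simp [Matrix.mul_apply, ← Algebra.smul_def]

lemma map_mul_dual {F L : Type} [Field F] [Field L] [Algebra F L] {n : ℕ} (φ : L →ₗ[F] F)
    (A : Matrix (Fin n) (Fin n) F) (X : Matrix (Fin n) (Fin n) L) :
    (X * A.map (algebraMap F L)).map φ = X.map φ * A := by
  ext i j
  simp only [Matrix.mul_apply, Matrix.map_apply, map_sum]
  refine Finset.sum_congr rfl fun x _ => ?_
  rw [mul_comm, ← Algebra.smul_def, map_smul, smul_eq_mul, mul_comm]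

/-- Let `Γ` be a finitely generated group and `ρ₁, ρ₂ : Γ → GL_n(𝔽_q)` two
semisimple (reductive) representations. If `ρ₂ = g ρ₁ g⁻¹` for some `g ∈ GL_n(𝔽̄_q)` (over the
algebraic closure), then `ρ₂ = h ρ₁ h⁻¹` for some `h ∈ GL_n(𝔽_q)`. -/
theorem stmt3 (Γ : Type) [Group Γ] (hΓ : Group.FG Γ) (n : ℕ)
    (F : Type) [Field F] [Fintype F]
    (ρ₁ ρ₂ : Γ →* GL (Fin n) F)
    (h₁ : IsSemisimpleRep ρ₁) (h₂ : IsSemisimpleRep ρ₂)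
    (hconj : ∃ g : GL (Fin n) (AlgebraicClosure F), ∀ γ : Γ,
      ((ρ₂ γ).val).map (algebraMap F (AlgebraicClosure F)) =
        g.val * (((ρ₁ γ).val).map (algebraMap F (AlgebraicClosure F))) * (g⁻¹).val) :
    ∃ h : GL (Fin n) F, ∀ γ : Γ, ρ₂ γ = h * ρ₁ γ * h⁻¹ := by
  obtain ⟨g, hg⟩ := hconj
  obtain ⟨h, k, hh, e1, e2, hk, hmax⟩ := exists_good ρ₁ ρ₂ h₁ h₂
  let m : Matrix (Fin n) (Fin n) F →+* Matrix (Fin n) (Fin n) (AlgebraicClosure F) :=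
    (algebraMap F (AlgebraicClosure F)).mapMatrix
  have hm : ∀ A, A.map (algebraMap F (AlgebraicClosure F)) = m A := fun A => rfl
  have hgi : ∀ γ, g.val * m (ρ₁ γ).val = m (ρ₂ γ).val * g.val := by
    intro γ
    rw [← hm (ρ₂ γ).val, hg, mul_assoc _ _ g.val, Units.inv_mul, mul_one, hm]
  have hhP : h * (1 - k * h) = 0 := by rw [mul_sub, mul_one, ← mul_assoc, e1, sub_self]
  have hPk : (1 - k * h) * k = 0 := by rw [sub_mul, one_mul, e2, sub_self]
  have hPP : (1 - k * h) * (1 - k * h) = 1 - k * h := by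
    rw [sub_mul, mul_assoc k, hhP, mul_zero, one_mul, sub_zero]
  have hP : ∀ γ, (1 - k * h) * (ρ₁ γ).val = (ρ₁ γ).val * (1 - k * h) := by
    intro γ
    rw [sub_mul, mul_sub, one_mul, mul_one, mul_assoc, hh, ← mul_assoc, hk, mul_assoc]
  -- the vanishing property over the algebraic closure
  have hmaxL : ∀ Y, (∀ γ, Y * m (ρ₁ γ).val = m (ρ₂ γ).val * Y) →
      m (1 - h * k) * Y * m (1 - k * h) = 0 := by
    intro Y hY
    ext i j
    rw [Matrix.zero_apply, ← Module.forall_dual_apply_eq_zero_iff F]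
    intro φ
    have h3 := hmax (Y.map φ) (fun γ => by
      rw [← map_mul_dual, ← map_dual_mul, hm, hm, hY])
    rw [← map_dual_mul, ← map_mul_dual, hm, hm] at h3
    exact congrFun (congrFun h3 i) j
  let H : Submodule (AlgebraicClosure F) (Matrix (Fin n) (Fin n) (AlgebraicClosure F)) :=
    { carrier := {X | (∀ γ, X * m (ρ₁ γ).val = m (ρ₁ γ).val * X) ∧ X * m (1 - k * h) = X}
      add_mem' := by
        rintro X Y ⟨a, b⟩ ⟨c, d⟩
        exact ⟨fun γ => by rw [add_mul, mul_add, a, c], by rw [add_mul, b, d]⟩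
      zero_mem' := ⟨fun γ => by rw [zero_mul, mul_zero], by rw [zero_mul]⟩
      smul_mem' := by
        rintro t X ⟨a, b⟩
        exact ⟨fun γ => by rw [smul_mul_assoc, mul_smul_comm, a], by rw [smul_mul_assoc, b]⟩ }
  let T : H →ₗ[AlgebraicClosure F] H :=
    (LinearMap.mulLeft (AlgebraicClosure F) (m k * g.val)).restrict (by
      rintro X ⟨a, b⟩
      refine ⟨fun γ => ?_, ?_⟩
      · rw [LinearMap.mulLeft_apply, mul_assoc _ X, a, ← mul_assoc, mul_assoc (m k), hgi,
          ← mul_assoc (m k), ← map_mul, hk, map_mul]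
        simp only [mul_assoc]
      · rw [LinearMap.mulLeft_apply, mul_assoc _ X, b])
  have hTinj : Function.Injective T := by
    rw [← LinearMap.ker_eq_bot, LinearMap.ker_eq_bot']
    rintro ⟨X, a, b⟩ hX
    have hX' : m k * g.val * X = 0 := congrArg Subtype.val hX
    have h4 := hmaxL (g.val * X) (fun γ => by
      rw [mul_assoc, a, ← mul_assoc, hgi, mul_assoc])
    rw [mul_assoc, mul_assoc g.val, b, map_sub, sub_mul, map_one, one_mul, map_mul,
      mul_assoc (m h), ← mul_assoc (m k), hX', mul_zero, sub_zero] at h4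
    have h5 : X = 0 := by
      have := congrArg (fun Z => (g⁻¹).val * Z) h4
      simpa only [← mul_assoc, Units.inv_mul, one_mul, mul_zero] using this
    exact Subtype.ext h5
  have hTsurj : Function.Surjective T := LinearMap.injective_iff_surjective.1 hTinj
  obtain ⟨⟨X, hX⟩, hTX⟩ := hTsurj ⟨m (1 - k * h), fun γ => by rw [← map_mul, hP, map_mul],
    by rw [← map_mul, hPP]⟩
  have hTX' : m k * g.val * X = m (1 - k * h) := congrArg Subtype.val hTX
  have hmP : m (1 - k * h) = 0 := by
    rw [← hPP, map_mul, ← hTX', ← mul_assoc, ← mul_assoc, hTX', ← map_mul, hPk, map_zero,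
      zero_mul, zero_mul]
  have hP0 : 1 - k * h = 0 := by
    apply Matrix.map_injective (algebraMap F (AlgebraicClosure F)).injective
    show m (1 - k * h) = m 0
    rw [hmP, map_zero]
  have hkh : k * h = 1 := (sub_eq_zero.1 hP0).symm
  have hhk : h * k = 1 := mul_eq_one_comm.1 hkh
  refine ⟨⟨h, k, hhk, hkh⟩, fun γ => ?_⟩
  rw [eq_mul_inv_iff_mul_eq]
  exact Units.ext (hh γ).symm
end

section
/- Let G be a finite group and Γ = π₁(Σ_g) the fundamental group of a compact oriented surface of genus g ≥ 1, presented as ⟨a₁,b₁,…,a_g,b_g | [a₁,b₁]⋯[a_g,b_g] = 1⟩. Then |Hom(Γ, G)| / |G| = Σ_χ (|G|/χ(1))^{2g−2}, where the sum is over irreducible complex characters χ of G. -/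
open CategoryTheory

namespace FrobMed

variable {G : Type} [Group G] [Fintype G]

/-- A matrix commuting with the image of the group is scalar. -/
lemma comm_scalar {d : ℕ} [NeZero d]
    (φ : MonoidAlgebra ℂ G →ₐ[ℂ] Matrix (Fin d) (Fin d) ℂ) (hφ : Function.Surjective φ)
    (A : Matrix (Fin d) (Fin d) ℂ)
    (h : ∀ x, A * φ (MonoidAlgebra.of ℂ G x) = φ (MonoidAlgebra.of ℂ G x) * A) :
    A = (A.trace / d) • (1 : Matrix (Fin d) (Fin d) ℂ) := by
  have h2 : ∀ y, A * φ y = φ y * A := by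
    intro y
    induction y using MonoidAlgebra.induction_on with
    | of x => exact h x
    | add a b ha hb => simp only [map_add, mul_add, add_mul, ha, hb]
    | smul r a ha => simp only [map_smul, mul_smul_comm, smul_mul_assoc, ha]
  have h3 : ∀ B, Commute B A := by
    intro B
    obtain ⟨y, rfl⟩ := hφ B
    exact (h2 y).symm
  obtain ⟨r, hr⟩ := Matrix.mem_range_scalar_iff_commute_single'.mpr fun i j => h3 (Matrix.single i j 1)
  have hd : (d : ℂ) ≠ 0 := NeZero.ne _
  subst hr
  have : (Matrix.scalar (Fin d) r).trace = d * r := by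
    simp [Matrix.trace]
  rw [this, mul_div_cancel_left₀ _ hd]
  ext i j
  simp [Matrix.one_apply, Matrix.diagonal_apply]

/-- The representation attached to a matrix representation of the group algebra. -/
noncomputable def matRep {d : ℕ}
    (φ : MonoidAlgebra ℂ G →ₐ[ℂ] Matrix (Fin d) (Fin d) ℂ) : Representation ℂ G (Fin d → ℂ) :=
  (Matrix.toLinAlgEquiv' : Matrix (Fin d) (Fin d) ℂ ≃ₐ[ℂ] _).toAlgHom.toMonoidHom.comp
    ((φ : MonoidAlgebra ℂ G →* Matrix (Fin d) (Fin d) ℂ).comp (MonoidAlgebra.of ℂ G))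

lemma matRep_apply {d : ℕ} (φ : MonoidAlgebra ℂ G →ₐ[ℂ] Matrix (Fin d) (Fin d) ℂ) (x : G) :
    matRep φ x = Matrix.toLin' (φ (MonoidAlgebra.of ℂ G x)) := rfl

lemma matRep_char {d : ℕ} (φ : MonoidAlgebra ℂ G →ₐ[ℂ] Matrix (Fin d) (Fin d) ℂ) (x : G) :
    (FDRep.of (matRep φ)).character x = (φ (MonoidAlgebra.of ℂ G x)).trace := by
  change LinearMap.trace ℂ (Fin d → ℂ) (matRep φ x) = _
  rw [matRep_apply, Matrix.trace_toLin'_eq]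

lemma matRep_norm {d : ℕ} [NeZero d]
    (φ : MonoidAlgebra ℂ G →ₐ[ℂ] Matrix (Fin d) (Fin d) ℂ) (hφ : Function.Surjective φ) :
    ∑ x : G, (φ (MonoidAlgebra.of ℂ G x)).trace * (φ (MonoidAlgebra.of ℂ G x⁻¹)).trace
      = Nat.card G := by
  have := invertibleOfNonzero (NeZero.ne (Nat.card G : ℂ))
  have key := Representation.card_inv_mul_sum_char_mul_char_eq_finrank (matRep φ) (matRep φ)
  have hf : Module.finrank ℂ (Representation.IntertwiningMap (matRep φ) (matRep φ)) = 1 := by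
    refine finrank_eq_one (Representation.IntertwiningMap.id (matRep φ)) ?_ ?_
    · intro h0
      have h1 := congrArg (fun f : Representation.IntertwiningMap (matRep φ) (matRep φ) =>
        f (fun _ => 1) 0) h0
      simp at h1
    · intro f
      have hc := comm_scalar φ hφ (LinearMap.toMatrix' f.toLinearMap) (by
        intro x
        apply Matrix.toLin'.injective
        rw [Matrix.toLin'_mul, Matrix.toLin'_mul, Matrix.toLin'_toMatrix', ← matRep_apply]
        exact f.isIntertwining' x)
      refine ⟨(LinearMap.toMatrix' f.toLinearMap).trace / d, ?_⟩
      apply Representation.IntertwiningMap.toLinearMap_injective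
      apply LinearMap.toMatrix'.injective
      dsimp only
      rw [Representation.IntertwiningMap.toLinearMap_smul, map_smul,
        Representation.IntertwiningMap.toLinearMap_id, LinearMap.toMatrix'_id]
      exact hc.symm
  rw [hf] at key
  have e : ∀ x, (matRep φ).character x = (φ (MonoidAlgebra.of ℂ G x)).trace :=
    fun x => matRep_char φ x
  simp only [e] at key
  have hne : (Nat.card G : ℂ) ≠ 0 := NeZero.ne _
  field_simp at key
  simpa using key

lemma matRep_simple {d : ℕ} [NeZero d]
    (φ : MonoidAlgebra ℂ G →ₐ[ℂ] Matrix (Fin d) (Fin d) ℂ) (hφ : Function.Surjective φ) :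
    Simple (FDRep.of (matRep φ)) := by
  rw [FDRep.simple_iff_char_is_norm_one]
  simp only [matRep_char]
  exact matRep_norm φ hφ

/-- The average of commutators acts as a scalar. -/
lemma sum_comm {d : ℕ} [NeZero d]
    (φ : MonoidAlgebra ℂ G →ₐ[ℂ] Matrix (Fin d) (Fin d) ℂ) (hφ : Function.Surjective φ) :
    ∑ p : G × G, φ (MonoidAlgebra.of ℂ G (p.1 * p.2 * p.1⁻¹ * p.2⁻¹)) =
      ((Nat.card G : ℂ) / d) ^ 2 • (1 : Matrix (Fin d) (Fin d) ℂ) := by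
  have hd : (d : ℂ) ≠ 0 := NeZero.ne _
  set M : G → Matrix (Fin d) (Fin d) ℂ := fun x => φ (MonoidAlgebra.of ℂ G x) with hM
  have Mmul : ∀ x y, M (x * y) = M x * M y := by intro x y; simp only [hM, map_mul]
  have Mtr : ∀ x y, (M (x * y)).trace = (M (y * x)).trace := by
    intro x y; rw [Mmul, Mmul, Matrix.trace_mul_comm]
  have h1 : ∀ b, ∑ a, M (a * b * a⁻¹) = ((Nat.card G : ℂ) / d * (M b).trace) • 1 := by
    intro b
    have := comm_scalar φ hφ (∑ a, M (a * b * a⁻¹)) (by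
      intro x
      change _ * M x = M x * _
      rw [Finset.sum_mul, Finset.mul_sum]
      refine Fintype.sum_equiv (Equiv.mulLeft x⁻¹) _ _ ?_
      intro a
      rw [← Mmul, ← Mmul]
      congr 1
      simp [mul_assoc])
    rw [this, Matrix.trace_sum]
    have h : ∀ a, (M (a * b * a⁻¹)).trace = (M b).trace := by
      intro a; rw [Mtr]; simp
    simp only [h]
    simp [Nat.card_eq_fintype_card]
    ring_nf
  have h2 : ∑ b, (M b).trace • M b⁻¹ = ((Nat.card G : ℂ) / d) • 1 := by
    have := comm_scalar φ hφ (∑ b, (M b).trace • M b⁻¹) (by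
      intro x
      change _ * M x = M x * _
      rw [Finset.sum_mul, Finset.mul_sum]
      refine Fintype.sum_equiv (MulAut.conj x⁻¹).toEquiv _ _ ?_
      intro a
      rw [smul_mul_assoc, mul_smul_comm, ← Mmul, ← Mmul]
      congr 1
      · simp only [MulEquiv.toEquiv_eq_coe, EquivLike.coe_coe, MulAut.conj_apply]
        rw [Mtr]; simp
      · simp [mul_assoc])
    rw [this, Matrix.trace_sum]
    simp only [Matrix.trace_smul, smul_eq_mul]
    rw [← matRep_norm φ hφ]
  rw [Fintype.sum_prod_type_right]
  change ∑ b, ∑ a, M (a * b * a⁻¹ * b⁻¹) = _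
  have h3 : ∀ b, ∑ a, M (a * b * a⁻¹ * b⁻¹) = ((Nat.card G : ℂ) / d) • ((M b).trace • M b⁻¹) := by
    intro b
    simp only [Mmul (_ * _ * _) b⁻¹]
    rw [← Finset.sum_mul, h1, smul_mul_assoc, one_mul, mul_smul]
  simp only [h3]
  rw [← Finset.smul_sum, h2, smul_smul, sq]

lemma sum_ofFn {R : Type} [Ring R] (M : G →* R) (g : ℕ) :
    ∑ v : Fin g → G × G,
      M (List.ofFn fun i => (v i).1 * (v i).2 * (v i).1⁻¹ * (v i).2⁻¹).prod =
      (∑ p : G × G, M (p.1 * p.2 * p.1⁻¹ * p.2⁻¹)) ^ g := by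
  induction g with
  | zero => simp
  | succ n ih =>
    rw [pow_succ', ← ih, ← (Fin.consEquiv (fun _ => G × G)).sum_comp, Fintype.sum_prod_type,
      Finset.sum_mul_sum]
    refine Finset.sum_congr rfl fun p _ => Finset.sum_congr rfl fun v _ => ?_
    simp [List.ofFn_succ, Fin.consEquiv]

/-- Trace of left multiplication on a product of matrix algebras. -/
lemma trace_pi {n : ℕ} (d : Fin n → ℕ) (y : Π i, Matrix (Fin (d i)) (Fin (d i)) ℂ) :
    LinearMap.trace ℂ _ (LinearMap.mulLeft ℂ y) = ∑ i, (d i : ℂ) * (y i).trace := by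
  classical
  rw [LinearMap.trace_eq_matrix_trace ℂ
    (Pi.basis fun i => Matrix.stdBasis ℂ (Fin (d i)) (Fin (d i)))]
  rw [Matrix.trace, Fintype.sum_sigma]
  refine Finset.sum_congr rfl fun i _ => ?_
  rw [Fintype.sum_prod_type_right]
  simp only [Matrix.diag_apply, LinearMap.toMatrix_apply, Pi.basis_repr, Pi.basis_apply,
    LinearMap.mulLeft_apply, Pi.mul_apply, Pi.single_eq_same, Matrix.stdBasis_eq_single]
  have : ∀ (a b : Fin (d i)), ((Matrix.stdBasis ℂ (Fin (d i)) (Fin (d i))).repr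
      (y i * Matrix.single a b 1)) (a, b) = y i a a := by
    intro a b
    have : ∀ B : Matrix (Fin (d i)) (Fin (d i)) ℂ,
      (Matrix.stdBasis ℂ (Fin (d i)) (Fin (d i))).repr B (a, b) = B a b := by
      intro B
      simp [Matrix.stdBasis]
    rw [this]
    simp
  simp [this, Matrix.trace]

lemma trace_reg (x : G) [DecidableEq G] :
    LinearMap.trace ℂ _ (LinearMap.mulLeft ℂ (MonoidAlgebra.of ℂ G x)) =
      if x = 1 then (Nat.card G : ℂ) else 0 := by
  classical
  rw [LinearMap.trace_eq_matrix_trace ℂ (MonoidAlgebra.basis G ℂ)]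
  have : ∀ a : G, (MonoidAlgebra.of ℂ G x * MonoidAlgebra.of ℂ G a).coeff a =
      if x = 1 then (1 : ℂ) else 0 := by
    intro a
    simp [MonoidAlgebra.single_mul_single, Finsupp.single_apply]
  rw [Matrix.trace]
  refine (Finset.sum_congr rfl fun a _ => (?_ : _ = if x = 1 then (1 : ℂ) else 0)).trans ?_
  · rw [Matrix.diag_apply, LinearMap.toMatrix_apply]
    exact this a
  · split_ifs <;> simp [Nat.card_eq_fintype_card]

/-- Wedderburn decomposition of the complex group algebra and its consequences. -/
lemma exists_decomp (G : Type) [Group G] [Fintype G] [DecidableEq G] :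
    ∃ (n : ℕ) (d : Fin n → ℕ) (_ : ∀ i, NeZero (d i))
      (φ : ∀ i, MonoidAlgebra ℂ G →ₐ[ℂ] Matrix (Fin (d i)) (Fin (d i)) ℂ),
      (∀ i, Function.Surjective (φ i)) ∧
      (∀ x : G, ∑ i, (d i : ℂ) * (φ i (MonoidAlgebra.of ℂ G x)).trace =
        if x = 1 then (Nat.card G : ℂ) else 0) ∧
      (∀ i j, (∀ x : G, (φ i (MonoidAlgebra.of ℂ G x)).trace =
        (φ j (MonoidAlgebra.of ℂ G x)).trace) → i = j) := by
  have : FiniteDimensional ℂ (MonoidAlgebra ℂ G) :=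
    Module.Finite.of_basis (MonoidAlgebra.basis G ℂ)
  obtain ⟨n, d, hd, ⟨e⟩⟩ :=
    IsSemisimpleRing.exists_algEquiv_pi_matrix_of_isAlgClosed ℂ (MonoidAlgebra ℂ G)
  refine ⟨n, d, hd, fun i => (Pi.evalAlgHom ℂ _ i).comp e.toAlgHom, ?_, ?_, ?_⟩
  · intro i
    exact (Function.surjective_eval i).comp e.surjective
  · intro x
    rw [← trace_reg, ← LinearMap.trace_conj' _ e.toLinearEquiv]
    have : e.toLinearEquiv.conj (LinearMap.mulLeft ℂ (MonoidAlgebra.of ℂ G x)) =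
        LinearMap.mulLeft ℂ (e (MonoidAlgebra.of ℂ G x)) := by
      apply LinearMap.ext
      intro y
      simp [LinearEquiv.conj_apply]
    rw [this, trace_pi]
    rfl
  · intro i j h
    by_contra hij
    have h2 : ∀ y, (e y i).trace = (e y j).trace := by
      intro y
      induction y using MonoidAlgebra.induction_on with
      | of x => exact h x
      | add a b ha hb => simp only [map_add, Pi.add_apply, Matrix.trace_add, ha, hb]
      | smul r a ha => simp only [map_smul, Pi.smul_apply, Matrix.trace_smul, ha]
    have h3 := h2 (e.symm (Pi.single i 1))
    have := hd i
    rw [AlgEquiv.apply_symm_apply, Pi.single_eq_same, Pi.single_eq_of_ne (Ne.symm hij)] at h3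
    simp at h3
    exact NeZero.ne (d i) h3

end FrobMed


open CategoryTheory

/-- The set of irreducible complex characters of a finite group `G`. -/
def irredChars (G : Type) [Group G] : Set (G → ℂ) :=
  {f | ∃ V : FDRep ℂ G, Simple V ∧ f = V.character}

/-- Frobenius–Mednykh: Let `G` be a finite group and
`Γ = π₁(Σ_g) = ⟨a₁,b₁,…,a_g,b_g | [a₁,b₁]⋯[a_g,b_g] = 1⟩` (`g ≥ 1`).  Then
`|Hom(Γ,G)| / |G| = Σ_χ (|G|/χ(1))^{2g−2}`, the sum over irreducible complex characters,
where `Hom(Γ,G)` is identified with the set of `2g`-tuples `(A₁,B₁,…,A_g,B_g) ∈ G^{2g}` with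
`[A₁,B₁]⋯[A_g,B_g] = 1`. -/
theorem stmt7 (G : Type) [Group G] [Fintype G] (g : ℕ) (hg : 1 ≤ g) :
    (Nat.card {v : Fin g → G × G //
        (List.ofFn fun i => (v i).1 * (v i).2 * (v i).1⁻¹ * (v i).2⁻¹).prod = 1} : ℂ) /
        (Fintype.card G : ℂ) =
      ∑ᶠ f ∈ irredChars G, ((Fintype.card G : ℂ) / f 1) ^ (2 * (g : ℤ) - 2) := by
  classical
  obtain ⟨n, d, hd, φ, hφ, hreg, hinj⟩ := FrobMed.exists_decomp G
  have hG : (Nat.card G : ℂ) ≠ 0 := NeZero.ne _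
  have hd0 : ∀ i, (d i : ℂ) ≠ 0 := fun i => NeZero.ne _
  let X : Fin n → G → ℂ := fun i => (FDRep.of (FrobMed.matRep (φ i))).character
  have hX : ∀ i x, X i x = (φ i (MonoidAlgebra.of ℂ G x)).trace :=
    fun i x => FrobMed.matRep_char (φ i) x
  have hX1 : ∀ i, X i 1 = d i := by
    intro i
    rw [hX, map_one, map_one]
    simp
  have Xinj : Function.Injective X := by
    intro i j hij
    apply hinj
    intro x
    rw [← hX, ← hX, hij]
  have hrange : irredChars G = Set.range X := by
    apply Set.Subset.antisymm
    · rintro f ⟨V, hV, rfl⟩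
      have := invertibleOfNonzero hG
      by_contra hcon
      have hz : ∀ i, ∑ x : G, X i x * V.character x⁻¹ = 0 := by
        intro i
        have := FrobMed.matRep_simple (φ i) (hφ i)
        have ho := FDRep.char_orthonormal (FDRep.of (FrobMed.matRep (φ i))) V
        rw [if_neg] at ho
        · exact (mul_eq_zero.mp ho).resolve_left (inv_ne_zero hG)
        · rintro ⟨iso⟩
          exact hcon ⟨i, FDRep.char_iso iso⟩
      have hs : ∑ i, (d i : ℂ) * ∑ x : G, X i x * V.character x⁻¹ =
          Nat.card G * V.character 1 := by
        simp only [Finset.mul_sum]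
        rw [Finset.sum_comm]
        have : ∀ x : G, ∑ i, (d i : ℂ) * (X i x * V.character x⁻¹) =
            if x = 1 then Nat.card G * V.character x⁻¹ else 0 := by
          intro x
          simp only [← mul_assoc, ← Finset.sum_mul, hX]
          rw [hreg x]
          split_ifs <;> simp
        simp only [this]
        simp
      simp only [hz, mul_zero, Finset.sum_const_zero] at hs
      have hV1 : V.character 1 = 0 := by
        simpa [hG] using hs.symm
      have hn := (FDRep.simple_iff_char_is_norm_one V).mp hV
      rw [FDRep.char_one] at hV1
      have hsub : Subsingleton V := Module.finrank_zero_iff.mp (by exact_mod_cast hV1)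
      have hc : ∀ x, V.character x = 0 := by
        intro x
        have : V.ρ x = 0 := Subsingleton.elim _ _
        simp [FDRep.character, this]
      simp only [hc, mul_zero, Finset.sum_const_zero] at hn
      exact hG hn.symm
    · rintro f ⟨i, rfl⟩
      exact ⟨_, FrobMed.matRep_simple (φ i) (hφ i), rfl⟩
  rw [hrange, finsum_mem_range Xinj, finsum_eq_sum_of_fintype]
  simp only [hX1]
  have hsum : ∀ i, ∑ v : Fin g → G × G, (φ i (MonoidAlgebra.of ℂ G
      (List.ofFn fun k => (v k).1 * (v k).2 * (v k).1⁻¹ * (v k).2⁻¹).prod)).trace =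
      (((Nat.card G : ℂ) / d i) ^ 2) ^ g * d i := by
    intro i
    have h := FrobMed.sum_ofFn ((φ i : MonoidAlgebra ℂ G →* Matrix (Fin (d i)) (Fin (d i)) ℂ).comp (MonoidAlgebra.of ℂ G)) g
    have h' := FrobMed.sum_comm (φ i) (hφ i)
    simp only [MonoidHom.comp_apply, MonoidHom.coe_coe] at h
    rw [h', smul_pow, one_pow] at h
    rw [← Matrix.trace_sum, h]
    simp
  have hN : (Nat.card G : ℂ) * (Nat.card {v : Fin g → G × G //
        (List.ofFn fun i => (v i).1 * (v i).2 * (v i).1⁻¹ * (v i).2⁻¹).prod = 1} : ℂ) =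
      ∑ i, (d i : ℂ) * ((((Nat.card G : ℂ) / d i) ^ 2) ^ g * d i) := by
    simp only [← hsum, Finset.mul_sum]
    rw [Finset.sum_comm]
    simp only [hreg]
    rw [Finset.sum_ite, Finset.sum_const_zero, add_zero, Finset.sum_const, nsmul_eq_mul,
      Nat.card_eq_fintype_card (α := {v : Fin g → G × G // _}), Fintype.card_subtype, mul_comm]
  rw [← Nat.card_eq_fintype_card]
  rw [div_eq_iff hG]
  apply mul_left_cancel₀ hG
  rw [hN, Finset.sum_mul, Finset.mul_sum]
  refine Finset.sum_congr rfl fun i _ => ?_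
  have hq : (Nat.card G : ℂ) / d i ≠ 0 := div_ne_zero hG (hd0 i)
  rw [zpow_sub₀ hq, zpow_mul, zpow_natCast]
  have := hd0 i
  have e2 : ((Nat.card G : ℂ) / d i) ^ (2 : ℤ) = ((Nat.card G : ℂ) / d i) ^ 2 := by
    exact zpow_natCast _ 2
  rw [e2]
  generalize (((Nat.card G : ℂ) / d i) ^ 2) ^ g = t
  field_simp
end

section
/- Let G be a finite group and Γ = ⟨a₁,…,a_k | a₁²a₂²⋯a_k² = 1⟩ the fundamental group of the non-orientable surface of Euler characteristic 2−k. Then |Hom(Γ, G)| / |G| = Σ_χ (|G|/χ(1))^{k−2} · ν₂(χ)^k, where ν₂(χ) = (1/|G|) Σ_{x∈G} χ(x²) is the Frobenius–Schur indicator. -/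
open CategoryTheory

open scoped MonoidAlgebra in
theorem aux_ortho (G : Type) [Group G] [Fintype G] {f f' : G → ℂ} (hf : f ∈ irredChars G)
    (hf' : f' ∈ irredChars G) :
    ((f = f') → ∑ g : G, f g * f' g⁻¹ = (Fintype.card G : ℂ)) ∧
    ((f ≠ f') → ∑ g : G, f g * f' g⁻¹ = 0) := by
  classical
  obtain ⟨V, hV, rfl⟩ := hf
  obtain ⟨W, hW, rfl⟩ := hf'
  constructor
  · intro h
    rw [← h, (FDRep.simple_iff_char_is_norm_one V).1 hV, Nat.card_eq_fintype_card]
  · intro h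
    have hn : (Nat.card G : ℂ) ≠ 0 := by
      exact_mod_cast Nat.card_pos.ne'
    have := invertibleOfNonzero hn
    have h2 := FDRep.char_orthonormal V W
    rw [if_neg (fun ⟨i⟩ => h (FDRep.char_iso i))] at h2
    exact (mul_eq_zero.1 h2).resolve_left (inv_ne_zero hn)

theorem aux_conj (G : Type) [Group G] {f : G → ℂ} (hf : f ∈ irredChars G) (g h : G) :
    f (h * g * h⁻¹) = f g := by
  obtain ⟨V, hV, rfl⟩ := hf
  exact FDRep.char_conj V g h

theorem aux_finite (G : Type) [Group G] [Fintype G] : (irredChars G).Finite := by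
  classical
  have : LinearIndependent ℂ (fun f : irredChars G => (f : G → ℂ)) := by
    rw [linearIndependent_iff']
    intro s c hc i hi
    have hn : (Fintype.card G : ℂ) ≠ 0 := by
      exact_mod_cast Fintype.card_ne_zero
    have h1 : ∑ g : G, (∑ j ∈ s, c j • (j : G → ℂ)) g * (i : G → ℂ) g⁻¹ = 0 := by
      rw [hc]; simp
    simp only [Finset.sum_apply, Pi.smul_apply, smul_eq_mul, Finset.sum_mul, mul_assoc] at h1
    rw [Finset.sum_comm] at h1
    simp only [← Finset.mul_sum] at h1
    rw [Finset.sum_eq_single i, (aux_ortho G i.2 i.2).1 rfl] at h1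
    · exact (mul_eq_zero.1 h1).resolve_right hn
    · intro j _ hj
      rw [(aux_ortho G j.2 i.2).2 (fun h => hj (Subtype.ext h)), mul_zero]
    · exact fun h => absurd hi h
  exact this.setFinite

/-- Schur's lemma for representations whose character has norm one. -/
theorem aux_schur (G : Type) [Group G] [Fintype G] {V : Type} [AddCommGroup V] [Module ℂ V]
    [FiniteDimensional ℂ V] (ρ : Representation ℂ G V)
    (hρ : ∑ g : G, ρ.character g * ρ.character g⁻¹ = Fintype.card G)
    (T : V →ₗ[ℂ] V) (hT : ∀ g, T ∘ₗ ρ g = ρ g ∘ₗ T) : ∃ c : ℂ, T = c • LinearMap.id := by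
  have hn : (Nat.card G : ℂ) ≠ 0 := by
    exact_mod_cast Nat.card_pos.ne'
  have := invertibleOfNonzero hn
  have h1 := Representation.card_inv_mul_sum_char_mul_char_eq_finrank ρ ρ
  rw [hρ, ← Nat.card_eq_fintype_card, inv_mul_cancel₀ hn] at h1
  have h2 : Module.finrank ℂ (Representation.IntertwiningMap ρ ρ) = 1 := by exact_mod_cast h1.symm
  let I : Representation.IntertwiningMap ρ ρ := ⟨LinearMap.id, by intro g; rfl⟩
  let T' : Representation.IntertwiningMap ρ ρ := ⟨T, hT⟩
  by_cases hI : I = 0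
  · have : (LinearMap.id : V →ₗ[ℂ] V) = 0 := congrArg (fun F => F.toLinearMap) hI
    refine ⟨0, ?_⟩
    rw [zero_smul, ← LinearMap.comp_id T, this, LinearMap.comp_zero]
  · obtain ⟨c, hc⟩ := (finrank_eq_one_iff_of_nonzero' I hI).1 h2 T'
    exact ⟨c, (congrArg (fun F => F.toLinearMap) hc).symm⟩

open scoped MonoidAlgebra in
theorem aux_module (G : Type) [Group G] [Fintype G] (a : ℂ[G])
    (h : ∀ (V : Type) [AddCommGroup V] [Module ℂ V] [FiniteDimensional ℂ V]
      (ρ : Representation ℂ G V), ρ.IsIrreducible → ρ.asAlgebraHom a = 0)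
    (M : Type) [AddCommGroup M] [Module ℂ M] [Module ℂ[G] M] [IsScalarTower ℂ ℂ[G] M]
    (hs : IsSimpleModule ℂ[G] M) (m : M) :
    a • m = 0 := by
  have hfin0 : Module.Finite ℂ ℂ[G] := inferInstance
  have hfinM : Module.Finite ℂ[G] M := inferInstance
  have hfin : FiniteDimensional ℂ M := Module.Finite.trans ℂ[G] _
  let ρ : Representation ℂ G M := Representation.ofModule' M
  have hρ : ∀ (r : ℂ[G]) (x : M), ρ.asAlgebraHom r x = r • x := by
    intro r x
    have : ρ.asAlgebraHom = Algebra.lsmul ℂ ℂ M :=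
      (MonoidAlgebra.lift ℂ (M →ₗ[ℂ] M) G).apply_symm_apply _
    rw [this]; rfl
  let e : ρ.asModule ≃ₗ[ℂ[G]] M :=
    { ρ.asModuleEquiv.toAddEquiv with
      map_smul' := fun r x => (ρ.asModuleEquiv_map_smul r x).trans (hρ r _) }
  have hi : ρ.IsIrreducible := by
    rw [Representation.irreducible_iff_isSimpleModule_asModule]
    exact IsSimpleModule.congr e
  rw [← hρ, h M ρ hi, LinearMap.zero_apply]

open scoped MonoidAlgebra in
theorem aux_jac (G : Type) [Group G] [Fintype G] (a : ℂ[G])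
    (h : ∀ (V : Type) [AddCommGroup V] [Module ℂ V] [FiniteDimensional ℂ V]
      (ρ : Representation ℂ G V), ρ.IsIrreducible → ρ.asAlgebraHom a = 0) : a = 0 := by
  have : IsSemisimpleRing ℂ[G] := inferInstance
  have hj : Ring.jacobson ℂ[G] = ⊥ := IsSemisimpleRing.jacobson_eq_bot _
  have : a ∈ Ring.jacobson ℂ[G] := by
    rw [Ring.jacobson, Module.jacobson, Submodule.mem_sInf]
    intro I hI
    have hs : IsSimpleModule ℂ[G] (ℂ[G] ⧸ I) := isSimpleModule_iff_isCoatom.2 hI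
    have h2 := aux_module G a h _ hs (Submodule.Quotient.mk 1)
    rw [← Submodule.Quotient.mk_smul, Submodule.Quotient.mk_eq_zero] at h2
    simpa using h2
  rw [hj] at this
  simpa using this

theorem aux_mem (G : Type) [Group G] [Fintype G] {V : Type} [AddCommGroup V] [Module ℂ V]
    [FiniteDimensional ℂ V] (ρ : Representation ℂ G V) (hρ : ρ.IsIrreducible) :
    ρ.character ∈ irredChars G ∧
      ∑ g : G, ρ.character g * ρ.character g⁻¹ = Fintype.card G := by
  have hn : (Nat.card G : ℂ) ≠ 0 := by
    exact_mod_cast Nat.card_pos.ne'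
  have := invertibleOfNonzero hn
  have h1 := Representation.char_orthonormal ρ ρ
  rw [if_pos ⟨Representation.Equiv.refl ρ⟩, inv_mul_eq_one₀ hn] at h1
  refine ⟨⟨FDRep.of ρ, ?_, rfl⟩, ?_⟩
  · rw [FDRep.simple_iff_char_is_norm_one]
    exact h1.symm
  · rw [← h1, Nat.card_eq_fintype_card]

open scoped MonoidAlgebra in
theorem aux_regular (G : Type) [Group G] [Fintype G] [DecidableEq G] (x : G) :
    ∑ f ∈ (aux_finite G).toFinset, f 1 * f x = if x = 1 then (Fintype.card G : ℂ) else 0 := by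
  classical
  set F : G → ℂ := fun g => (if g = 1 then (Fintype.card G : ℂ) else 0) -
    ∑ f ∈ (aux_finite G).toFinset, f 1 * f g with hF
  have hFc : ∀ g h, F (h * g * h⁻¹) = F g := by
    intro g h
    simp only [hF, conj_eq_one_iff]
    congr 1
    refine Finset.sum_congr rfl fun f hf => ?_
    rw [aux_conj G ((Set.Finite.mem_toFinset _).1 hf)]
  set a : ℂ[G] := ∑ g : G, MonoidAlgebra.single g⁻¹ (F g) with ha
  have ha0 : a = 0 := by
    apply aux_jac
    intro V _ _ _ ρ hρ
    obtain ⟨hm, hnorm⟩ := aux_mem G ρ hρ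
    have hT : ρ.asAlgebraHom a = ∑ g : G, F g • ρ g⁻¹ := by
      rw [ha, map_sum]
      simp only [Representation.asAlgebraHom_single]
    obtain ⟨c, hc⟩ := aux_schur G ρ hnorm (ρ.asAlgebraHom a) (by
      intro h
      rw [hT, ← Module.End.mul_eq_comp, ← Module.End.mul_eq_comp, Finset.sum_mul, Finset.mul_sum]
      refine Fintype.sum_equiv (MulAut.conj h⁻¹).toEquiv _ _ fun g => ?_
      have : F ((MulAut.conj h⁻¹).toEquiv g) = F g := hFc g h⁻¹
      rw [this, smul_mul_assoc, mul_smul_comm, ← map_mul, ← map_mul]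
      simp [mul_assoc])
    have htr : LinearMap.trace ℂ V (ρ.asAlgebraHom a) = 0 := by
      rw [hT, map_sum]
      have : ∀ g, LinearMap.trace ℂ V (F g • ρ g⁻¹) = F g * ρ.character g⁻¹ := by
        intro g
        rw [map_smul, smul_eq_mul]; rfl
      simp only [this]
      simp only [hF, sub_mul, Finset.sum_sub_distrib, Finset.sum_mul, mul_assoc]
      rw [Finset.sum_comm]
      simp only [← Finset.mul_sum]
      rw [Finset.sum_eq_single ρ.character, (aux_ortho G hm hm).1 rfl]
      · simp [mul_comm]
      · intro f hf hne
        rw [(aux_ortho G ((Set.Finite.mem_toFinset _).1 hf) hm).2 hne, mul_zero]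
      · intro h
        exact absurd ((Set.Finite.mem_toFinset _).2 hm) h
    rw [hc] at htr ⊢
    rw [map_smul, LinearMap.trace_id, smul_eq_mul, mul_eq_zero] at htr
    rcases htr with h | h
    · rw [h, zero_smul]
    · have h' : Module.finrank ℂ V = 0 := by exact_mod_cast h
      have := Module.finrank_zero_iff.1 h'
      exact Subsingleton.elim _ _
  have hx : F x = 0 := by
    have h1 : a.coeff x⁻¹ = 0 := by rw [ha0]; rfl
    rw [ha, MonoidAlgebra.coeff_sum, Finsupp.finsetSum_apply] at h1
    simpa [Finsupp.single_apply] using h1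
  exact (sub_eq_zero.1 hx).symm

theorem aux_prod (G : Type) [Group G] [Fintype G] {R : Type} [Ring R] (ρ : G →* R) (k : ℕ) :
    ∑ v : Fin k → G, ρ (List.ofFn fun i => (v i) ^ 2).prod = (∑ x : G, ρ (x ^ 2)) ^ k := by
  induction k with
  | zero => simp
  | succ n ih =>
    rw [← (Fin.consEquiv fun _ => G).sum_comp, Fintype.sum_prod_type, pow_succ', ← ih,
      Finset.sum_mul_sum]
    simp [Fin.consEquiv, List.ofFn_succ]

theorem aux_char (G : Type) [Group G] [Fintype G] (k : ℕ) {f : G → ℂ} (hf : f ∈ irredChars G) :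
    f 1 ≠ 0 ∧ ∑ v : Fin k → G, f (List.ofFn fun i => (v i) ^ 2).prod =
      ((∑ x : G, f (x ^ 2)) / f 1) ^ k * f 1 := by
  classical
  have hf1 : f 1 ≠ 0 := by
    intro h0
    have h := (aux_ortho G hf hf).1 rfl
    obtain ⟨V, hV, rfl⟩ := hf
    rw [FDRep.char_one] at h0
    have h' : Module.finrank ℂ V = 0 := by exact_mod_cast h0
    have := Module.finrank_zero_iff.1 h'
    have hz : ∀ g, V.character g = 0 := fun g => by
      rw [FDRep.character, Subsingleton.elim (V.ρ g) 0, map_zero]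
    simp only [hz, mul_zero, Finset.sum_const_zero] at h
    exact Fintype.card_ne_zero (α := G) (by exact_mod_cast h.symm)
  refine ⟨hf1, ?_⟩
  have hnorm := (aux_ortho G hf hf).1 rfl
  obtain ⟨V, hV, rfl⟩ := hf
  let ρ : Representation ℂ G V := V.ρ
  obtain ⟨c, hc⟩ := aux_schur G ρ hnorm (∑ x : G, ρ (x ^ 2)) (by
    intro h
    rw [← Module.End.mul_eq_comp, ← Module.End.mul_eq_comp, Finset.sum_mul, Finset.mul_sum]
    refine Fintype.sum_equiv (MulAut.conj h⁻¹).toEquiv _ _ fun g => ?_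
    rw [← map_mul, ← map_mul]
    congr 1
    simp [pow_two, mul_assoc])
  have h1 : ∑ x : G, V.character (x ^ 2) = c * V.character 1 := by
    have := congrArg (LinearMap.trace ℂ V) hc
    rw [map_sum, map_smul, LinearMap.trace_id, smul_eq_mul] at this
    rw [FDRep.char_one]
    exact this
  rw [h1, mul_div_cancel_right₀ _ hf1]
  have h2 := congrArg (LinearMap.trace ℂ V) (aux_prod G ρ k)
  rw [hc, map_sum, smul_pow, ← Module.End.one_eq_id, one_pow, map_smul, LinearMap.trace_one,
    smul_eq_mul] at h2
  rw [FDRep.char_one]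
  exact h2

/-- Let `G` be a finite group and `Γ = ⟨a₁,…,a_k | a₁²a₂²⋯a_k² = 1⟩` the
fundamental group of the non-orientable surface of Euler characteristic `2−k`. Then
`|Hom(Γ,G)| / |G| = Σ_χ (|G|/χ(1))^{k−2} · ν₂(χ)^k`, where
`ν₂(χ) = (1/|G|) Σ_{x∈G} χ(x²)` is the Frobenius–Schur indicator, the sum over irreducible
complex characters of `G`, and `Hom(Γ,G)` is identified with the set of `k`-tuples
`(A₁,…,A_k) ∈ G^k` with `A₁²⋯A_k² = 1`. -/
theorem stmt8 (G : Type) [Group G] [Fintype G] (k : ℕ) (hk : 1 ≤ k) :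
    (Nat.card {v : Fin k → G // (List.ofFn fun i => (v i) ^ 2).prod = 1} : ℂ) /
        (Fintype.card G : ℂ) =
      ∑ᶠ f ∈ irredChars G, ((Fintype.card G : ℂ) / f 1) ^ ((k : ℤ) - 2) *
        ((1 / (Fintype.card G : ℂ)) * ∑ x : G, f (x ^ 2)) ^ k := by

  classical
  have hn : (Fintype.card G : ℂ) ≠ 0 := by
    exact_mod_cast Fintype.card_ne_zero
  have hN : (Nat.card {v : Fin k → G // (List.ofFn fun i => (v i) ^ 2).prod = 1} : ℂ) *
      (Fintype.card G : ℂ) = ∑ f ∈ (aux_finite G).toFinset,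
        f 1 * (((∑ x : G, f (x ^ 2)) / f 1) ^ k * f 1) := by
    have h1 : ∑ v : Fin k → G, ∑ f ∈ (aux_finite G).toFinset,
        f 1 * f (List.ofFn fun i => (v i) ^ 2).prod =
        (Nat.card {v : Fin k → G // (List.ofFn fun i => (v i) ^ 2).prod = 1} : ℂ) *
          (Fintype.card G : ℂ) := by
      simp only [aux_regular]
      rw [← Finset.sum_filter, Finset.sum_const, nsmul_eq_mul, Nat.card_eq_fintype_card,
        Fintype.card_subtype]
    rw [← h1, Finset.sum_comm]
    refine Finset.sum_congr rfl fun f hf => ?_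
    rw [← Finset.mul_sum, (aux_char G k ((Set.Finite.mem_toFinset _).1 hf)).2]
  rw [finsum_mem_eq_finite_toFinset_sum _ (aux_finite G)]
  rw [div_eq_iff hn, ← mul_left_inj' hn, hN, Finset.sum_mul, Finset.sum_mul]
  refine Finset.sum_congr rfl fun f hf => ?_
  have hf1 := (aux_char G k ((Set.Finite.mem_toFinset _).1 hf)).1
  rw [zpow_sub₀ (div_ne_zero hn hf1), zpow_natCast, zpow_ofNat]
  field_simp
  rw [← mul_pow]
  congr 1
  field_simp
end

section
/- For any finite group G and irreducible complex character χ of G and positive integer n, the n-th Frobenius–Schur indicator ν_n(χ) = (1/|G|) Σ_{x∈G} χ(x^n) is an integer. -/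
open CategoryTheory

namespace FSInd

open Module

lemma trace_pow_eigen {V : Type*} [AddCommGroup V] [Module ℂ V] [FiniteDimensional ℂ V]
    (f : End ℂ V) (N : ℕ) (hN : 0 < N) (hf : f ^ N = 1) :
    ∃ (s : Finset ℂ) (m : ℂ → ℕ), (∀ μ ∈ s, μ ^ N = 1) ∧
      ∀ k : ℕ, LinearMap.trace ℂ V (f ^ k) = ∑ μ ∈ s, (m μ : ℂ) * μ ^ k := by
  classical
  have hss : f.IsSemisimple := by
    have h : (Polynomial.X ^ N - 1 : Polynomial ℂ).Separable :=
      Polynomial.X_pow_sub_one_separable_iff.2 (by exact_mod_cast hN.ne')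
    refine Module.End.isSemisimple_of_squarefree_aeval_eq_zero h.squarefree ?_
    simp [hf]
  have hds := DirectSum.isInternal_submodule_of_iSupIndep_of_iSup_eq_top
      f.eigenspaces_iSupIndep hss.iSup_eigenspace_eq_top
  have h_fin : {μ | f.eigenspace μ ≠ ⊥}.Finite :=
      WellFoundedGT.finite_ne_bot_of_iSupIndep f.eigenspaces_iSupIndep
  have happ : ∀ (k : ℕ) (μ : ℂ) (v : V), v ∈ f.eigenspace μ → (f ^ k) v = μ ^ k • v := by
    intro k μ v hv
    induction k with
    | zero => simp
    | succ k ih =>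
      rw [pow_succ', Module.End.mul_apply, ih, map_smul, Module.End.mem_eigenspace_iff.1 hv,
        smul_smul, pow_succ]
  refine ⟨h_fin.toFinset, fun μ => finrank ℂ (f.eigenspace μ), ?_, ?_⟩
  · intro μ hμ
    have hμ' : f.eigenspace μ ≠ ⊥ := by simpa using hμ
    obtain ⟨v, hv, hv0⟩ := Submodule.exists_mem_ne_zero_of_ne_bot hμ'
    have := happ N μ v hv
    rw [hf, Module.End.one_apply] at this
    have h2 : (μ ^ N - 1) • v = 0 := by rw [sub_smul, ← this, one_smul, sub_self]
    rcases smul_eq_zero.1 h2 with h | h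
    · exact sub_eq_zero.1 h
    · exact absurd h hv0
  · intro k
    have hmaps : ∀ μ, Set.MapsTo (f ^ k) (f.eigenspace μ) (f.eigenspace μ) := by
      intro μ v hv
      have hv' : v ∈ f.eigenspace μ := hv
      rw [happ k μ v hv']
      exact Submodule.smul_mem _ _ hv'
    rw [LinearMap.trace_eq_sum_trace_restrict' hds h_fin hmaps]
    refine Finset.sum_congr rfl fun μ _ => ?_
    have : (f ^ k).restrict (hmaps μ) = μ ^ k • (1 : End ℂ (f.eigenspace μ)) := by
      ext v
      exact happ k μ v v.2
    rw [this, map_smul, LinearMap.trace_one, smul_eq_mul, mul_comm]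

lemma rational_aux (K : Type) [Field K] [CharZero K] [Algebra ℚ K] {G : Type} [Group G] [Fintype G] {V : Type*} [AddCommGroup V] [Module ℂ V]
    [FiniteDimensional ℂ V] (ρ : Representation ℂ G V) (n : ℕ)
    [IsCyclotomicExtension {Fintype.card G} ℚ K] :
    ∃ q : ℚ, (1 / (Fintype.card G : ℂ)) * ∑ x : G, ρ.character (x ^ n) = (q : ℂ) := by
  classical
  generalize hNdef : Fintype.card G = N at *
  have hN : 0 < N := hNdef ▸ Fintype.card_pos
  have : NeZero N := ⟨hN.ne'⟩
  have : IsGalois ℚ K := IsCyclotomicExtension.isGalois {N} ℚ K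
  have : FiniteDimensional ℚ K := IsCyclotomicExtension.finiteDimensional {N} ℚ K
  have φ : K →ₐ[ℚ] ℂ := IsAlgClosed.lift
  have hζ := IsCyclotomicExtension.zeta_spec N ℚ K
  set ζ := IsCyclotomicExtension.zeta N ℚ K
  have hφζ : IsPrimitiveRoot (φ ζ) N := hζ.map_of_injective (RingHom.injective (φ : K →+* ℂ))
  have hr : ∀ μ : ℂ, ∃ z : K, μ ^ N = 1 → z ^ N = 1 ∧ φ z = μ := by
    intro μ
    by_cases h : μ ^ N = 1
    · obtain ⟨i, -, hi⟩ := hφζ.eq_pow_of_pow_eq_one h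
      refine ⟨ζ ^ i, fun _ => ⟨?_, by simpa using hi⟩⟩
      rw [← pow_mul, mul_comm, pow_mul, hζ.pow_eq_one, one_pow]
    · exact ⟨0, fun h' => absurd h' h⟩
  choose r hr using hr
  have hc : ∀ g : G, ∃ c : K, φ c = ρ.character g ∧ ∀ (σ : K ≃ₐ[ℚ] K) (k : ℕ),
      (∀ z : K, z ^ N = 1 → σ z = z ^ k) → φ (σ c) = ρ.character (g ^ k) := by
    intro g
    obtain ⟨s, m, hs, hm⟩ := trace_pow_eigen (ρ g) N hN
      (by rw [← map_pow, ← hNdef, pow_card_eq_one, map_one])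
    refine ⟨∑ μ ∈ s, (m μ : K) * r μ, ?_, ?_⟩
    · have := hm 1
      rw [pow_one] at this
      rw [Representation.character, this, map_sum]
      refine Finset.sum_congr rfl fun μ hμ => ?_
      simp [(hr μ (hs μ hμ)).2]
    · intro σ k hσ
      rw [Representation.character, map_pow, hm k, map_sum, map_sum]
      refine Finset.sum_congr rfl fun μ hμ => ?_
      simp [hσ _ (hr μ (hs μ hμ)).1, (hr μ (hs μ hμ)).2]
  choose c hc1 hc2 using hc
  let t : K := (1 / (N : K)) * ∑ x : G, c (x ^ n)
  have ht : φ t = (1 / (N : ℂ)) * ∑ x : G, ρ.character (x ^ n) := by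
    simp [t, hc1]
  have hfix : ∀ σ : K ≃ₐ[ℚ] K, σ t = t := by
    intro σ
    have h1 : IsPrimitiveRoot (σ ζ) N := hζ.map_of_injective σ.injective
    obtain ⟨k, -, hk, hk2⟩ := hζ.isPrimitiveRoot_iff.1 h1
    have hσ : ∀ z : K, z ^ N = 1 → σ z = z ^ k := by
      intro z hz
      obtain ⟨i, -, rfl⟩ := hζ.eq_pow_of_pow_eq_one hz
      rw [map_pow, ← hk2, ← pow_mul, ← pow_mul, mul_comm]
    refine (RingHom.injective (φ : K →+* ℂ)) ?_
    change φ (σ t) = φ t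
    have : φ (σ t) = (1 / (N : ℂ)) * ∑ x : G, ρ.character ((x ^ n) ^ k) := by
      simp [t, fun x => hc2 x σ k hσ]
    rw [this, ht]
    congr 1
    have hcop : (Nat.card G).Coprime k := by
      rw [Nat.card_eq_fintype_card]; rw [hNdef]; exact hk.symm
    rw [← (powCoprime hcop).sum_comp (fun x => ρ.character (x ^ n))]
    refine Finset.sum_congr rfl fun x _ => ?_
    simp [← pow_mul, mul_comm]
  obtain ⟨q, hq⟩ := (IsGalois.mem_range_algebraMap_iff_fixed t).2 hfix
  refine ⟨q, ?_⟩
  rw [← ht, ← hq]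
  simp

lemma rational {G : Type} [Group G] [Fintype G] {V : Type*} [AddCommGroup V] [Module ℂ V]
    [FiniteDimensional ℂ V] (ρ : Representation ℂ G V) (n : ℕ) :
    ∃ q : ℚ, (1 / (Fintype.card G : ℂ)) * ∑ x : G, ρ.character (x ^ n) = (q : ℂ) := by
  have : NeZero (Fintype.card G) := ⟨Fintype.card_ne_zero⟩
  have : NeZero ((Fintype.card G : ℕ) : ℚ) := ⟨by exact_mod_cast Fintype.card_ne_zero⟩
  have h := CyclotomicField.isCyclotomicExtension (Fintype.card G) ℚ
  have : IsCyclotomicExtension {Fintype.card G} ℚ (CyclotomicField (Fintype.card G) ℚ) := by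
    convert! h
  exact rational_aux (CyclotomicField (Fintype.card G) ℚ) ρ n

lemma trace_integral {ι : Type*} [Fintype ι] [DecidableEq ι] (M : Matrix ι ι ℂ) (k : ℕ)
    (hk : 0 < k) (h : M ^ (k + 1) = M) : IsIntegral ℤ M.trace := by
  rw [Matrix.trace_eq_sum_roots_charpoly]
  refine IsIntegral.multiset_sum fun μ hμ => ?_
  have h1 : μ ∈ spectrum ℂ M :=
    Matrix.mem_spectrum_of_isRoot_charpoly (Polynomial.isRoot_of_mem_roots hμ)
  have h2 := spectrum.subset_polynomial_aeval M (Polynomial.X ^ (k + 1) - Polynomial.X)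
    ⟨μ, h1, rfl⟩
  have h0 : Polynomial.aeval M (Polynomial.X ^ (k + 1) - Polynomial.X : Polynomial ℂ) = 0 := by
    simp [h]
  rw [h0] at h2
  have : μ ^ (k + 1) - μ = 0 := by
    by_contra hne
    rw [spectrum.mem_iff] at h2
    apply h2
    simp only [Polynomial.eval_sub, Polynomial.eval_pow, Polynomial.eval_X, sub_zero]
    exact (IsUnit.mk0 _ hne).map _
  by_cases hμ0 : μ = 0
  · rw [hμ0]; exact isIntegral_zero
  · have h3 : μ ^ k = 1 := by
      have : μ * (μ ^ k - 1) = 0 := by rw [← this]; ring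
      rcases mul_eq_zero.1 this with h | h
      · exact absurd h hμ0
      · exact sub_eq_zero.1 h
    refine IsIntegral.of_pow hk ?_
    rw [h3]; exact isIntegral_one

lemma path_trace {ι : Type*} [Fintype ι] [DecidableEq ι] (A : Matrix ι ι ℂ) (m : ℕ) :
    ∀ B : Matrix ι ι ℂ, ∑ f : Fin (m + 1) → ι,
      (∏ i : Fin m, A (f i.castSucc) (f i.succ)) * B (f (Fin.last m)) (f 0)
      = (A ^ m * B).trace := by
  induction m with
  | zero =>
    intro B
    rw [← (Equiv.funUnique (Fin 1) ι).symm.sum_comp]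
    simp [Matrix.trace]
  | succ m ih =>
    intro B
    rw [pow_succ, mul_assoc, ← ih (A * B),
      ← (Fin.snocEquiv (fun _ : Fin (m + 2) => ι)).sum_comp, Fintype.sum_prod_type_right]
    refine Finset.sum_congr rfl fun f _ => ?_
    rw [Matrix.mul_apply, Finset.mul_sum]
    refine Finset.sum_congr rfl fun b _ => ?_
    rw [Fin.prod_univ_castSucc]
    have h0 : (Fin.snoc f b : Fin (m + 2) → ι) 0 = f 0 := by
      rw [← Fin.castSucc_zero, Fin.snoc_castSucc]
    simp only [Fin.snocEquiv_apply, Fin.snoc_castSucc, Fin.succ_last, Fin.snoc_last, h0,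
      Fin.succ_castSucc]
    ring

/-- Kronecker power of a matrix. -/
def kron {ι : Type*} (n : ℕ) (A : Matrix ι ι ℂ) : Matrix (Fin n → ι) (Fin n → ι) ℂ :=
  Matrix.of fun f g => ∏ i, A (f i) (g i)

lemma kron_mul {ι : Type*} [Fintype ι] [DecidableEq ι] (n : ℕ) (A B : Matrix ι ι ℂ) :
    kron n (A * B) = kron n A * kron n B := by
  ext f g
  simp only [kron, Matrix.of_apply, Matrix.mul_apply, ← Finset.prod_mul_distrib]
  rw [Finset.prod_univ_sum, Fintype.piFinset_univ]

lemma integral {G : Type} [Group G] [Fintype G] {ι : Type*} [Fintype ι] [DecidableEq ι]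
    (ρ : G →* Matrix ι ι ℂ) (m : ℕ) :
    IsIntegral ℤ ((1 / (Fintype.card G : ℂ)) * ∑ x : G, (ρ (x ^ (m + 1))).trace) := by
  classical
  let e : Equiv.Perm (Fin (m + 1) → ι) := Equiv.arrowCongr (finRotate (m + 1)).symm (Equiv.refl ι)
  have he : ∀ f i, e f i = f (finRotate (m + 1) i) := fun f i => rfl
  let C' := Matrix.permMatrixHom (n := Fin (m + 1) → ι) (R := ℂ) e⁻¹
  let E : Matrix (Fin (m + 1) → ι) (Fin (m + 1) → ι) ℂ :=
    (1 / (Fintype.card G : ℂ)) • ∑ x : G, kron (m + 1) (ρ x)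
  have hCmul : ∀ X, C' * X = X.submatrix e id := fun X => by
    simp only [C', Matrix.permMatrixHom_apply, inv_inv]
    exact PEquiv.toMatrix_toPEquiv_mul _ _
  have hmulC : ∀ X, X * C' = X.submatrix id e.symm := fun X => by
    simp only [C', Matrix.permMatrixHom_apply, inv_inv]
    exact PEquiv.mul_toMatrix_toPEquiv _ _
  have hcard : (Fintype.card G : ℂ) ≠ 0 := by exact_mod_cast Fintype.card_ne_zero
  have hEE : E * E = E := by
    simp only [E, Matrix.smul_mul, Matrix.mul_smul, Finset.sum_mul_sum, ← kron_mul, ← map_mul]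
    have : ∀ x : G, ∑ y : G, kron (m + 1) (ρ (x * y)) = ∑ y : G, kron (m + 1) (ρ y) := fun x =>
      Equiv.sum_comp (Equiv.mulLeft x) (fun y => kron (m + 1) (ρ y))
    simp only [this, Finset.sum_const, Finset.card_univ]
    rw [← Nat.cast_smul_eq_nsmul ℂ, smul_smul (1 / (Fintype.card G : ℂ)) (Fintype.card G : ℂ),
      one_div_mul_cancel hcard, one_smul]
  have hcomm1 : ∀ A : Matrix ι ι ℂ, Commute C' (kron (m + 1) A) := by
    intro A
    rw [Commute, SemiconjBy, hCmul, hmulC]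
    ext f g
    simp only [kron, Matrix.submatrix_apply, Matrix.of_apply, id]
    rw [← Equiv.prod_comp (finRotate (m + 1)) (fun i => A (f i) (e.symm g i))]
    refine Finset.prod_congr rfl fun i _ => ?_
    have h1 := he (e.symm g) i
    rw [Equiv.apply_symm_apply] at h1
    rw [← h1, he f i]
  have hcomm : Commute C' E :=
    (Commute.sum_right _ _ _ fun x _ => hcomm1 (ρ x)).smul_right _
  have hpow : (C' * E) ^ (orderOf e + 1) = C' * E := by
    have hE : ∀ k, E ^ (k + 1) = E := fun k => by
      have hI : IsIdempotentElem E := hEE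
      exact hI.pow_succ_eq k
    rw [hcomm.mul_pow, hE, pow_succ, ← map_pow, inv_pow, pow_orderOf_eq_one, inv_one, map_one,
      one_mul]
  have htr : (C' * E).trace = (1 / (Fintype.card G : ℂ)) * ∑ x : G, (ρ (x ^ (m + 1))).trace := by
    simp only [E, Matrix.mul_smul, Matrix.trace_smul, smul_eq_mul, Finset.mul_sum,
      Matrix.trace_sum]
    refine Finset.sum_congr rfl fun x _ => ?_
    congr 1
    have hT : (ρ x ^ (m + 1)).trace = ((ρ x).transpose ^ m * (ρ x).transpose).trace := by
      rw [← pow_succ, ← Matrix.transpose_pow, Matrix.trace_transpose]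
    rw [map_pow, hT, hCmul, ← path_trace]
    refine Finset.sum_congr rfl fun f _ => ?_
    simp only [Matrix.diag_apply, Matrix.submatrix_apply, kron, Matrix.of_apply, id]
    rw [Fin.prod_univ_castSucc]
    simp [he, Matrix.transpose_apply]
  rw [← htr]
  exact trace_integral _ (orderOf e) (orderOf_pos e) hpow

end FSInd

/-- For any finite group `G`, irreducible complex character `χ` of `G` and
positive integer `n`, the `n`-th Frobenius–Schur indicator
`ν_n(χ) = (1/|G|) Σ_{x∈G} χ(x^n)` is an integer. -/
theorem stmt10 (G : Type) [Group G] [Fintype G] (V : FDRep ℂ G) (hV : Simple V)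
    (n : ℕ) (hn : 0 < n) :
    ∃ m : ℤ, (1 / (Fintype.card G : ℂ)) * ∑ x : G, V.character (x ^ n) = (m : ℂ) := by
  classical
  obtain ⟨m, rfl⟩ : ∃ m, n = m + 1 := ⟨n - 1, by omega⟩
  obtain ⟨q, hq⟩ := FSInd.rational V.ρ (m + 1)
  let b := Module.finBasis ℂ V
  let ρ' : G →* Matrix (Fin (Module.finrank ℂ V)) (Fin (Module.finrank ℂ V)) ℂ :=
    (LinearMap.toMatrixAlgEquiv b).toRingEquiv.toMonoidHom.comp V.ρ
  have hint := FSInd.integral ρ' m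
  have hch : ∀ g : G, (ρ' g).trace = Representation.character V.ρ g := fun g =>
    (LinearMap.trace_eq_matrix_trace ℂ b (V.ρ g)).symm
  simp only [hch] at hint
  rw [hq] at hint
  have hint' : IsIntegral ℤ q := by
    have : IsIntegral ℤ (algebraMap ℚ ℂ q) := by simpa using hint
    exact (isIntegral_algebraMap_iff (algebraMap ℚ ℂ).injective).1 this
  obtain ⟨z, hz⟩ := IsIntegrallyClosed.isIntegral_iff.1 hint'
  refine ⟨z, ?_⟩
  have : (q : ℂ) = (z : ℂ) := by rw [← hz]; simp
  rw [← this, ← hq]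
  rfl
end

section
/- For q ≡ 1 (mod 2) an odd prime power and Γ the free group on r generators (r ≥ 1), the number of isomorphism classes of semisimple 2-dimensional representations of Γ over 𝔽_q with trivial determinant equals (q³−q)^{r−1} − (q²−q)^{r−1} + q·((q+1)^{r−1} + (q−1)^{r−1})/2. -/
set_option linter.unusedSectionVars false
set_option linter.unusedSimpArgs false
namespace S16
open Matrix

section gen

lemma card_swap {α β : Type} [Fintype α] [Fintype β] (P : α → β → Prop) :
    ∑ a, Nat.card {b // P a b} = ∑ b, Nat.card {a // P a b} := by
  classical
  rw [← Nat.card_sigma, ← Nat.card_sigma]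
  exact Nat.card_congr
    { toFun := fun x => ⟨x.2.1, x.1, x.2.2⟩
      invFun := fun x => ⟨x.2.1, x.1, x.2.2⟩
      left_inv := fun x => rfl
      right_inv := fun x => rfl }

lemma card_tuples {α : Type} (r : ℕ) (P : α → Prop) :
    Nat.card {ρ : Fin r → α // ∀ i, P (ρ i)} = Nat.card {a // P a} ^ r := by
  rw [Nat.card_congr (Equiv.subtypePiEquivPi (p := fun (_ : Fin r) a => P a)), Nat.card_fun]
  simp

lemma card_offdiag {α : Type} [Finite α] (P : α → Prop) :
    (Nat.card {p : α × α // p.1 ≠ p.2 ∧ P p.1 ∧ P p.2} : ℚ) =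
      Nat.card {a // P a} * (Nat.card {a // P a} - 1) := by
  classical
  have := Fintype.ofFinite α
  have h : Nat.card {p : α × α // p.1 ≠ p.2 ∧ P p.1 ∧ P p.2} =
      (Finset.univ.filter P).offDiag.card := by
    rw [Nat.card_eq_fintype_card, Fintype.card_subtype]
    congr 1
    ext p
    simp [Finset.mem_offDiag]
    tauto
  rw [h, Finset.offDiag_card, Nat.card_eq_fintype_card, Fintype.card_subtype,
    Nat.cast_sub (Nat.le_mul_self _)]
  push_cast
  ring

lemma card_compl {α : Type} [Finite α] (P : α → Prop) :
    (Nat.card {a // ¬ P a} : ℚ) = Nat.card α - Nat.card {a // P a} := by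
  classical
  have := Fintype.ofFinite α
  have h := Nat.card_congr (Equiv.sumCompl P)
  rw [Nat.card_sum] at h
  rw [← h]
  push_cast
  ring

end gen

variable {F : Type} [Field F]

/-- Root of a binary quadratic form at a point of the projective line. -/
def Root (A B C : F) : Option F → Prop
  | none => A = 0
  | some m => A * m ^ 2 + B * m + C = 0

/-- The matrix `M` fixes the point `L` of the projective line. -/
def Fx (M : Matrix (Fin 2) (Fin 2) F) (L : Option F) : Prop :=
  Root (M 1 0) (M 1 1 - M 0 0) (-(M 0 1)) L

/-- Representative vector of a point. -/
def pv : Option F → Fin 2 → F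
  | none => ![1, 0]
  | some m => ![m, 1]

lemma pv_ne (L : Option F) : pv L ≠ 0 := by
  cases L with
  | none => intro h; simpa [pv] using congrFun h 0
  | some m => intro h; simpa [pv] using congrFun h 1

lemma fx_iff (M : Matrix (Fin 2) (Fin 2) F) (L : Option F) :
    Fx M L ↔ ∃ l : F, M.mulVec (pv L) = l • pv L := by
  cases L with
  | none =>
    simp only [Fx, Root, pv]
    constructor
    · intro h
      refine ⟨M 0 0, ?_⟩
      ext i
      fin_cases i <;> simp [mulVec, dotProduct, Fin.sum_univ_two, h]
    · rintro ⟨l, h⟩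
      simpa [mulVec, dotProduct, Fin.sum_univ_two] using congrFun h 1
  | some m =>
    simp only [Fx, Root, pv]
    constructor
    · intro h
      refine ⟨M 1 0 * m + M 1 1, ?_⟩
      ext i
      fin_cases i
      · simp [mulVec, dotProduct, Fin.sum_univ_two]
        linear_combination -h
      · simp [mulVec, dotProduct, Fin.sum_univ_two]
    · rintro ⟨l, h⟩
      have h0 := congrFun h 0
      have h1 := congrFun h 1
      simp [mulVec, dotProduct, Fin.sum_univ_two] at h0 h1
      linear_combination -h0 + m * h1

lemma exists_pv (v : Fin 2 → F) (hv : v ≠ 0) : ∃ L : Option F, ∃ l : F, l ≠ 0 ∧ v = l • pv L := by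
  by_cases h : v 1 = 0
  · refine ⟨none, v 0, ?_, ?_⟩
    · intro h0
      apply hv
      ext i
      fin_cases i <;> simp [h, h0]
    · ext i
      fin_cases i <;> simp [pv, h]
  · refine ⟨some (v 0 / v 1), v 1, h, ?_⟩
    ext i
    fin_cases i
    · simp [pv]; field_simp
    · simp [pv]

lemma pv_inj {L L' : Option F} {l : F} (h : pv L = l • pv L') : L = L' := by
  cases L <;> cases L'
  · rfl
  · have h0 := congrFun h 0
    have h1 := congrFun h 1
    simp [pv] at h0 h1
    simp [← h1] at h0
  · have h1 := congrFun h 1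
    simp [pv] at h1
  · have h0 := congrFun h 0
    have h1 := congrFun h 1
    simp [pv] at h0 h1
    simp [h0, ← h1]

section counting
variable [Fintype F]


lemma sl_det (M : (SpecialLinearGroup (Fin 2) F)) : M 0 0 * M 1 1 - M 0 1 * M 1 0 = 1 := by
  have := M.2
  rwa [det_fin_two] at this

/-- Make an element of SL2. -/
def mk (a b c d : F) (h : a * d - b * c = 1) : (SpecialLinearGroup (Fin 2) F) :=
  ⟨!![a, b; c, d], by rw [det_fin_two_of, h]⟩

lemma sl_ext {M N : (SpecialLinearGroup (Fin 2) F)} (h0 : M 0 0 = N 0 0) (h1 : M 0 1 = N 0 1) (h2 : M 1 0 = N 1 0)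
    (h3 : M 1 1 = N 1 1) : M = N := by
  ext i j
  fin_cases i <;> fin_cases j <;> assumption

lemma card_F : Nat.card F = Fintype.card F := Nat.card_eq_fintype_card

lemma card_units_Q : (Nat.card Fˣ : ℚ) = (Fintype.card F : ℚ) - 1 := by
  classical
  rw [Nat.card_eq_fintype_card, Fintype.card_units, Nat.cast_sub Fintype.card_pos]
  simp

lemma card_fx (L : Option F) :
    (Nat.card {M : (SpecialLinearGroup (Fin 2) F) // Fx (M : Matrix _ _ F) L} : ℚ)
      = (Fintype.card F : ℚ) ^ 2 - Fintype.card F := by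
  have : (Nat.card (Fˣ × F) : ℚ) = (Fintype.card F : ℚ) ^ 2 - Fintype.card F := by
    rw [Nat.card_prod]
    push_cast
    rw [card_units_Q, card_F]
    ring
  rw [← this]
  congr 1
  symm
  cases L with
  | none =>
    refine Nat.card_eq_of_bijective (fun p : Fˣ × F => (⟨mk (p.1 : F) p.2 0 (p.1 : F)⁻¹ (by simp),
      by simp [Fx, Root, mk]⟩ : {M : (SpecialLinearGroup (Fin 2) F) // Fx (M : Matrix _ _ F) none})) ⟨?_, ?_⟩
    · rintro ⟨u, b⟩ ⟨u', b'⟩ h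
      have h' := congrArg (fun x : {M : (SpecialLinearGroup (Fin 2) F) // Fx (M : Matrix _ _ F) none} => (x.1 0 0, x.1 0 1)) h
      simp [mk] at h'
      ext <;> simp [h']
    · rintro ⟨M, hM⟩
      simp only [Fx, Root] at hM
      have hd := sl_det M
      rw [hM] at hd
      have h0 : M 0 0 ≠ 0 := by
        intro h; simp [h] at hd
      refine ⟨(Units.mk0 _ h0, M 0 1), ?_⟩
      apply Subtype.ext
      apply sl_ext <;> simp [mk, hM]
      field_simp
      linear_combination -hd
  | some m =>
    refine Nat.card_eq_of_bijective (fun p : Fˣ × F => (⟨mk ((p.1 : F) + p.2 * m)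
      (p.2 * m ^ 2 + (((p.1 : F)⁻¹ - p.2 * m) - ((p.1 : F) + p.2 * m)) * m) p.2
      ((p.1 : F)⁻¹ - p.2 * m) (by
        have := p.1.ne_zero
        field_simp
        ring),
      by simp [Fx, Root, mk]⟩ : {M : (SpecialLinearGroup (Fin 2) F) // Fx (M : Matrix _ _ F) (some m)})) ⟨?_, ?_⟩
    · rintro ⟨u, b⟩ ⟨u', b'⟩ h
      have h' := congrArg (fun x : {M : (SpecialLinearGroup (Fin 2) F) // Fx (M : Matrix _ _ F) (some m)} =>
        (x.1 0 0, x.1 1 0)) h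
      simp [mk] at h'
      obtain ⟨h1, rfl⟩ := h'
      ext <;> simp
      simpa using h1
    · rintro ⟨M, hM⟩
      simp only [Fx, Root] at hM
      have hd := sl_det M
      have hk : (M 0 0 - M 1 0 * m) * (M 1 1 + M 1 0 * m) = 1 := by
        linear_combination hd - M 1 0 * hM
      have h0 : M 0 0 - M 1 0 * m ≠ 0 := left_ne_zero_of_mul_eq_one hk
      have hi : (M 0 0 - M 1 0 * m)⁻¹ = M 1 1 + M 1 0 * m := inv_eq_of_mul_eq_one_right hk
      refine ⟨(Units.mk0 _ h0, M 1 0), ?_⟩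
      apply Subtype.ext
      apply sl_ext <;> simp [mk, hi]
      linear_combination hM

lemma card_fx2 (L L' : Option F) (hL : L ≠ L') :
    (Nat.card {M : (SpecialLinearGroup (Fin 2) F) // Fx (M : Matrix _ _ F) L ∧ Fx (M : Matrix _ _ F) L'} : ℚ)
      = (Fintype.card F : ℚ) - 1 := by
  rw [← card_units_Q]
  congr 1
  symm
  have key : ∀ m : F, Nat.card Fˣ =
      Nat.card {M : (SpecialLinearGroup (Fin 2) F) // Fx (M : Matrix _ _ F) none ∧ Fx (M : Matrix _ _ F) (some m)} := by
    intro m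
    refine Nat.card_eq_of_bijective (fun p : Fˣ => (⟨mk (p : F) (((p : F)⁻¹ - p) * m) 0 (p : F)⁻¹
      (by simp), by simp [Fx, Root, mk]⟩ : {M : (SpecialLinearGroup (Fin 2) F) // Fx (M : Matrix _ _ F) none ∧
        Fx (M : Matrix _ _ F) (some m)})) ⟨?_, ?_⟩
    · intro u u' h
      have h' := congrArg (fun x : {M : (SpecialLinearGroup (Fin 2) F) // Fx (M : Matrix _ _ F) none ∧
        Fx (M : Matrix _ _ F) (some m)} => (x.1 0 0)) h
      simp [mk] at h'
      ext; simp [h']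
    · rintro ⟨M, hM, hM'⟩
      simp only [Fx, Root] at hM hM'
      have hd := sl_det M
      rw [hM] at hd hM'
      have h0 : M 0 0 ≠ 0 := by
        intro h; simp [h] at hd
      have hi : (M 0 0)⁻¹ = M 1 1 := inv_eq_of_mul_eq_one_right (by linear_combination hd)
      refine ⟨Units.mk0 _ h0, ?_⟩
      apply Subtype.ext
      apply sl_ext <;> simp [mk, hM, hi]
      linear_combination hM'
  cases L with
  | none =>
    cases L' with
    | none => exact absurd rfl hL
    | some m => exact key m
  | some m =>
    cases L' with
    | none =>
      rw [key m]
      exact Nat.card_congr (Equiv.subtypeEquivRight fun M => and_comm)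
    | some m' =>
      have hm : m - m' ≠ 0 := sub_ne_zero.mpr fun h => hL (by rw [h])
      have hm' : m' - m ≠ 0 := sub_ne_zero.mpr fun h => hL (by rw [h])
      refine Nat.card_eq_of_bijective (fun p : Fˣ => (⟨mk
        ((p : F) + ((p : F)⁻¹ - p) / (m - m') * m)
        (-((p : F)⁻¹ - p) / (m - m') * m * m')
        (((p : F)⁻¹ - p) / (m - m'))
        ((p : F) + ((p : F)⁻¹ - p) / (m - m') * m - ((p : F)⁻¹ - p) / (m - m') * (m + m'))
        ?_, ?_, ?_⟩ : {M : (SpecialLinearGroup (Fin 2) F) // Fx (M : Matrix _ _ F) (some m) ∧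
          Fx (M : Matrix _ _ F) (some m')})) ⟨?_, ?_⟩
      · have := p.ne_zero
        field_simp
        ring
      · simp only [Fx, Root, mk]
        simp
        ring
      · simp only [Fx, Root, mk]
        simp
        ring
      · intro u u' h
        have h' := congrArg (fun x : {M : (SpecialLinearGroup (Fin 2) F) // Fx (M : Matrix _ _ F) (some m) ∧
          Fx (M : Matrix _ _ F) (some m')} => (x.1 0 0, x.1 1 0)) h
        simp only [mk, Prod.mk.injEq] at h'
        obtain ⟨h1, h2⟩ := h'
        simp at h1 h2
        ext
        linear_combination h1 - m * h2
      · rintro ⟨M, hM, hM'⟩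
        simp only [Fx, Root] at hM hM'
        have hd := sl_det M
        have h1 : M 1 1 = M 0 0 - M 1 0 * (m + m') := by
          apply mul_left_cancel₀ hm
          linear_combination hM - hM'
        have h2 : M 0 1 = - M 1 0 * m * m' := by
          rw [h1] at hM; linear_combination -hM
        have hk : (M 0 0 - M 1 0 * m) * (M 0 0 - M 1 0 * m') = 1 := by
          rw [h1, h2] at hd
          linear_combination hd
        have h0 : M 0 0 - M 1 0 * m ≠ 0 := left_ne_zero_of_mul_eq_one hk
        have hi : (M 0 0 - M 1 0 * m)⁻¹ = M 0 0 - M 1 0 * m' := inv_eq_of_mul_eq_one_right hk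
        have hq : (M 0 0 - M 1 0 * m' - (M 0 0 - M 1 0 * m)) / (m - m') = M 1 0 := by
          field_simp; ring
        refine ⟨Units.mk0 _ h0, ?_⟩
        apply Subtype.ext
        apply sl_ext
        · simp only [mk]
          simp only [Units.val_mk0, hi, hq]
          simp
        · simp only [mk]
          simp only [Units.val_mk0, hi, neg_div, hq]
          simp [h2]
        · simp only [mk]
          simp only [Units.val_mk0, hi, hq]
          simp
        · simp only [mk]
          simp only [Units.val_mk0, hi, hq]
          simp [h1]

lemma card_SL : (Nat.card (SpecialLinearGroup (Fin 2) F) : ℚ) = (Fintype.card F : ℚ) ^ 3 - Fintype.card F := by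
  have h1 := card_compl (fun M : (SpecialLinearGroup (Fin 2) F) => Fx (M : Matrix _ _ F) none)
  rw [card_fx] at h1
  have h2 : Nat.card {M : (SpecialLinearGroup (Fin 2) F) // ¬ Fx (M : Matrix _ _ F) none} = Nat.card (Fˣ × F × F) := by
    symm
    refine Nat.card_eq_of_bijective (fun p : Fˣ × F × F =>
      (⟨mk p.2.1 ((p.2.1 * p.2.2 - 1) / p.1) p.1 p.2.2 (by
        have := p.1.ne_zero
        field_simp; ring), by simp [Fx, Root, mk]⟩ :
        {M : (SpecialLinearGroup (Fin 2) F) // ¬ Fx (M : Matrix _ _ F) none})) ⟨?_, ?_⟩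
    · rintro ⟨u, b, c⟩ ⟨u', b', c'⟩ h
      have h' := congrArg (fun x : {M : (SpecialLinearGroup (Fin 2) F) // ¬ Fx (M : Matrix _ _ F) none} =>
        (x.1 0 0, x.1 1 0, x.1 1 1)) h
      simp [mk] at h'
      ext <;> simp [h']
    · rintro ⟨M, hM⟩
      simp only [Fx, Root] at hM
      have hd := sl_det M
      refine ⟨(Units.mk0 _ hM, M 0 0, M 1 1), ?_⟩
      apply Subtype.ext
      apply sl_ext <;> simp [mk]
      field_simp
      linear_combination hd
  rw [h2, Nat.card_prod, Nat.card_prod] at h1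
  push_cast at h1
  rw [card_units_Q, card_F] at h1
  linear_combination -h1

end counting

section chars
variable [Fintype F] [DecidableEq F]

/-- The quadratic character with rational values. -/
def chi (d : F) : ℚ := ((quadraticChar F d : ℤ) : ℚ)

lemma chi_zero : chi (0 : F) = 0 := by simp [chi]

lemma chi_cases (d : F) (hd : d ≠ 0) : chi d = 1 ∨ chi d = -1 := by
  rcases quadraticChar_dichotomy hd with h | h <;> simp [chi, h]

lemma chi_sq (a : F) (ha : a ≠ 0) : chi (a ^ 2) = 1 := by
  rw [chi, quadraticChar_sq_one' ha]; simp

lemma chi_four (h2 : (2 : F) ≠ 0) (d : F) : chi (4 * d) = chi d := by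
  have h4 : (4 : F) = 2 ^ 2 := by norm_num
  rw [chi, map_mul, h4, quadraticChar_sq_one' h2, one_mul, chi]

lemma card_sqrt (hF : ringChar F ≠ 2) (d : F) :
    (Nat.card {x : F // x ^ 2 = d} : ℚ) = 1 + chi d := by
  have h := quadraticChar_card_sqrts hF d
  have h' : Nat.card {x : F // x ^ 2 = d} = ({x : F | x ^ 2 = d}.toFinset).card := by
    rw [Nat.card_eq_fintype_card, Fintype.card_subtype]
    congr 1
    ext; simp
  rw [h', chi]
  have := congrArg (fun z : ℤ => (z : ℚ)) h
  simp only [Int.cast_natCast] at this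
  rw [this]
  push_cast
  ring

lemma card_sum_ite {α : Type} [Fintype α] (P : α → Prop) [DecidablePred P] :
    Nat.card {a // P a} = ∑ a, if P a then 1 else 0 := by
  rw [Nat.card_eq_fintype_card, Fintype.card_subtype]
  simp

lemma card_option_sub (P : Option F → Prop) [DecidablePred P] :
    Nat.card {L // P L} = (if P none then 1 else 0) + Nat.card {m // P (some m)} := by
  rw [card_sum_ite, card_sum_ite, Fintype.sum_option]

lemma card_root (hF : ringChar F ≠ 2) (h2 : (2 : F) ≠ 0) (A B C : F)
    (h : ¬ (A = 0 ∧ B = 0 ∧ C = 0)) :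
    (Nat.card {L // Root A B C L} : ℚ) = 1 + chi (B ^ 2 - 4 * A * C) := by
  classical
  rw [card_option_sub]
  simp only [Root]
  by_cases hA : A = 0
  · subst hA
    by_cases hB : B = 0
    · subst hB
      have hC : C ≠ 0 := by tauto
      have : IsEmpty {m : F // (0 : F) * m ^ 2 + 0 * m + C = 0} := ⟨fun m => hC (by simpa using m.2)⟩
      simp [chi_zero, hC]
    · have : Nat.card {m : F // (0 : F) * m ^ 2 + B * m + C = 0} = 1 := by
        rw [Nat.card_eq_one_iff_unique]
        refine ⟨⟨fun x y => ?_⟩, ⟨⟨-C / B, by field_simp; ring⟩⟩⟩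
        apply Subtype.ext
        apply mul_left_cancel₀ hB
        linear_combination x.2 - y.2
      rw [this]
      norm_num [chi_sq _ hB]
  · rw [← card_sqrt hF]
    simp only [hA, if_false, zero_add]
    congr 1
    have h2A : 2 * A ≠ 0 := mul_ne_zero h2 hA
    refine Nat.card_eq_of_bijective (fun m : {m : F // A * m ^ 2 + B * m + C = 0} =>
      (⟨2 * A * m.1 + B, by linear_combination 4 * A * m.2⟩ :
        {x : F // x ^ 2 = B ^ 2 - 4 * A * C})) ⟨?_, ?_⟩
    · intro x y hxy
      simp only [Subtype.mk.injEq, add_left_inj] at hxy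
      exact Subtype.ext (mul_left_cancel₀ h2A hxy)
    · rintro ⟨x, hx⟩
      refine ⟨⟨(x - B) / (2 * A), ?_⟩, ?_⟩
      · field_simp
        linear_combination hx
      · apply Subtype.ext
        simp only
        field_simp
        ring

lemma card_conic (hF : ringChar F ≠ 2) (h2 : (2 : F) ≠ 0) (d : F) (hd : d ≠ 0) :
    (Nat.card {p : F × F // p.1 ^ 2 - d * p.2 ^ 2 = 1} : ℚ) = Fintype.card F - chi d := by
  have h1 := card_compl (fun m : F => d * m ^ 2 = 1)
  have h3 : Nat.card {m : F // d * m ^ 2 = 1} = Nat.card {x : F // x ^ 2 = d} := by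
    refine Nat.card_eq_of_bijective (fun m : {m : F // d * m ^ 2 = 1} =>
      (⟨d * m.1, by linear_combination d * m.2⟩ : {x : F // x ^ 2 = d})) ⟨?_, ?_⟩
    · intro x y hxy
      simp only [Subtype.mk.injEq] at hxy
      exact Subtype.ext (mul_left_cancel₀ hd hxy)
    · rintro ⟨x, hx⟩
      refine ⟨⟨x / d, ?_⟩, ?_⟩
      · field_simp
        exact hx
      · apply Subtype.ext
        simp only
        field_simp
  rw [h3, card_sqrt hF, card_F (F := F)] at h1
  have h4 : Nat.card (Option {m : F // ¬ d * m ^ 2 = 1}) =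
      Nat.card {p : F × F // p.1 ^ 2 - d * p.2 ^ 2 = 1} := by
    let φ : Option {m : F // ¬ d * m ^ 2 = 1} → {p : F × F // p.1 ^ 2 - d * p.2 ^ 2 = 1} :=
      fun o => match o with
      | none => ⟨(-1, 0), by simp⟩
      | some m => ⟨((1 + d * m.1 ^ 2) / (1 - d * m.1 ^ 2), 2 * m.1 / (1 - d * m.1 ^ 2)), by
          have h : 1 - d * m.1 ^ 2 ≠ 0 := fun h => m.2 (by linear_combination -h)
          simp only
          field_simp
          ring⟩
    have hne : ∀ m : {m : F // ¬ d * m ^ 2 = 1}, 1 - d * m.1 ^ 2 ≠ 0 :=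
      fun m h => m.2 (by linear_combination -h)
    have hx : ∀ m : {m : F // ¬ d * m ^ 2 = 1},
        (1 + d * m.1 ^ 2) / (1 - d * m.1 ^ 2) + 1 = 2 / (1 - d * m.1 ^ 2) := by
      intro m
      have := hne m
      field_simp
      ring
    refine Nat.card_eq_of_bijective φ ⟨?_, ?_⟩
    · intro x y hxy
      cases x with
      | none =>
        cases y with
        | none => rfl
        | some m =>
          exfalso
          simp only [φ, Subtype.mk.injEq, Prod.mk.injEq] at hxy
          have := hx m
          rw [← hxy.1] at this
          have h5 := hne m
          field_simp at this
          apply h2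
          linear_combination -this
      | some m' =>
        cases y with
        | none =>
          exfalso
          simp only [φ, Subtype.mk.injEq, Prod.mk.injEq] at hxy
          have := hx m'
          rw [hxy.1] at this
          have h5 := hne m'
          field_simp at this
          apply h2
          linear_combination -this
        | some m =>
          simp only [φ, Subtype.mk.injEq, Prod.mk.injEq] at hxy
          obtain ⟨e1, e2⟩ := hxy
          have e3 := hx m
          rw [← e1, hx m'] at e3
          have h5 := hne m
          have h6 := hne m'
          congr 1
          apply Subtype.ext
          have e4 : 2 * m'.1 / (1 - d * m'.1 ^ 2) = m'.1 * (2 / (1 - d * m'.1 ^ 2)) := by ring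
          have e5 : 2 * m.1 / (1 - d * m.1 ^ 2) = m.1 * (2 / (1 - d * m.1 ^ 2)) := by ring
          rw [e4, e5, ← e3] at e2
          exact mul_right_cancel₀ (div_ne_zero h2 h6) e2
    · rintro ⟨⟨x, y⟩, hp⟩
      simp only at hp
      by_cases hx1 : x + 1 = 0
      · have hx' : x = -1 := by linear_combination hx1
        subst hx'
        have : d * y ^ 2 = 0 := by linear_combination -hp
        have hy : y = 0 := by simpa [hd] using this
        subst hy
        exact ⟨none, rfl⟩
      · have hm : 1 - d * (y / (x + 1)) ^ 2 = 2 / (x + 1) := by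
          field_simp
          linear_combination hp
        have hm0 : 2 / (x + 1) ≠ 0 := div_ne_zero h2 hx1
        refine ⟨some ⟨y / (x + 1), fun h => hm0 (by rw [← hm, h]; ring)⟩, ?_⟩
        apply Subtype.ext
        simp only [φ]
        have hm2 : 1 + d * (y / (x + 1)) ^ 2 = 2 * x / (x + 1) := by
          have : d * (y / (x + 1)) ^ 2 = 1 - 2 / (x + 1) := by linear_combination -hm
          rw [this]
          field_simp
          ring
        rw [hm, hm2]
        ext
        · simp only; field_simp
        · simp only; field_simp
  rw [← h4, Finite.card_option]
  push_cast
  rw [h1]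
  ring

lemma sum_sq (hF : ringChar F ≠ 2) (H : F → ℚ) :
    ∑ a : F, H (a ^ 2) = ∑ d, (1 + chi d) * H d := by
  rw [← Finset.sum_fiberwise Finset.univ (fun a : F => a ^ 2) (fun a => H (a ^ 2))]
  refine Finset.sum_congr rfl fun d _ => ?_
  rw [← card_sqrt hF, Nat.card_eq_fintype_card, Fintype.card_subtype]
  rw [Finset.sum_congr rfl (g := fun _ => H d)]
  · simp
  · intro x hx
    simp at hx
    simp [hx]

lemma sum_triples (hF : ringChar F ≠ 2) (H : F → ℚ) :
    ∑ p : F × F × F, H (p.1 ^ 2 + p.2.1 * p.2.2) =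
      ∑ d, ((Fintype.card F : ℚ) ^ 2 + Fintype.card F * chi d) * H d := by
  have h1 : ∀ a b : F, ∑ c, H (a ^ 2 + b * c) =
      if b = 0 then (Fintype.card F : ℚ) * H (a ^ 2) else ∑ d, H d := by
    intro a b
    split_ifs with hb
    · simp [hb]
    · exact Fintype.sum_bijective (fun c => a ^ 2 + b * c)
        ((Equiv.addLeft (a ^ 2)).bijective.comp (Equiv.mulLeft₀ b hb).bijective) _ _ (fun _ => rfl)
  have h2 : ∀ a : F, ∑ b, ∑ c, H (a ^ 2 + b * c) =
      (Fintype.card F : ℚ) * H (a ^ 2) + ((Fintype.card F : ℚ) - 1) * ∑ d, H d := by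
    intro a
    simp_rw [h1]
    rw [Fintype.sum_eq_add_sum_compl (0 : F)]
    simp only [if_true]
    congr 1
    rw [Finset.sum_congr rfl (g := fun _ => ∑ d, H d)]
    · rw [Finset.sum_const, Finset.card_compl, Finset.card_singleton, nsmul_eq_mul,
        Nat.cast_sub Fintype.card_pos]
      simp
    · intro x hx
      simp at hx
      simp [hx]
  simp_rw [Fintype.sum_prod_type, h2]
  rw [Finset.sum_add_distrib, ← Finset.mul_sum, sum_sq hF, Finset.sum_const, Finset.card_univ,
    nsmul_eq_mul, Finset.mul_sum, Finset.mul_sum, Finset.mul_sum, ← Finset.sum_add_distrib]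
  refine Finset.sum_congr rfl fun d _ => ?_
  ring

lemma sum_types (hF : ringChar F ≠ 2) (H : F → ℚ) (z p n : ℚ) (hz : H 0 = z)
    (hp : ∀ d, d ≠ 0 → chi d = 1 → H d = p) (hn : ∀ d, d ≠ 0 → chi d = -1 → H d = n) :
    ∑ d, H d = z + ((Fintype.card F : ℚ) - 1) / 2 * (p + n) := by
  have h0 : ∑ d : F, chi d = 0 := by
    have := quadraticChar_sum_zero hF
    simp only [chi]
    exact_mod_cast this
  have key : ∀ d, H d = (if d = 0 then z else (p + n) / 2) + chi d * ((p - n) / 2) := by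
    intro d
    split_ifs with hd
    · simp [hd, hz, chi_zero]
    · rcases chi_cases d hd with h | h
      · rw [hp d hd h, h]; ring
      · rw [hn d hd h, h]; ring
  simp_rw [key]
  rw [Finset.sum_add_distrib, ← Finset.sum_mul, h0, Fintype.sum_eq_add_sum_compl (0 : F)]
  rw [Finset.sum_congr rfl (g := fun _ => (p + n) / 2) (s₁ := {(0 : F)}ᶜ)]
  · rw [Finset.sum_const, Finset.card_compl, Finset.card_singleton, nsmul_eq_mul,
        Nat.cast_sub Fintype.card_pos]
    simp
    ring
  · intro x hx
    simp at hx
    simp [hx]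

end chars

section main
variable [Fintype F] [DecidableEq F]


/-- Number of common fixed points. -/
noncomputable def fn {r : ℕ} (ρ : Fin r → (SpecialLinearGroup (Fin 2) F)) : ℕ :=
  Nat.card {L : Option F // ∀ i, Fx (ρ i : Matrix _ _ F) L}

/-- Central (scalar) matrices. -/
def IsC (M : (SpecialLinearGroup (Fin 2) F)) : Prop := M 1 0 = 0 ∧ M 1 1 - M 0 0 = 0 ∧ -(M 0 1) = 0

/-- `M` commutes with the traceless matrix with entries `a, b, c, -a`. -/
def Cm (a b c : F) (M : (SpecialLinearGroup (Fin 2) F)) : Prop :=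
  M 0 1 * c = b * M 1 0 ∧ b * (M 0 0 - M 1 1) = 2 * a * M 0 1 ∧
    c * (M 0 0 - M 1 1) = 2 * a * M 1 0

lemma card_isC (hF : ringChar F ≠ 2) : (Nat.card {M : (SpecialLinearGroup (Fin 2) F) // IsC M} : ℚ) = 2 := by
  have h1 : chi (1 : F) = 1 := by simp [chi]
  have : (2 : ℚ) = Nat.card {x : F // x ^ 2 = 1} := by rw [card_sqrt hF, h1]; norm_num
  rw [this]
  congr 1
  symm
  refine Nat.card_eq_of_bijective (fun x : {x : F // x ^ 2 = 1} =>
    (⟨mk x.1 0 0 x.1 (by linear_combination x.2), by simp [IsC, mk]⟩ : {M : (SpecialLinearGroup (Fin 2) F) // IsC M})) ⟨?_, ?_⟩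
  · intro x y h
    have h' := congrArg (fun x : {M : (SpecialLinearGroup (Fin 2) F) // IsC M} => x.1 0 0) h
    simp [mk] at h'
    exact Subtype.ext h'
  · rintro ⟨M, h1, h2, h3⟩
    have hd := sl_det M
    rw [h1] at hd
    have h4 : M 1 1 = M 0 0 := by linear_combination h2
    have h5 : M 0 1 = 0 := by linear_combination -h3
    rw [h4] at hd
    refine ⟨⟨M 0 0, by linear_combination hd⟩, ?_⟩
    apply Subtype.ext
    apply sl_ext <;> simp [mk, h1, h4, h5]

lemma isC_fx {M : (SpecialLinearGroup (Fin 2) F)} (h : IsC M) (L : Option F) : Fx (M : Matrix _ _ F) L := by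
  obtain ⟨h1, h2, h3⟩ := h
  rw [Fx, h1, h2, h3]
  cases L <;> simp [Root]

lemma fn_central {r : ℕ} (ρ : Fin r → (SpecialLinearGroup (Fin 2) F)) (h : ∀ i, IsC (ρ i)) :
    fn ρ = Fintype.card F + 1 := by
  rw [fn, Nat.card_congr (Equiv.subtypeUnivEquiv fun L i => isC_fx (h i) L),
    Finite.card_option, card_F]

lemma fn_noncentral (hF : ringChar F ≠ 2) (h2 : (2 : F) ≠ 0) {r : ℕ} (ρ : Fin r → (SpecialLinearGroup (Fin 2) F))
    (h : ¬ ∀ i, IsC (ρ i)) : fn ρ ≤ 2 := by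
  push Not at h
  obtain ⟨i, hi⟩ := h
  have h1 := card_root hF h2 (ρ i 1 0) (ρ i 1 1 - ρ i 0 0) (-(ρ i 0 1)) hi
  have h3 : fn ρ ≤ Nat.card {L // Root (ρ i 1 0) (ρ i 1 1 - ρ i 0 0) (-(ρ i 0 1)) L} := by
    refine Nat.card_le_card_of_injective
      (fun L => ⟨L.1, L.2 i⟩) (fun x y hxy => Subtype.ext (Subtype.mk.inj hxy))
  have h4 : ∀ d : F, chi d ≤ 1 := by
    intro d
    by_cases hd : d = 0
    · simp [hd, chi_zero]
    · rcases chi_cases d hd with h | h <;> norm_num [h]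
  have h5 : (fn ρ : ℚ) ≤ 2 := by
    calc (fn ρ : ℚ) ≤ _ := Nat.cast_le.mpr h3
      _ = _ := h1
      _ ≤ 2 := by linarith [h4 ((ρ i 1 1 - ρ i 0 0) ^ 2 - 4 * (ρ i 1 0) * (-(ρ i 0 1)))]
  exact_mod_cast h5

lemma card_NS (hF : ringChar F ≠ 2) (h2 : (2 : F) ≠ 0) (r : ℕ) (q : ℚ)
    (hq : q = (Fintype.card F : ℚ)) :
    (Nat.card {ρ : Fin r → (SpecialLinearGroup (Fin 2) F) // fn ρ = 1} : ℚ) =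
      (q + 1) * (q ^ 2 - q) ^ r - (q + 1) * q * (q - 1) ^ r + (q ^ 2 - 1) * 2 ^ r := by
  classical
  have e1 : (∑ ρ : Fin r → (SpecialLinearGroup (Fin 2) F), (fn ρ : ℚ)) = (q + 1) * (q ^ 2 - q) ^ r := by
    have := card_swap (fun (ρ : Fin r → (SpecialLinearGroup (Fin 2) F)) (L : Option F) => ∀ i, Fx (ρ i : Matrix _ _ F) L)
    simp only [fn]
    rw [← Nat.cast_sum, this, Nat.cast_sum]
    have h : ∀ L : Option F, (Nat.card {ρ : Fin r → (SpecialLinearGroup (Fin 2) F) // ∀ i, Fx (ρ i : Matrix _ _ F) L} : ℚ) =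
        (q ^ 2 - q) ^ r := by
      intro L
      rw [card_tuples r (fun M : (SpecialLinearGroup (Fin 2) F) => Fx (M : Matrix _ _ F) L)]
      push_cast
      rw [card_fx, hq]
    simp_rw [h]
    simp [hq]
  have e2 : (∑ ρ : Fin r → (SpecialLinearGroup (Fin 2) F), (fn ρ : ℚ) * (fn ρ - 1)) = (q + 1) * q * (q - 1) ^ r := by
    have := card_swap (fun (ρ : Fin r → (SpecialLinearGroup (Fin 2) F)) (p : Option F × Option F) =>
      p.1 ≠ p.2 ∧ (∀ i, Fx (ρ i : Matrix _ _ F) p.1) ∧ ∀ i, Fx (ρ i : Matrix _ _ F) p.2)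
    simp only [fn]
    simp_rw [← card_offdiag]
    rw [← Nat.cast_sum, this, Nat.cast_sum]
    have h : ∀ p : Option F × Option F, (Nat.card {ρ : Fin r → (SpecialLinearGroup (Fin 2) F) // p.1 ≠ p.2 ∧
        (∀ i, Fx (ρ i : Matrix _ _ F) p.1) ∧ ∀ i, Fx (ρ i : Matrix _ _ F) p.2} : ℚ) =
        if p.1 ≠ p.2 then (q - 1) ^ r else 0 := by
      intro p
      split_ifs with hp
      · rw [hq, ← card_fx2 _ _ hp, ← Nat.cast_pow, ← card_tuples]
        congr 1
        apply Nat.card_congr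
        apply Equiv.subtypeEquivRight
        intro ρ
        simp [hp, forall_and]
      · simp [hp]
    simp_rw [h]
    have h' := card_offdiag (fun _ : Option F => True)
    have h'' : Nat.card {p : Option F × Option F // p.1 ≠ p.2 ∧ True ∧ True} =
      (Finset.univ.filter fun p : Option F × Option F => p.1 ≠ p.2).card := by
      rw [Nat.card_eq_fintype_card, Fintype.card_subtype]
      simp
    rw [h''] at h'
    rw [← Finset.sum_filter, Finset.sum_const, nsmul_eq_mul, h']
    simp [hq]
  have e3 : (∑ ρ : Fin r → (SpecialLinearGroup (Fin 2) F), if (∀ i, IsC (ρ i)) then (1 : ℚ) else 0) = 2 ^ r := by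
    have := card_sum_ite (fun ρ : Fin r → (SpecialLinearGroup (Fin 2) F) => ∀ i, IsC (ρ i))
    rw [← card_isC hF, ← Nat.cast_pow, ← card_tuples, this]
    push_cast
    rfl
  have e4 : (Nat.card {ρ : Fin r → (SpecialLinearGroup (Fin 2) F) // fn ρ = 1} : ℚ) = ∑ ρ : Fin r → (SpecialLinearGroup (Fin 2) F),
      ((fn ρ : ℚ) - (fn ρ : ℚ) * (fn ρ - 1) +
        (q ^ 2 - 1) * if (∀ i, IsC (ρ i)) then (1 : ℚ) else 0) := by
    rw [card_sum_ite, Nat.cast_sum]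
    refine Finset.sum_congr rfl fun ρ _ => ?_
    by_cases hc : ∀ i, IsC (ρ i)
    · rw [if_pos hc, fn_central ρ hc]
      have : Fintype.card F ≠ 0 := Fintype.card_ne_zero
      rw [if_neg (by omega)]
      push_cast
      rw [hq]
      ring
    · rw [if_neg hc]
      have := fn_noncentral hF h2 ρ hc
      interval_cases (fn ρ) <;> norm_num
  rw [e4, Finset.sum_add_distrib, Finset.sum_sub_distrib, ← Finset.mul_sum, e1, e2, e3]

lemma cm_iff (h2 : (2 : F) ≠ 0) (a b c : F) (h : ¬ (a = 0 ∧ b = 0 ∧ c = 0)) (M : (SpecialLinearGroup (Fin 2) F)) :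
    Cm a b c M ↔ ∃ y, M 1 0 = y * c ∧ M 0 1 = y * b ∧ M 0 0 - M 1 1 = 2 * y * a := by
  constructor
  · rintro ⟨e1, e2, e3⟩
    by_cases ha : a = 0
    · by_cases hb : b = 0
      · have hc : c ≠ 0 := by tauto
        refine ⟨M 1 0 / c, by field_simp, ?_, ?_⟩
        · apply mul_right_cancel₀ hc
          rw [e1]; field_simp
        · apply mul_left_cancel₀ hc
          rw [e3]; field_simp
      · refine ⟨M 0 1 / b, ?_, by field_simp, ?_⟩
        · field_simp; linear_combination -e1
        · field_simp; linear_combination e2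
    · have h2a : 2 * a ≠ 0 := mul_ne_zero h2 ha
      refine ⟨(M 0 0 - M 1 1) / (2 * a), ?_, ?_, by field_simp⟩
      · field_simp; linear_combination -e3
      · field_simp; linear_combination -e2
  · rintro ⟨y, e1, e2, e3⟩
    refine ⟨?_, ?_, ?_⟩
    · rw [e1, e2]; ring
    · rw [e3, e2]; ring
    · rw [e3, e1]; ring

lemma card_cm (hF : ringChar F ≠ 2) (h2 : (2 : F) ≠ 0) (a b c : F)
    (h : ¬ (a = 0 ∧ b = 0 ∧ c = 0)) (hd : a ^ 2 + b * c ≠ 0) :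
    (Nat.card {M : (SpecialLinearGroup (Fin 2) F) // Cm a b c M} : ℚ) = Fintype.card F - chi (a ^ 2 + b * c) := by
  rw [← card_conic hF h2 _ hd]
  congr 1
  symm
  refine Nat.card_eq_of_bijective (fun p : {p : F × F // p.1 ^ 2 - (a ^ 2 + b * c) * p.2 ^ 2 = 1} =>
    (⟨mk (p.1.1 + p.1.2 * a) (p.1.2 * b) (p.1.2 * c) (p.1.1 - p.1.2 * a)
      (by linear_combination p.2), (cm_iff h2 a b c h _).2 ⟨p.1.2, ?_, ?_, ?_⟩⟩ :
        {M : (SpecialLinearGroup (Fin 2) F) // Cm a b c M})) ⟨?_, ?_⟩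
  · simp [mk]
  · simp [mk]
  · simp [mk]; ring
  · rintro ⟨⟨x, y⟩, hp⟩ ⟨⟨x', y'⟩, hp'⟩ hh
    have h' := congrArg (fun x : {M : (SpecialLinearGroup (Fin 2) F) // Cm a b c M} =>
      (x.1 0 0, x.1 0 1, x.1 1 0, x.1 1 1)) hh
    simp only [mk, Prod.mk.injEq] at h'
    obtain ⟨k1, k2, k3, k4⟩ := h'
    simp only [of_apply, cons_val', cons_val_zero, cons_val_one, cons_val_fin_one] at k1 k2 k3 k4
    have hx : x = x' := by
      apply mul_left_cancel₀ h2
      linear_combination k1 + k4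
    have hy : y = y' := by
      by_cases ha : a = 0
      · by_cases hb : b = 0
        · have hc : c ≠ 0 := fun hc => h ⟨ha, hb, hc⟩
          exact mul_right_cancel₀ hc k3
        · exact mul_right_cancel₀ hb k2
      · apply mul_right_cancel₀ ha
        linear_combination k1 - hx
    subst hx hy
    rfl
  · rintro ⟨M, hM⟩
    obtain ⟨y, k1, k2, k3⟩ := (cm_iff h2 a b c h M).1 hM
    have hd := sl_det M
    have k4 : M 0 0 = M 1 1 + 2 * y * a := by linear_combination k3
    refine ⟨⟨(M 1 1 + y * a, y), ?_⟩, ?_⟩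
    · rw [k1, k2, k4] at hd
      linear_combination hd
    · apply Subtype.ext
      apply sl_ext <;> simp [mk, k1, k2, k4]
      ring

/-- Number of semisimple tuples commuting with a traceless matrix. -/
noncomputable def psi (r : ℕ) (a b c : F) : ℕ :=
  Nat.card {ρ : Fin r → (SpecialLinearGroup (Fin 2) F) // fn ρ ≠ 1 ∧ ∀ i, Cm a b c (ρ i)}

lemma fn_cm (hF : ringChar F ≠ 2) (h2 : (2 : F) ≠ 0) {r : ℕ} (a b c : F)
    (h : ¬ (a = 0 ∧ b = 0 ∧ c = 0)) (ρ : Fin r → (SpecialLinearGroup (Fin 2) F)) (hρ : ∀ i, Cm a b c (ρ i))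
    (hc : ¬ ∀ i, IsC (ρ i)) : (fn ρ : ℚ) = 1 + chi (a ^ 2 + b * c) := by
  have hh : ¬ (c = 0 ∧ -2 * a = 0 ∧ -b = 0) := by
    rintro ⟨k1, k2, k3⟩
    refine h ⟨?_, by simpa using k3, k1⟩
    simpa [h2] using k2
  have h3 := card_root hF h2 c (-2 * a) (-b) hh
  have h4 : (-2 * a) ^ 2 - 4 * c * (-b) = 4 * (a ^ 2 + b * c) := by ring
  rw [h4, chi_four h2] at h3
  rw [← h3, fn]
  congr 1
  apply Nat.card_congr
  apply Equiv.subtypeEquivRight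
  have h5 : ∀ i, ∃ y, ρ i 1 0 = y * c ∧ ρ i 0 1 = y * b ∧ ρ i 0 0 - ρ i 1 1 = 2 * y * a :=
    fun i => (cm_iff h2 a b c h _).1 (hρ i)
  intro L
  have h6 : ∀ i (y : F), ρ i 1 0 = y * c → ρ i 0 1 = y * b → ρ i 0 0 - ρ i 1 1 = 2 * y * a →
      (Fx (ρ i : Matrix _ _ F) L ↔ y = 0 ∨ Root c (-2 * a) (-b) L) := by
    intro i y k1 k2 k3
    have k4 : ρ i 1 1 - ρ i 0 0 = y * (-2 * a) := by linear_combination -k3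
    rw [Fx, k1, k2, k4]
    cases L with
    | none => simp [Root]
    | some m =>
      simp only [Root]
      rw [← mul_eq_zero]
      ring_nf
  constructor
  · intro hL
    push Not at hc
    obtain ⟨i, hi⟩ := hc
    obtain ⟨y, k1, k2, k3⟩ := h5 i
    rcases (h6 i y k1 k2 k3).1 (hL i) with hy | hy
    · exfalso
      apply hi
      subst hy
      simp at k1 k2 k3
      refine ⟨k1, by linear_combination -k3, by simp [k2]⟩
    · exact hy
  · intro hL i
    obtain ⟨y, k1, k2, k3⟩ := h5 i
    exact (h6 i y k1 k2 k3).2 (Or.inr hL)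

lemma cm_isC (a b c : F) (M : (SpecialLinearGroup (Fin 2) F)) (h : IsC M) : Cm a b c M := by
  obtain ⟨h1, h2, h3⟩ := h
  have h4 : M 1 1 = M 0 0 := by linear_combination h2
  have h5 : M 0 1 = 0 := by linear_combination -h3
  simp [Cm, h1, h4, h5]

lemma psi_ne (hF : ringChar F ≠ 2) (h2 : (2 : F) ≠ 0) (r : ℕ) (a b c : F)
    (h : ¬ (a = 0 ∧ b = 0 ∧ c = 0)) (hd : a ^ 2 + b * c ≠ 0) :
    (psi r a b c : ℚ) = (Fintype.card F - chi (a ^ 2 + b * c)) ^ r := by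
  rw [← card_cm hF h2 a b c h hd, ← Nat.cast_pow, ← card_tuples, psi]
  congr 1
  apply Nat.card_congr
  apply Equiv.subtypeEquivRight
  intro ρ
  refine ⟨fun k => k.2, fun k => ⟨?_, k⟩⟩
  by_cases hc : ∀ i, IsC (ρ i)
  · rw [fn_central ρ hc]
    have : Fintype.card F ≠ 0 := Fintype.card_ne_zero
    omega
  · intro h1
    have := fn_cm hF h2 a b c h ρ k hc
    rw [h1] at this
    rcases chi_cases _ hd with h' | h' <;> rw [h'] at this <;> norm_num at this

lemma psi_zero (hF : ringChar F ≠ 2) (h2 : (2 : F) ≠ 0) (r : ℕ) (a b c : F)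
    (h : ¬ (a = 0 ∧ b = 0 ∧ c = 0)) (hd : a ^ 2 + b * c = 0) :
    (psi r a b c : ℚ) = 2 ^ r := by
  rw [← card_isC hF, ← Nat.cast_pow, ← card_tuples, psi]
  congr 1
  apply Nat.card_congr
  apply Equiv.subtypeEquivRight
  intro ρ
  constructor
  · rintro ⟨k1, k2⟩
    by_contra hc
    have := fn_cm hF h2 a b c h ρ k2 hc
    rw [hd, chi_zero] at this
    apply k1
    have h' : (fn ρ : ℚ) = 1 := by rw [this]; ring
    exact_mod_cast h'
  · intro k
    refine ⟨?_, fun i => cm_isC _ _ _ _ (k i)⟩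
    rw [fn_central ρ k]
    have : Fintype.card F ≠ 0 := Fintype.card_ne_zero
    omega

lemma psi_000 (hF : ringChar F ≠ 2) (h2 : (2 : F) ≠ 0) (r : ℕ) (q : ℚ)
    (hq : q = (Fintype.card F : ℚ)) :
    (psi r (0 : F) 0 0 : ℚ) = (q ^ 3 - q) ^ r -
      ((q + 1) * (q ^ 2 - q) ^ r - (q + 1) * q * (q - 1) ^ r + (q ^ 2 - 1) * 2 ^ r) := by
  rw [← card_NS hF h2 r q hq]
  have h1 := card_compl (fun ρ : Fin r → (SpecialLinearGroup (Fin 2) F) => fn ρ = 1)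
  rw [Nat.card_fun, Nat.cast_pow, card_SL, ← hq] at h1
  simp only [Nat.card_eq_fintype_card, Fintype.card_fin] at h1 ⊢
  rw [← h1, psi, ← Nat.card_eq_fintype_card]
  congr 1
  apply Nat.card_congr
  apply Equiv.subtypeEquivRight
  intro ρ
  simp [Cm]

lemma total (hF : ringChar F ≠ 2) (h2 : (2 : F) ≠ 0) (r : ℕ) (q : ℚ)
    (hq : q = (Fintype.card F : ℚ)) :
    ∑ p : F × F × F, (q - 1 - chi (p.1 ^ 2 + p.2.1 * p.2.2)) * (psi r p.1 p.2.1 p.2.2 : ℚ) =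
      q ^ 2 * (q - 1) * 2 ^ r + (q - 1) / 2 * ((q ^ 2 + q) * (q - 2) * (q - 1) ^ r +
        (q ^ 2 - q) * q * (q + 1) ^ r) + (q - 1) * ((psi r (0 : F) 0 0 : ℚ) - 2 ^ r) := by
  let G : F → ℚ := fun d => (q - 1 - chi d) * if d = 0 then 2 ^ r else (q - chi d) ^ r
  have key : ∀ p : F × F × F,
      (q - 1 - chi (p.1 ^ 2 + p.2.1 * p.2.2)) * (psi r p.1 p.2.1 p.2.2 : ℚ) =
        G (p.1 ^ 2 + p.2.1 * p.2.2) +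
          if p = 0 then (q - 1) * ((psi r (0 : F) 0 0 : ℚ) - 2 ^ r) else 0 := by
    rintro ⟨a, b, c⟩
    by_cases h : a = 0 ∧ b = 0 ∧ c = 0
    · obtain ⟨rfl, rfl, rfl⟩ := h
      simp [G, chi_zero]
      ring
    · have h' : ((a, b, c) : F × F × F) ≠ 0 := by
        intro k; apply h; simpa [Prod.ext_iff] using k
      rw [if_neg h', add_zero]
      simp only [G]
      split_ifs with hd
      · rw [psi_zero hF h2 r a b c h hd]
      · rw [psi_ne hF h2 r a b c h hd, hq]
  simp_rw [key]
  rw [Finset.sum_add_distrib, sum_triples hF G, Finset.sum_ite_eq' Finset.univ,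
    if_pos (Finset.mem_univ _)]
  congr 1
  rw [sum_types hF _ (q ^ 2 * (q - 1) * 2 ^ r) ((q ^ 2 + q) * (q - 2) * (q - 1) ^ r)
    ((q ^ 2 - q) * q * (q + 1) ^ r), ← hq]
  · simp [G, chi_zero, hq]; ring
  · intro d hd hχ
    simp only [G, hd, hχ, if_false, ← hq]; ring
  · intro d hd hχ
    simp only [G, hd, hχ, if_false, ← hq]; ring

end main

section reps

lemma fx_one (L : Option F) : Fx (1 : Matrix (Fin 2) (Fin 2) F) L := by
  rw [fx_iff]; exact ⟨1, by simp⟩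

lemma fx_mul {M N : Matrix (Fin 2) (Fin 2) F} {L : Option F} (hM : Fx M L) (hN : Fx N L) :
    Fx (M * N) L := by
  rw [fx_iff] at *
  obtain ⟨l, hl⟩ := hM
  obtain ⟨k, hk⟩ := hN
  exact ⟨k * l, by rw [← mulVec_mulVec, hk, mulVec_smul, hl, smul_smul]⟩

lemma fx_inv {M : GL (Fin 2) F} {L : Option F} (hM : Fx M.val L) : Fx (M⁻¹).val L := by
  rw [fx_iff] at *
  obtain ⟨l, hl⟩ := hM
  have h : (M⁻¹).val.mulVec (M.val.mulVec (pv L)) = pv L := by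
    rw [mulVec_mulVec, Units.inv_mul, one_mulVec]
  rw [hl, mulVec_smul] at h
  have hl0 : l ≠ 0 := by
    rintro rfl
    rw [zero_smul] at h
    exact pv_ne L h.symm
  refine ⟨l⁻¹, ?_⟩
  have h' := congrArg (fun v => l⁻¹ • v) h
  simp only [smul_smul, inv_mul_cancel₀ hl0, one_smul] at h'
  exact h'

lemma fx_free {r : ℕ} (ρ : FreeGroup (Fin r) →* GL (Fin 2) F) (L : Option F) :
    (∀ γ, Fx (ρ γ).val L) ↔ ∀ i, Fx (ρ (FreeGroup.of i)).val L := by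
  refine ⟨fun h i => h _, fun h γ => ?_⟩
  induction γ using FreeGroup.induction_on with
  | C1 => rw [map_one]; exact fx_one L
  | of i => exact h i
  | inv_of i hi => rw [map_inv]; exact fx_inv hi
  | mul x y hx hy => rw [map_mul]; exact fx_mul hx hy

lemma sub_line (W : Submodule F (Fin 2 → F)) (h0 : W ≠ ⊥) (h1 : W ≠ ⊤) :
    ∃ L : Option F, W = Submodule.span F {pv L} := by
  obtain ⟨v, hv, hv0⟩ := Submodule.exists_mem_ne_zero_of_ne_bot h0
  obtain ⟨L, l, hl, rfl⟩ := exists_pv v hv0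
  have hm : pv L ∈ W := (W.smul_mem_iff hl).1 hv
  refine ⟨L, ?_⟩
  symm
  apply Submodule.eq_of_le_of_finrank_le
  · rwa [Submodule.span_singleton_le_iff_mem]
  · rw [finrank_span_singleton (pv_ne L)]
    have := Submodule.finrank_lt h1
    simp at this
    omega

lemma inv_line (M : Matrix (Fin 2) (Fin 2) F) (L : Option F) :
    (∀ v ∈ Submodule.span F {pv L}, M.mulVec v ∈ Submodule.span F {pv L}) ↔ Fx M L := by
  rw [fx_iff]
  constructor
  · intro h
    obtain ⟨l, hl⟩ := Submodule.mem_span_singleton.1 (h _ (Submodule.mem_span_singleton_self _))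
    exact ⟨l, hl.symm⟩
  · rintro ⟨l, hl⟩ v hv
    obtain ⟨k, rfl⟩ := Submodule.mem_span_singleton.1 hv
    rw [mulVec_smul, hl]
    exact Submodule.smul_mem _ _ (Submodule.smul_mem _ _ (Submodule.mem_span_singleton_self _))

lemma line_ne_bot (L : Option F) : Submodule.span F {pv L} ≠ ⊥ := by
  simpa using pv_ne L

lemma line_ne_top (L : Option F) : Submodule.span F {pv L} ≠ ⊤ := by
  intro h
  have h1 := finrank_span_singleton (K := F) (pv_ne L)
  rw [h, finrank_top] at h1
  simp at h1

lemma line_compl {L L' : Option F} (h : L ≠ L') :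
    IsCompl (Submodule.span F {pv L}) (Submodule.span F {pv L'}) := by
  have hd : Disjoint (Submodule.span F {pv L}) (Submodule.span F {pv L'}) := by
    rw [Submodule.disjoint_def]
    intro x hx hx'
    obtain ⟨k, rfl⟩ := Submodule.mem_span_singleton.1 hx
    obtain ⟨k', hk'⟩ := Submodule.mem_span_singleton.1 hx'
    by_cases hk : k = 0
    · simp [hk]
    · exfalso
      apply h
      apply pv_inj (l := k⁻¹ * k')
      rw [← smul_smul, hk', smul_smul, inv_mul_cancel₀ hk, one_smul]
  refine ⟨hd, ?_⟩
  rw [codisjoint_iff]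
  apply Submodule.eq_top_of_disjoint _ _ _ hd
  rw [finrank_span_singleton (pv_ne L), finrank_span_singleton (pv_ne L')]
  simp

lemma ss_iff [Finite F] {r : ℕ} (ρ : FreeGroup (Fin r) →* GL (Fin 2) F) :
    IsSemisimpleRep ρ ↔
      Nat.card {L : Option F // ∀ i, Fx (ρ (FreeGroup.of i)).val L} ≠ 1 := by
  have hinv : ∀ L, (∀ γ : FreeGroup (Fin r), ∀ v ∈ Submodule.span F {pv L},
      ((ρ γ).val).mulVec v ∈ Submodule.span F {pv L}) ↔
      ∀ i, Fx (ρ (FreeGroup.of i)).val L := by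
    intro L
    rw [← fx_free]
    exact forall_congr' fun γ => inv_line _ _
  constructor
  · intro hss hcard
    rw [Nat.card_eq_one_iff_unique] at hcard
    obtain ⟨hsub, ⟨⟨L, hL⟩⟩⟩ := hcard
    obtain ⟨W', hW', hc⟩ := hss _ ((hinv L).2 hL)
    have h0 : W' ≠ ⊥ := by
      rintro rfl
      exact line_ne_top L (by simpa using hc.sup_eq_top)
    have h1 : W' ≠ ⊤ := by
      rintro rfl
      exact line_ne_bot L (by simpa using hc.inf_eq_bot)
    obtain ⟨L', rfl⟩ := sub_line W' h0 h1
    have hL' := (hinv L').1 hW'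
    have : L = L' := congrArg Subtype.val (Subsingleton.elim
      (⟨L, hL⟩ : {L : Option F // ∀ i, Fx (ρ (FreeGroup.of i)).val L}) ⟨L', hL'⟩)
    subst this
    exact line_ne_bot L (by simpa using hc.inf_eq_bot)
  · intro hcard W hW
    by_cases h0 : W = ⊥
    · exact ⟨⊤, by simp, by rw [h0]; exact isCompl_bot_top⟩
    by_cases h1 : W = ⊤
    · refine ⟨⊥, ?_, by rw [h1]; exact isCompl_top_bot⟩
      intro γ v hv
      rw [Submodule.mem_bot] at hv
      simp [hv]
    obtain ⟨L, rfl⟩ := sub_line W h0 h1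
    have hL := (hinv L).1 hW
    by_contra hno
    apply hcard
    rw [Nat.card_eq_one_iff_unique]
    refine ⟨⟨?_⟩, ⟨⟨L, hL⟩⟩⟩
    have : ∀ y : {L : Option F // ∀ i, Fx (ρ (FreeGroup.of i)).val L}, y.1 = L := by
      rintro ⟨L', hL'⟩
      by_contra hne
      exact hno ⟨_, (hinv L').2 hL', line_compl (Ne.symm hne)⟩
    intro x y
    apply Subtype.ext
    rw [this x, this y]

lemma ss_conj {Γ : Type} [Group Γ] (ρ : Γ →* GL (Fin 2) F) (g : GL (Fin 2) F)
    (h : IsSemisimpleRep ρ) : IsSemisimpleRep ((MulAut.conj g).toMonoidHom.comp ρ) := by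
  let e : (Fin 2 → F) ≃ₗ[F] (Fin 2 → F) :=
    Matrix.toLin'OfInv (M := (g⁻¹).val) (M' := g.val) (by simp) (by simp)
  have he : ∀ v, e v = g.val.mulVec v := fun v => rfl
  have hes : ∀ v, e.symm v = (g⁻¹).val.mulVec v := fun v => rfl
  have hconj : ∀ γ v, (((MulAut.conj g).toMonoidHom.comp ρ) γ).val.mulVec v =
      e ((ρ γ).val.mulVec (e.symm v)) := by
    intro γ v
    rw [he, hes, mulVec_mulVec, mulVec_mulVec]
    simp [mul_assoc]
  intro W hW
  obtain ⟨W1', h1, h2⟩ := h (W.comap (e : (Fin 2 → F) →ₗ[F] (Fin 2 → F))) (by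
    intro γ v hv
    have := hW γ (e v) hv
    rw [hconj, e.symm_apply_apply] at this
    exact this)
  refine ⟨W1'.map (e : (Fin 2 → F) →ₗ[F] (Fin 2 → F)), ?_, ?_⟩
  · rintro γ v ⟨w, hw, rfl⟩
    refine ⟨_, h1 γ w hw, ?_⟩
    rw [hconj]
    simp
  · have h3 := (Submodule.orderIsoMapComap e).isCompl h2
    have h4 : (W.comap (e : (Fin 2 → F) →ₗ[F] (Fin 2 → F))).map
        (e : (Fin 2 → F) →ₗ[F] (Fin 2 → F)) = W :=
      Submodule.map_comap_eq_of_surjective e.surjective W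
    have h5 : IsCompl ((W.comap (e : (Fin 2 → F) →ₗ[F] (Fin 2 → F))).map
        (e : (Fin 2 → F) →ₗ[F] (Fin 2 → F))) (W1'.map (e : (Fin 2 → F) →ₗ[F] (Fin 2 → F))) := h3
    rwa [h4] at h5

abbrev XX (r : ℕ) (F : Type) [Field F] : Type :=
  {ρ : FreeGroup (Fin r) →* GL (Fin 2) F // (∀ γ, ((ρ γ).val).det = 1) ∧ IsSemisimpleRep ρ}

/-- Conjugation action. -/
@[reducible] def act (r : ℕ) : MulAction (GL (Fin 2) F) (XX r F) where
  smul g x := ⟨(MulAut.conj g).toMonoidHom.comp x.1, by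
    intro γ
    have h : (g.val).det ≠ 0 := g.det_ne_zero
    simp [x.2.1 γ, h], ss_conj _ _ x.2.2⟩
  one_smul x := by
    apply Subtype.ext
    refine MonoidHom.ext fun γ => ?_
    change 1 * x.1 γ * 1⁻¹ = x.1 γ
    simp
  mul_smul g h x := by
    apply Subtype.ext
    refine MonoidHom.ext fun γ => ?_
    change g * h * x.1 γ * (g * h)⁻¹ = g * (h * x.1 γ * h⁻¹) * g⁻¹
    group

/-- The tuple of generators. -/
def tup {r : ℕ} (x : XX r F) : Fin r → SpecialLinearGroup (Fin 2) F :=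
  fun i => ⟨(x.1 (FreeGroup.of i)).val, x.2.1 _⟩

lemma finite_XX [Finite F] (r : ℕ) : Finite (XX r F) := by
  have : Finite (FreeGroup (Fin r) →* GL (Fin 2) F) := Finite.of_equiv _ FreeGroup.lift
  infer_instance

lemma comm_iff (s a b c : F) (M : SpecialLinearGroup (Fin 2) F) :
    Cm a b c M ↔ (!![s + a, b; c, s - a] * (M : Matrix _ _ F)
      = (M : Matrix _ _ F) * !![s + a, b; c, s - a]) := by
  constructor
  · rintro ⟨h1, h2, h3⟩
    ext i j
    fin_cases i <;> fin_cases j <;> simp [Matrix.mul_apply, Fin.sum_univ_two]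
    · linear_combination -h1
    · linear_combination -h2
    · linear_combination h3
    · linear_combination h1
  · intro h
    have h00 := congrFun (congrFun h 0) 0
    have h01 := congrFun (congrFun h 0) 1
    have h10 := congrFun (congrFun h 1) 0
    simp [Matrix.mul_apply, Fin.sum_univ_two] at h00 h01 h10
    refine ⟨?_, ?_, ?_⟩
    · linear_combination -h00
    · linear_combination -h01
    · linear_combination h10

lemma card_fixed [Fintype F] [DecidableEq F] (r : ℕ) (s a b c : F) (g : GL (Fin 2) F)
    (hg : g.val = !![s + a, b; c, s - a]) :
    Nat.card {x : XX r F // (act r).toSMul.smul g x = x} = psi r a b c := by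
  rw [psi]
  have hiff : ∀ x : XX r F, (act r).toSMul.smul g x = x ↔ ∀ i, Cm a b c (tup x i) := by
    intro x
    have h1 : (act r).toSMul.smul g x = x ↔
        (MulAut.conj g).toMonoidHom.comp x.1 = x.1 := Subtype.ext_iff
    rw [h1]
    have h2 : ((MulAut.conj g).toMonoidHom.comp x.1 = x.1) ↔
        ∀ i, g * x.1 (FreeGroup.of i) * g⁻¹ = x.1 (FreeGroup.of i) := by
      constructor
      · intro h i
        exact DFunLike.congr_fun h (FreeGroup.of i)
      · intro h
        exact FreeGroup.ext_hom _ _ h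
    rw [h2]
    refine forall_congr' fun i => ?_
    rw [comm_iff s, ← hg, mul_inv_eq_iff_eq_mul, Units.ext_iff]
    rfl
  refine Nat.card_eq_of_bijective (fun x : {x : XX r F // (act r).toSMul.smul g x = x} =>
    (⟨tup x.1, (ss_iff x.1.1).1 x.1.2.2, (hiff x.1).1 x.2⟩ :
      {ρ : Fin r → SpecialLinearGroup (Fin 2) F // fn ρ ≠ 1 ∧ ∀ i, Cm a b c (ρ i)})) ⟨?_, ?_⟩
  · intro x y hxy
    apply Subtype.ext
    apply Subtype.ext
    apply FreeGroup.ext_hom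
    intro i
    have h := congrFun (Subtype.mk.inj hxy) i
    exact Units.ext (congrArg Subtype.val h)
  · rintro ⟨t, ht1, ht2⟩
    have hof : ∀ i, (((SpecialLinearGroup.toGL (n := Fin 2) (R := F)).comp (FreeGroup.lift t))
        (FreeGroup.of i)).val = (t i : Matrix _ _ F) := by
      intro i
      simp
    let x : XX r F := ⟨(SpecialLinearGroup.toGL (n := Fin 2) (R := F)).comp (FreeGroup.lift t), by
      intro γ
      exact (FreeGroup.lift t γ).2, by
      rw [ss_iff]
      simp_rw [hof]
      exact ht1⟩
    have hx : tup x = t := by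
      funext i
      exact Subtype.ext (hof i)
    refine ⟨⟨x, ?_⟩, ?_⟩
    · rw [hiff, hx]; exact ht2
    · exact Subtype.ext hx

lemma sum_GL [Fintype F] [DecidableEq F] [Fintype (GL (Fin 2) F)] (hF : ringChar F ≠ 2)
    (Φ : GL (Fin 2) F → ℚ)
    (Ψ : F → F → F → ℚ)
    (h : ∀ (s a b c : F) (g : GL (Fin 2) F), g.val = !![s + a, b; c, s - a] → Φ g = Ψ a b c)
    (h2 : (2 : F) ≠ 0) :
    ∑ g, Φ g = ∑ p : F × F × F, ((Fintype.card F : ℚ) - 1 - chi (p.1 ^ 2 + p.2.1 * p.2.2)) *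
      Ψ p.1 p.2.1 p.2.2 := by
  let f : (Σ p : F × F × F, {s : F // ¬ s ^ 2 = p.1 ^ 2 + p.2.1 * p.2.2}) → GL (Fin 2) F :=
    fun x => GeneralLinearGroup.mkOfDetNeZero
      !![x.2.1 + x.1.1, x.1.2.1; x.1.2.2, x.2.1 - x.1.1] (by
        rw [det_fin_two_of]
        intro h
        exact x.2.2 (by linear_combination h))
  have hf : ∀ x, (f x).val = !![x.2.1 + x.1.1, x.1.2.1; x.1.2.2, x.2.1 - x.1.1] := fun x => rfl
  have hb : Function.Bijective f := by
    constructor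
    · rintro ⟨⟨a, b, c⟩, s, hs⟩ ⟨⟨a', b', c'⟩, s', hs'⟩ hh
      have h0 := congrArg Units.val hh
      rw [hf, hf] at h0
      have h00 := congrFun (congrFun h0 0) 0
      have h01 := congrFun (congrFun h0 0) 1
      have h10 := congrFun (congrFun h0 1) 0
      have h11 := congrFun (congrFun h0 1) 1
      simp at h00 h01 h10 h11
      have e1 : s = s' := by
        apply mul_left_cancel₀ h2
        linear_combination h00 + h11
      have e2 : a = a' := by linear_combination h00 - e1
      subst e1 e2 h01 h10
      rfl
    · intro g
      have hd : g.val.det ≠ 0 := g.det_ne_zero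
      rw [det_fin_two] at hd
      refine ⟨⟨((g.val 0 0 - g.val 1 1) / 2, g.val 0 1, g.val 1 0),
        (g.val 0 0 + g.val 1 1) / 2, ?_⟩, ?_⟩
      · intro k
        apply hd
        simp only at k
        field_simp at k
        have h4 : (4 : F) ≠ 0 := by
          have : (4 : F) = 2 * 2 := by norm_num
          rw [this]; exact mul_ne_zero h2 h2
        apply mul_left_cancel₀ h4
        linear_combination k
      · apply Units.ext
        rw [hf]
        ext i j
        fin_cases i <;> fin_cases j <;> simp
        · field_simp; ring
        · field_simp; ring
  rw [← Function.Bijective.sum_comp hb, Fintype.sum_sigma]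
  refine Finset.sum_congr rfl fun p _ => ?_
  have : ∀ s : {s : F // ¬ s ^ 2 = p.1 ^ 2 + p.2.1 * p.2.2}, Φ (f ⟨p, s⟩) = Ψ p.1 p.2.1 p.2.2 :=
    fun s => h _ _ _ _ _ (hf _)
  simp_rw [this]
  have hc := card_compl (fun s : F => s ^ 2 = p.1 ^ 2 + p.2.1 * p.2.2)
  rw [card_sqrt hF, card_F (F := F), Nat.card_eq_fintype_card] at hc
  rw [Finset.sum_const, nsmul_eq_mul, Finset.card_univ, hc]
  ring

end reps

end S16

/-- For `q` an odd prime power and `Γ` the free group on `r ≥ 1` generators,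
the number of isomorphism classes (i.e. `GL₂(𝔽_q)`-conjugacy classes) of semisimple
`2`-dimensional representations of `Γ` over `𝔽_q` with trivial determinant equals
`(q³−q)^{r−1} − (q²−q)^{r−1} + q·((q+1)^{r−1} + (q−1)^{r−1})/2`. -/
theorem stmt16 (F : Type) [Field F] [Fintype F] (q : ℕ) (hq : Fintype.card F = q)
    (hodd : Odd q) (r : ℕ) (hr : 1 ≤ r) :
    (Nat.card (Quot (fun ρ₁ ρ₂ :
        {ρ : FreeGroup (Fin r) →* GL (Fin 2) F //
          (∀ γ, ((ρ γ).val).det = 1) ∧ IsSemisimpleRep ρ} =>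
          ∃ g : GL (Fin 2) F, ∀ γ, ρ₂.val γ = g * ρ₁.val γ * g⁻¹)) : ℚ) =
      ((q : ℚ) ^ 3 - q) ^ (r - 1) - ((q : ℚ) ^ 2 - q) ^ (r - 1) +
        q * (((q : ℚ) + 1) ^ (r - 1) + ((q : ℚ) - 1) ^ (r - 1)) / 2 := by
  classical
  have hF : ringChar F ≠ 2 := by
    intro h
    have h1 := FiniteField.even_card_iff_char_two.1 h
    rw [hq] at h1
    rw [Nat.odd_iff] at hodd
    omega
  have h2 : (2 : F) ≠ 0 := Ring.two_ne_zero hF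
  let _ : MulAction (GL (Fin 2) F) (S16.XX r F) := S16.act r
  have : Finite (S16.XX r F) := S16.finite_XX r
  let _ : Fintype (S16.XX r F) := Fintype.ofFinite _
  let _ : Fintype (MulAction.orbitRel.Quotient (GL (Fin 2) F) (S16.XX r F)) := Fintype.ofFinite _
  have hB := MulAction.sum_card_fixedBy_eq_card_orbits_mul_card_group (GL (Fin 2) F) (S16.XX r F)
  have hQ : Nat.card (Quot (fun ρ₁ ρ₂ :
        {ρ : FreeGroup (Fin r) →* GL (Fin 2) F //
          (∀ γ, ((ρ γ).val).det = 1) ∧ IsSemisimpleRep ρ} =>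
          ∃ g : GL (Fin 2) F, ∀ γ, ρ₂.val γ = g * ρ₁.val γ * g⁻¹)) =
      Fintype.card (MulAction.orbitRel.Quotient (GL (Fin 2) F) (S16.XX r F)) := by
    rw [← Nat.card_eq_fintype_card]
    refine Nat.card_congr (Quot.congrRight ?_)
    intro x y
    change _ ↔ x ∈ MulAction.orbit (GL (Fin 2) F) y
    rw [← MulAction.mem_orbit_symm]
    constructor
    · rintro ⟨g, hg⟩
      refine ⟨g, Subtype.ext ?_⟩
      refine MonoidHom.ext fun γ => ?_
      exact (hg γ).symm
    · rintro ⟨g, hg⟩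
      refine ⟨g, fun γ => ?_⟩
      exact (DFunLike.congr_fun (congrArg Subtype.val hg) γ).symm
  rw [hQ]
  have hS := S16.sum_GL hF (fun g : GL (Fin 2) F =>
      (Fintype.card (MulAction.fixedBy (S16.XX r F) g) : ℚ))
    (fun a b c => (S16.psi r a b c : ℚ)) (by
      intro s a b c g hg
      rw [← S16.card_fixed r s a b c g hg, ← Nat.card_eq_fintype_card]
      rfl) h2
  rw [← Nat.cast_sum, hB, Nat.cast_mul] at hS
  have hG : (Fintype.card (GL (Fin 2) F) : ℚ) = ((q : ℚ) ^ 2 - 1) * ((q : ℚ) ^ 2 - q) := by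
    rw [← Nat.card_eq_fintype_card, Matrix.card_GL_field, hq, Fin.prod_univ_two]
    have h1 : 1 ≤ q := hq ▸ Fintype.card_pos
    have h3 : 1 ≤ q ^ 2 := Nat.one_le_pow _ _ h1
    have h4 : q ≤ q ^ 2 := Nat.le_self_pow (by norm_num) q
    simp only [Fin.val_zero, Fin.val_one, pow_zero, pow_one]
    rw [Nat.cast_mul, Nat.cast_sub h3, Nat.cast_sub h4]
    push_cast
    ring
  have hqQ : (q : ℚ) = (Fintype.card F : ℚ) := by rw [hq]
  rw [← hqQ, S16.total hF h2 r q hqQ, S16.psi_000 hF h2 r q hqQ, hG] at hS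
  have hq1 : (1 : ℚ) < q := by
    have : 1 < q := hq ▸ Fintype.one_lt_card
    exact_mod_cast this
  obtain ⟨k, rfl⟩ : ∃ k, r = k + 1 := ⟨r - 1, by omega⟩
  have hne : ((q : ℚ) ^ 2 - 1) * ((q : ℚ) ^ 2 - q) ≠ 0 := by
    have : ((q : ℚ) ^ 2 - 1) * ((q : ℚ) ^ 2 - q) = (q - 1) ^ 2 * (q + 1) * q := by ring
    rw [this]
    have : 0 < (q : ℚ) - 1 := by linarith
    positivity
  apply mul_right_cancel₀ hne
  rw [hS]
  simp only [Nat.add_sub_cancel]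
  generalize (q : ℚ) = x
  simp only [pow_succ (n := k)]
  ring
end

section
/- Let q be an odd prime power and Γ a finitely generated group. With m_j the number of homomorphisms Γ → ℤ/jℤ, the number of isomorphism classes of irreducible-but-not-absolutely-irreducible 2-dimensional representations of Γ over 𝔽_q with trivial determinant equals (m_{q+1} − m₂)/2. -/
/-- A representation `ρ : Γ → GL_n(F)` is irreducible over `F`: there is no proper nonzero
invariant subspace. -/
def IsIrreducibleRep {Γ F : Type} [Group Γ] [Field F] {n : ℕ}
    (ρ : Γ →* GL (Fin n) F) : Prop :=
  ∀ W : Submodule F (Fin n → F),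
    (∀ γ : Γ, ∀ v ∈ W, ((ρ γ).val).mulVec v ∈ W) → W = ⊥ ∨ W = ⊤

/-- A representation `ρ : Γ → GL_n(F)` is absolutely irreducible: it stays irreducible after
extending scalars to the algebraic closure of `F`. -/
def IsAbsolutelyIrreducibleRep {Γ F : Type} [Group Γ] [Field F] {n : ℕ}
    (ρ : Γ →* GL (Fin n) F) : Prop :=
  ∀ W : Submodule (AlgebraicClosure F) (Fin n → AlgebraicClosure F),
    (∀ γ : Γ, ∀ v ∈ W,
      (((ρ γ).val).map (algebraMap F (AlgebraicClosure F))).mulVec v ∈ W) → W = ⊥ ∨ W = ⊤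


lemma aux_finite_hom (Γ : Type) [Group Γ] (hΓ : Group.FG Γ) (C : Type) [Group C] [Finite C] :
    Finite (Γ →* C) := by
  obtain ⟨S, hS⟩ := Group.fg_def.1 hΓ
  refine Finite.of_injective (fun f : Γ →* C => fun s : S => f s) ?_
  intro f g h
  refine MonoidHom.eq_of_eqOn_dense hS ?_
  intro s hs
  exact congrFun h ⟨s, hs⟩

lemma aux_ringChar (F : Type) [Field F] [Fintype F] (hodd : Odd (Fintype.card F)) :
    ringChar F ≠ 2 := by
  intro h
  have := FiniteField.even_card_of_char_two h
  rw [Nat.odd_iff] at hodd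
  omega

open Polynomial in
lemma aux_range (F K : Type) [Field F] [Fintype F] [Field K] [Algebra F K] (x : K)
    (hx : x ^ Fintype.card F = x) : ∃ a : F, algebraMap F K a = x := by
  have h1 : (X ^ Fintype.card F - X : K[X]) =
      (X ^ Fintype.card F - X : F[X]).map (algebraMap F K) := by simp
  have h2 : x ∈ (X ^ Fintype.card F - X : K[X]).roots := by
    rw [mem_roots (FiniteField.X_pow_card_sub_X_ne_zero K Fintype.one_lt_card)]
    simp [hx]
  have hs : (X ^ Fintype.card F - X : F[X]).Splits := by
    rw [splits_iff_card_roots, FiniteField.roots_X_pow_card_sub_X,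
      FiniteField.X_pow_card_sub_X_natDegree_eq F Fintype.one_lt_card]
    rfl
  rw [h1, hs.roots_map, FiniteField.roots_X_pow_card_sub_X] at h2
  simpa using h2

lemma aux_sqrt_pow (F K : Type) [Field F] [Fintype F] [Field K] [Algebra F K]
    (hodd : Odd (Fintype.card F)) (δ : F) (hδ : ¬ IsSquare δ) (w : K)
    (hw : w ^ 2 = algebraMap F K δ) : w ^ Fintype.card F = - w := by
  have h0 : δ ≠ 0 := by rintro rfl; exact hδ (IsSquare.zero)
  have hc := aux_ringChar F hodd
  have h1 := FiniteField.pow_dichotomy hc h0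
  rw [← FiniteField.isSquare_iff hc h0] at h1
  have h2 := h1.resolve_left hδ
  obtain ⟨k, hk⟩ := hodd
  have hk2 : Fintype.card F / 2 = k := by omega
  rw [hk2] at h2
  rw [hk, pow_succ, pow_mul, hw, ← map_pow, h2]
  simp

/-- The nonsplit torus of norm one elements. -/
def torus {F : Type} [Field F] (δ : F) : Subgroup (GL (Fin 2) F) where
  carrier := {g | g.val 0 0 = g.val 1 1 ∧ g.val 0 1 = δ * g.val 1 0 ∧ g.val.det = 1}
  one_mem' := by simp
  mul_mem' := by
    rintro a b ⟨h1, h2, h3⟩ ⟨h4, h5, h6⟩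
    refine ⟨?_, ?_, ?_⟩
    · simp only [Units.val_mul, Matrix.mul_apply, Fin.sum_univ_two, h1, h2, h4, h5]; ring
    · simp only [Units.val_mul, Matrix.mul_apply, Fin.sum_univ_two, h1, h2, h4, h5]; ring
    · simp [h3, h6]
  inv_mem' := by
    rintro a ⟨h1, h2, h3⟩
    have : (a⁻¹).val = !![a.val 1 1, - a.val 0 1; - a.val 1 0, a.val 0 0] := by
      rw [Matrix.coe_units_inv, Matrix.inv_def, h3, Matrix.adjugate_fin_two]
      simp
    refine ⟨?_, ?_, ?_⟩
    · simp [this, h1]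
    · simp [this, h2]
    · rw [this]; rw [Matrix.det_fin_two] at h3; simp; linear_combination h3

lemma torus_mem {F : Type} [Field F] {δ : F} {g : GL (Fin 2) F} : g ∈ torus δ ↔
  g.val 0 0 = g.val 1 1 ∧ g.val 0 1 = δ * g.val 1 0 ∧ g.val.det = 1 := Iff.rfl

lemma torus_norm {F : Type} [Field F] {δ : F} {g : GL (Fin 2) F} (hg : g ∈ torus δ) :
    g.val 0 0 ^ 2 - δ * g.val 1 0 ^ 2 = 1 := by
  obtain ⟨h1, h2, h3⟩ := torus_mem.1 hg
  rw [Matrix.det_fin_two] at h3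
  rw [h2, ← h1] at h3
  linear_combination h3

lemma torus_ext {F : Type} [Field F] {δ : F} {g h : GL (Fin 2) F} (hg : g ∈ torus δ)
    (hh : h ∈ torus δ) (h0 : g.val 0 0 = h.val 0 0) (h1 : g.val 1 0 = h.val 1 0) : g = h := by
  obtain ⟨h2, h3, -⟩ := torus_mem.1 hg
  obtain ⟨h4, h5, -⟩ := torus_mem.1 hh
  apply Units.ext
  ext i j
  fin_cases i <;> fin_cases j <;> simp_all

lemma torus_inv {F : Type} [Field F] {δ : F} {g : GL (Fin 2) F} (hg : g ∈ torus δ) :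
    (g⁻¹).val = !![g.val 0 0, - (δ * g.val 1 0); - g.val 1 0, g.val 0 0] := by
  obtain ⟨h1, h2, h3⟩ := torus_mem.1 hg
  rw [Matrix.coe_units_inv, Matrix.inv_def, h3, Matrix.adjugate_fin_two]
  simp [h1, h2]

lemma torus_mk {F : Type} [Field F] {δ a b : F} (h : a ^ 2 - δ * b ^ 2 = 1) :
    ∃ g ∈ torus δ, g.val 0 0 = a ∧ g.val 1 0 = b := by
  have hd : (!![a, δ * b; b, a] : Matrix (Fin 2) (Fin 2) F).det = 1 := by
    rw [Matrix.det_fin_two_of]; linear_combination h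
  refine ⟨Matrix.GeneralLinearGroup.mkOfDetNeZero _ (by rw [hd]; exact one_ne_zero), ?_, ?_, ?_⟩
  · rw [torus_mem]
    refine ⟨?_, ?_, hd⟩ <;> simp [Matrix.GeneralLinearGroup.mkOfDetNeZero]
  · simp [Matrix.GeneralLinearGroup.mkOfDetNeZero]
  · simp [Matrix.GeneralLinearGroup.mkOfDetNeZero]

/-- The eigenvalue hom. -/
def torusHom {F K : Type} [Field F] [Field K] [Algebra F K] (δ : F) (w : K)
    (hw : w ^ 2 = algebraMap F K δ) : torus δ →* K where
  toFun g := algebraMap F K (g.val.val 0 0) + algebraMap F K (g.val.val 1 0) * w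
  map_one' := by simp
  map_mul' := by
    rintro ⟨a, ha⟩ ⟨b, hb⟩
    obtain ⟨h1, h2, h3⟩ := torus_mem.1 ha
    obtain ⟨h4, h5, h6⟩ := torus_mem.1 hb
    simp only [MulMemClass.mk_mul_mk, Units.val_mul, Matrix.mul_apply, Fin.sum_univ_two, h2,
      ← h1, map_add, map_mul]
    rw [← hw]; ring

lemma torus_cyclic (F K : Type) [Field F] [Fintype F] [Field K] [Algebra F K] [IsAlgClosed K]
    (hodd : Odd (Fintype.card F)) (δ : F)
    (hδ : ¬ IsSquare δ) : IsCyclic (torus δ) ∧ Nat.card (torus δ) = Fintype.card F + 1 := by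
  obtain ⟨w, hw⟩ := IsAlgClosed.exists_pow_nat_eq (algebraMap F K δ) (n := 2) (by norm_num)
  have hwq := aux_sqrt_pow F K hodd δ hδ w hw
  have h0 : δ ≠ 0 := by rintro rfl; exact hδ (IsSquare.zero)
  have hw0 : w ≠ 0 := by
    rintro rfl
    apply h0
    simpa using hw.symm
  have h2F : (2 : F) ≠ 0 := Ring.two_ne_zero (aux_ringChar F hodd)
  have h2 : (2 : K) ≠ 0 := by
    have := (map_ne_zero (algebraMap F K)).2 h2F
    rwa [map_ofNat] at this
  let φ := FiniteField.frobeniusAlgHom F K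
  have hφ : ∀ x, φ x = x ^ Fintype.card F := fun x => rfl
  have hφw : φ w = - w := by rw [hφ, hwq]
  let f := torusHom δ w hw
  have hf : ∀ g : torus δ, f g = algebraMap F K (g.val.val 0 0) + algebraMap F K (g.val.val 1 0) * w :=
    fun _ => rfl
  have hfφ : ∀ g : torus δ, φ (f g) =
      algebraMap F K (g.val.val 0 0) - algebraMap F K (g.val.val 1 0) * w := by
    intro g
    rw [hf, map_add, map_mul, hφw, AlgHom.commutes, AlgHom.commutes]; ring
  have hinj : Function.Injective f := by
    intro g h hgh
    have e2 : φ (f g) = φ (f h) := by rw [hgh]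
    rw [hfφ, hfφ] at e2
    rw [hf, hf] at hgh
    have e3 : algebraMap F K (g.val.val 0 0) = algebraMap F K (h.val.val 0 0) := by
      apply mul_left_cancel₀ h2; linear_combination hgh + e2
    have e4 : algebraMap F K (g.val.val 1 0) = algebraMap F K (h.val.val 1 0) := by
      apply mul_left_cancel₀ h2; apply mul_right_cancel₀ hw0; linear_combination hgh - e2
    apply Subtype.ext
    exact torus_ext g.2 h.2 ((algebraMap F K).injective e3) ((algebraMap F K).injective e4)
  refine ⟨isCyclic_of_injective_ringHom f hinj, ?_⟩
  have : NeZero ((Fintype.card F + 1 : ℕ) : K) := ⟨by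
    rw [← map_natCast (algebraMap F K)]; simp⟩
  rw [← HasEnoughRootsOfUnity.natCard_rootsOfUnity K (Fintype.card F + 1)]
  have hnorm : ∀ g : torus δ, f g ^ (Fintype.card F + 1) = 1 := by
    intro g
    have := congrArg (algebraMap F K) (torus_norm g.2)
    rw [map_sub, map_mul, map_pow, map_pow, map_one] at this
    rw [pow_succ, ← hφ, hfφ, hf]
    rw [← hw] at this
    linear_combination this
  refine Nat.card_congr (Equiv.ofBijective
    (fun g => rootsOfUnity.mkOfPowEq (f g) (hnorm g)) ⟨?_, ?_⟩)
  · intro g h hgh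
    apply hinj
    have := congrArg (fun x : rootsOfUnity (Fintype.card F + 1) K => (x.val : K)) hgh
    simpa using this
  · rintro ⟨x, hx⟩
    rw [mem_rootsOfUnity'] at hx
    set y : K := x.val with hy
    have hxy : φ y * y = 1 := by rw [hφ, ← pow_succ, hx]
    have hφφ : φ (φ y) = y := by
      have e1 : φ (φ y) * φ y = 1 := by rw [← map_mul, hxy, map_one]
      have : φ y ≠ 0 := by intro h; rw [h] at hxy; simp at hxy
      apply mul_right_cancel₀ this
      rw [e1, mul_comm, hxy]
    have hφ2 : φ 2 = 2 := map_ofNat φ 2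
    obtain ⟨a, ha⟩ := aux_range F K ((y + φ y) / 2) (by
      rw [← hφ, map_div₀, map_add, hφφ, hφ2, add_comm])
    obtain ⟨b, hb⟩ := aux_range F K ((y - φ y) / (2 * w)) (by
      rw [← hφ, map_div₀, map_sub, hφφ, map_mul, hφ2, hφw]; field_simp; ring)
    obtain ⟨g, hg, hga, hgb⟩ := torus_mk (δ := δ) (a := a) (b := b) (by
      apply (algebraMap F K).injective
      rw [map_sub, map_mul, map_pow, map_pow, map_one, ha, hb, ← hw]
      field_simp
      linear_combination 4 * hxy)
    refine ⟨⟨g, hg⟩, ?_⟩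
    apply Subtype.ext
    apply Units.ext
    change f ⟨g, hg⟩ = y
    rw [hf]
    simp only [hga, hgb, ha, hb]
    field_simp
    ring

lemma top_of_det {K : Type} [Field K] (W : Submodule K (Fin 2 → K)) (u v : Fin 2 → K)
    (hu : u ∈ W) (hv : v ∈ W) (h : u 0 * v 1 - u 1 * v 0 ≠ 0) : W = ⊤ := by
  rw [eq_top_iff]
  intro x _
  have : x = ((x 0 * v 1 - x 1 * v 0) / (u 0 * v 1 - u 1 * v 0)) • u +
      ((u 0 * x 1 - u 1 * x 0) / (u 0 * v 1 - u 1 * v 0)) • v := by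
    have e0 : x 0 = ((x 0 * v 1 - x 1 * v 0) / (u 0 * v 1 - u 1 * v 0)) * u 0 +
      ((u 0 * x 1 - u 1 * x 0) / (u 0 * v 1 - u 1 * v 0)) * v 0 := by
      rw [div_mul_eq_mul_div, div_mul_eq_mul_div, ← add_div, eq_div_iff h]; ring
    have e1 : x 1 = ((x 0 * v 1 - x 1 * v 0) / (u 0 * v 1 - u 1 * v 0)) * u 1 +
      ((u 0 * x 1 - u 1 * x 0) / (u 0 * v 1 - u 1 * v 0)) * v 1 := by
      rw [div_mul_eq_mul_div, div_mul_eq_mul_div, ← add_div, eq_div_iff h]; ring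
    ext i
    fin_cases i
    · exact e0
    · exact e1
  rw [this]
  exact W.add_mem (W.smul_mem _ hu) (W.smul_mem _ hv)

lemma not_irr_of_line {Γ F : Type} [Group Γ] [Field F] (ρ : Γ →* GL (Fin 2) F) (p r : F)
    (hpr : p ≠ 0 ∨ r ≠ 0)
    (h : ∀ γ, (ρ γ).val 1 0 * p ^ 2 + ((ρ γ).val 1 1 - (ρ γ).val 0 0) * p * r
      - (ρ γ).val 0 1 * r ^ 2 = 0) : ¬ IsIrreducibleRep ρ := by
  intro hirr
  let W : Submodule F (Fin 2 → F) :=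
    { carrier := {u | p * u 1 = r * u 0}
      zero_mem' := by simp
      add_mem' := by
        intro a b ha hb
        simp only [Set.mem_ofPred_eq, Pi.add_apply] at *
        linear_combination ha + hb
      smul_mem' := by
        intro c a ha
        simp only [Set.mem_ofPred_eq, Pi.smul_apply, smul_eq_mul] at *
        linear_combination c * ha }
  have hW : ∀ u, u ∈ W ↔ p * u 1 = r * u 0 := fun _ => Iff.rfl
  rcases hirr W (by
    intro γ v hv
    have hγ := h γ
    rw [hW] at hv ⊢
    simp only [Matrix.mulVec, dotProduct, Fin.sum_univ_two]
    rcases hpr with hp | hr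
    · apply mul_left_cancel₀ hp
      linear_combination v 0 * hγ + (p * (ρ γ).val 1 1 - r * (ρ γ).val 0 1) * hv
    · apply mul_left_cancel₀ hr
      linear_combination v 1 * hγ + (r * (ρ γ).val 0 0 - p * (ρ γ).val 1 0) * hv) with h1 | h1
  · have : (![p, r] : Fin 2 → F) ∈ W := by rw [hW]; simp; ring
    rw [h1, Submodule.mem_bot] at this
    have e0 := congrFun this 0
    have e1 := congrFun this 1
    simp at e0 e1
    tauto
  · have e0 : (![0, 1] : Fin 2 → F) ∈ W := by rw [h1]; trivial
    have e1 : (![1, 0] : Fin 2 → F) ∈ W := by rw [h1]; trivial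
    rw [hW] at e0 e1
    simp at e0 e1
    tauto

lemma nonsq_ratio (F : Type) [Field F] [Fintype F] (hodd : Odd (Fintype.card F)) (δ D : F)
    (hδ : ¬ IsSquare δ) (hD : ¬ IsSquare D) : ∃ e : F, e ≠ 0 ∧ D = δ * e ^ 2 := by
  have h0 : δ ≠ 0 := by rintro rfl; exact hδ (IsSquare.zero)
  have h0' : D ≠ 0 := by rintro rfl; exact hD (IsSquare.zero)
  have hc := aux_ringChar F hodd
  have h1 := FiniteField.pow_dichotomy hc h0
  rw [← FiniteField.isSquare_iff hc h0] at h1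
  have h2 := FiniteField.pow_dichotomy hc h0'
  rw [← FiniteField.isSquare_iff hc h0'] at h2
  have h3 : IsSquare (D * δ) := by
    rw [FiniteField.isSquare_iff hc (mul_ne_zero h0' h0), mul_pow, h1.resolve_left hδ,
      h2.resolve_left hD]
    ring
  obtain ⟨r, hr⟩ := h3
  have hr0 : r ≠ 0 := by
    rintro rfl
    simp [h0, h0'] at hr
  refine ⟨r / δ, div_ne_zero hr0 h0, ?_⟩
  field_simp
  linear_combination hr

lemma exists_conj_torus_aux {Γ F K : Type} [Group Γ] [Field F] [Fintype F] [Field K] [Algebra F K]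
    (hodd : Odd (Fintype.card F)) (δ : F) (hδ : ¬ IsSquare δ) (ρ : Γ →* GL (Fin 2) F)
    (hdet : ∀ γ, ((ρ γ).val).det = 1) (hirr : IsIrreducibleRep ρ)
    (v : Fin 2 → K) (hv0 : v ≠ 0)
    (key : ∀ γ, algebraMap F K ((ρ γ).val 1 0) * v 0 ^ 2 +
      (algebraMap F K ((ρ γ).val 1 1) - algebraMap F K ((ρ γ).val 0 0)) * v 0 * v 1
      - algebraMap F K ((ρ γ).val 0 1) * v 1 ^ 2 = 0) :
    ∃ g : GL (Fin 2) F, ∀ γ, g * ρ γ * g⁻¹ ∈ torus δ := by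
  have h2 : (2 : F) ≠ 0 := Ring.two_ne_zero (aux_ringChar F hodd)
  have h2K : (2 : K) ≠ 0 := by
    have := (map_ne_zero (algebraMap F K)).2 h2
    rwa [map_ofNat] at this
  have hy : v 1 ≠ 0 := by
    intro h1
    have h0 : v 0 ≠ 0 := by
      intro h0
      apply hv0
      ext i
      fin_cases i
      · exact h0
      · exact h1
    refine not_irr_of_line ρ 1 0 (Or.inl one_ne_zero) ?_ hirr
    intro γ
    have := key γ
    rw [h1] at this
    simpa [h0] using this
  obtain ⟨z, hz⟩ : ∃ z, z = v 0 / v 1 := ⟨_, rfl⟩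
  have keyz : ∀ γ, algebraMap F K ((ρ γ).val 1 0) * z ^ 2 +
      (algebraMap F K ((ρ γ).val 1 1) - algebraMap F K ((ρ γ).val 0 0)) * z
      - algebraMap F K ((ρ γ).val 0 1) = 0 := by
    intro γ
    have hx : v 0 = z * v 1 := by rw [hz]; field_simp
    have := key γ
    rw [hx] at this
    apply mul_right_cancel₀ (pow_ne_zero 2 hy)
    linear_combination this
  have hzF : ∀ a : F, algebraMap F K a ≠ z := by
    intro a ha
    refine not_irr_of_line ρ a 1 (Or.inr one_ne_zero) ?_ hirr
    intro γ
    apply (algebraMap F K).injective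
    have := keyz γ
    rw [← ha] at this
    simp only [map_sub, map_add, map_mul, map_pow, map_one, map_zero]
    linear_combination this
  obtain ⟨γ₀, hγ₀⟩ : ∃ γ, (ρ γ).val 1 0 ≠ 0 := by
    by_contra! hc
    refine not_irr_of_line ρ 1 0 (Or.inl one_ne_zero) ?_ hirr
    intro γ
    simp [hc γ]
  have hlin : ∀ a b : F, algebraMap F K a * z = algebraMap F K b → a = 0 ∧ b = 0 := by
    intro a b h
    by_cases ha : a = 0
    · subst ha
      refine ⟨rfl, ?_⟩
      simpa using h.symm
    · exfalso
      apply hzF (b / a)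
      rw [map_div₀, ← h]
      have : algebraMap F K a ≠ 0 := (map_ne_zero _).2 ha
      field_simp
  obtain ⟨s, hs⟩ : ∃ s, s = ((ρ γ₀).val 0 0 - (ρ γ₀).val 1 1) / (ρ γ₀).val 1 0 := ⟨_, rfl⟩
  obtain ⟨t, ht⟩ : ∃ t, t = (ρ γ₀).val 0 1 / (ρ γ₀).val 1 0 := ⟨_, rfl⟩
  have hzz : z ^ 2 = algebraMap F K s * z + algebraMap F K t := by
    have h0 : algebraMap F K ((ρ γ₀).val 1 0) ≠ 0 := (map_ne_zero _).2 hγ₀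
    have := keyz γ₀
    rw [hs, ht, map_div₀, map_div₀, map_sub]
    apply mul_left_cancel₀ h0
    field_simp
    linear_combination this
  have hst : ∀ γ, (ρ γ).val 0 0 = (ρ γ).val 1 1 + (ρ γ).val 1 0 * s ∧
      (ρ γ).val 0 1 = (ρ γ).val 1 0 * t := by
    intro γ
    have := keyz γ
    obtain ⟨e1, e2⟩ := hlin ((ρ γ).val 1 0 * s + (ρ γ).val 1 1 - (ρ γ).val 0 0)
      ((ρ γ).val 0 1 - (ρ γ).val 1 0 * t) (by
        simp only [map_sub, map_add, map_mul]
        linear_combination this - algebraMap F K ((ρ γ).val 1 0) * hzz)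
    exact ⟨by linear_combination -e1, by linear_combination e2⟩
  have hD : ¬ IsSquare (t + (s / 2) ^ 2) := by
    rintro ⟨r, hr⟩
    have hr' := congrArg (algebraMap F K) hr
    simp only [map_add, map_mul, map_pow] at hr'
    have hs2 : algebraMap F K s = 2 * algebraMap F K (s / 2) := by
      rw [map_div₀, map_ofNat]; field_simp
    rw [hs2] at hzz
    have : (z - algebraMap F K (s / 2 + r)) * (z - algebraMap F K (s / 2 - r)) = 0 := by
      simp only [map_add, map_sub]
      linear_combination hzz + hr'
    rcases mul_eq_zero.1 this with h | h
    · exact hzF _ (sub_eq_zero.1 h).symm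
    · exact hzF _ (sub_eq_zero.1 h).symm
  obtain ⟨e, he, hDe⟩ := nonsq_ratio F hodd δ _ hδ hD
  have hgd : (!![1, -(s / 2); 0, e] : Matrix (Fin 2) (Fin 2) F).det ≠ 0 := by
    rw [Matrix.det_fin_two_of]; simpa using he
  let g := Matrix.GeneralLinearGroup.mkOfDetNeZero _ hgd
  have hg : g.val = !![1, -(s / 2); 0, e] := rfl
  refine ⟨g, fun γ => ?_⟩
  obtain ⟨h1, h3⟩ := hst γ
  obtain ⟨a, ha⟩ : ∃ a, a = (ρ γ).val 1 1 + (ρ γ).val 1 0 * (s / 2) := ⟨_, rfl⟩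
  obtain ⟨b, hb⟩ : ∃ b, b = (ρ γ).val 1 0 * e := ⟨_, rfl⟩
  have hs3 : s = 2 * (s / 2) := by field_simp
  have hR : (g * ρ γ * g⁻¹).val = !![a, δ * b; b, a] := by
    have : g.val * (ρ γ).val = !![a, δ * b; b, a] * g.val := by
      rw [hg]
      ext i j
      fin_cases i <;> fin_cases j <;>
        simp only [Matrix.mul_apply, Fin.sum_univ_two, Fin.zero_eta, Fin.mk_one, Matrix.of_apply,
          Matrix.cons_val', Matrix.cons_val_zero, Matrix.cons_val_one, Matrix.cons_val_fin_one,
          h1, h3, ha, hb]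
      · linear_combination (ρ γ).val 1 0 * hs3
      · linear_combination (ρ γ).val 1 0 * hDe
      · ring
      · ring
    rw [Units.val_mul, Units.val_mul, this, mul_assoc, Units.mul_inv, mul_one]
  rw [torus_mem]
  refine ⟨by rw [hR]; simp, by rw [hR]; simp, ?_⟩
  rw [Units.val_mul, Units.val_mul, Matrix.det_mul, Matrix.det_mul, hdet, mul_one, ← Matrix.det_mul,
    Units.mul_inv, Matrix.det_one]

lemma exists_conj_torus {Γ F : Type} [Group Γ] [Field F] [Fintype F]
    (hodd : Odd (Fintype.card F)) (δ : F) (hδ : ¬ IsSquare δ) (ρ : Γ →* GL (Fin 2) F)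
    (hdet : ∀ γ, ((ρ γ).val).det = 1) (hirr : IsIrreducibleRep ρ)
    (habs : ¬ IsAbsolutelyIrreducibleRep ρ) :
    ∃ g : GL (Fin 2) F, ∀ γ, g * ρ γ * g⁻¹ ∈ torus δ := by
  unfold IsAbsolutelyIrreducibleRep at habs
  push Not at habs
  obtain ⟨W, hW, hbot, htop⟩ := habs
  obtain ⟨v, hv, hv0⟩ := Submodule.exists_mem_ne_zero_of_ne_bot hbot
  have key : ∀ γ, algebraMap F (AlgebraicClosure F) ((ρ γ).val 1 0) * v 0 ^ 2 +
      (algebraMap F (AlgebraicClosure F) ((ρ γ).val 1 1) -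
        algebraMap F (AlgebraicClosure F) ((ρ γ).val 0 0)) * v 0 * v 1
      - algebraMap F (AlgebraicClosure F) ((ρ γ).val 0 1) * v 1 ^ 2 = 0 := by
    intro γ
    by_contra hne
    apply htop
    refine top_of_det W _ _ hv (hW γ v hv) ?_
    simp only [Matrix.mulVec, dotProduct, Fin.sum_univ_two, Matrix.map_apply]
    intro h
    apply hne
    linear_combination h
  exact exists_conj_torus_aux hodd δ hδ ρ hdet hirr v hv0 key

lemma torus_conj {Γ F : Type} [Group Γ] [Field F] (h2 : (2 : F) ≠ 0)
    (δ : F) (h0 : δ ≠ 0) (A B : Γ → GL (Fin 2) F) (hA : ∀ γ, A γ ∈ torus δ)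
    (hB : ∀ γ, B γ ∈ torus δ) (g : GL (Fin 2) F) (h : ∀ γ, B γ = g * A γ * g⁻¹) :
    (∀ γ, B γ = A γ) ∨ (∀ γ, B γ = (A γ)⁻¹) := by
  have hα : ∀ γ, (B γ).val 0 0 = (A γ).val 0 0 := by
    intro γ
    have ht : (B γ).val.trace = (A γ).val.trace := by
      rw [h γ, Units.val_mul, Matrix.trace_mul_comm, Units.val_mul, ← mul_assoc, Units.inv_mul,
        one_mul]
    rw [Matrix.trace_fin_two, Matrix.trace_fin_two, ← (torus_mem.1 (hA γ)).1,
      ← (torus_mem.1 (hB γ)).1] at ht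
    apply mul_left_cancel₀ h2
    linear_combination ht
  have hdet : g.val 0 0 * g.val 1 1 - g.val 0 1 * g.val 1 0 ≠ 0 := by
    rw [← Matrix.det_fin_two]
    exact ((Matrix.isUnit_iff_isUnit_det _).1 g.isUnit).ne_zero
  have hmul : ∀ γ, (B γ).val * g.val = g.val * (A γ).val := by
    intro γ
    rw [h γ, Units.val_mul, mul_assoc, Units.inv_mul, mul_one, Units.val_mul]
  have e : ∀ γ, δ * (B γ).val 1 0 * g.val 1 0 = g.val 0 1 * (A γ).val 1 0 ∧
      (B γ).val 1 0 * g.val 0 0 = g.val 1 1 * (A γ).val 1 0 := by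
    intro γ
    have a1 := congrFun (congrFun (hmul γ) 0) 0
    have a2 := congrFun (congrFun (hmul γ) 1) 0
    simp only [Matrix.mul_apply, Fin.sum_univ_two] at a1 a2
    rw [← (torus_mem.1 (hB γ)).1, hα γ] at a2
    rw [(torus_mem.1 (hB γ)).2.1, hα γ] at a1
    exact ⟨by linear_combination a1, by linear_combination a2⟩
  by_cases hz : ∀ γ, (A γ).val 1 0 = 0
  · left
    intro γ
    refine torus_ext (hB γ) (hA γ) (hα γ) ?_
    have n1 := torus_norm (hA γ)
    have n2 := torus_norm (hB γ)
    rw [hα γ] at n2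
    rw [hz γ] at n1 ⊢
    have : δ * (B γ).val 1 0 ^ 2 = 0 := by linear_combination n1 - n2
    simpa [h0] using this
  · push Not at hz
    obtain ⟨γ₀, hγ₀⟩ := hz
    have hε : ∃ ε : F, (ε = 1 ∨ ε = -1) ∧ (B γ₀).val 1 0 = ε * (A γ₀).val 1 0 := by
      have n1 := torus_norm (hA γ₀)
      have n2 := torus_norm (hB γ₀)
      rw [hα γ₀] at n2
      have : (B γ₀).val 1 0 ^ 2 = (A γ₀).val 1 0 ^ 2 := by
        apply mul_left_cancel₀ h0
        linear_combination n1 - n2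
      rcases sq_eq_sq_iff_eq_or_eq_neg.1 this with h | h
      · exact ⟨1, Or.inl rfl, by rw [h, one_mul]⟩
      · exact ⟨-1, Or.inr rfl, by rw [h, neg_one_mul]⟩
    obtain ⟨ε, hε, hε1⟩ := hε
    obtain ⟨e1, e2⟩ := e γ₀
    rw [hε1] at e1 e2
    have f1 : g.val 0 1 = ε * δ * g.val 1 0 := by
      apply mul_right_cancel₀ hγ₀; linear_combination - e1
    have f2 : g.val 1 1 = ε * g.val 0 0 := by
      apply mul_right_cancel₀ hγ₀; linear_combination - e2
    have hall : ∀ γ, (B γ).val 1 0 = ε * (A γ).val 1 0 := by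
      intro γ
      obtain ⟨e3, e4⟩ := e γ
      rw [f1] at e3
      rw [f2] at e4
      by_contra hne
      have hne := sub_ne_zero.2 hne
      have p0 : g.val 0 0 = 0 := by
        apply (mul_eq_zero.1 (_ : ((B γ).val 1 0 - ε * (A γ).val 1 0) * g.val 0 0 = 0)).resolve_left hne
        linear_combination e4
      have p1 : g.val 1 0 = 0 := by
        apply (mul_eq_zero.1 (_ : (((B γ).val 1 0 - ε * (A γ).val 1 0) * δ) * g.val 1 0 = 0)).resolve_left
          (mul_ne_zero hne h0)
        linear_combination e3
      apply hdet
      rw [p0, p1]; ring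
    rcases hε with rfl | rfl
    · left
      intro γ
      exact torus_ext (hB γ) (hA γ) (hα γ) (by rw [hall γ, one_mul])
    · right
      intro γ
      refine torus_ext (hB γ) ((torus δ).inv_mem (hA γ)) ?_ ?_
      · rw [hα γ, torus_inv (hA γ)]; simp
      · rw [hall γ, torus_inv (hA γ)]; simp

lemma torus_conj_inv {F : Type} [Field F] (δ : F) :
    ∃ g : GL (Fin 2) F, ∀ A ∈ torus δ, A⁻¹ = g * A * g⁻¹ := by
  have hgd : (!![1, 0; 0, -1] : Matrix (Fin 2) (Fin 2) F).det ≠ 0 := by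
    rw [Matrix.det_fin_two_of]; simp
  refine ⟨Matrix.GeneralLinearGroup.mkOfDetNeZero _ hgd, fun A hA => ?_⟩
  rw [eq_mul_inv_iff_mul_eq]
  apply Units.ext
  rw [Units.val_mul, Units.val_mul, torus_inv hA]
  obtain ⟨h1, h2, -⟩ := torus_mem.1 hA
  change _ * !![1, 0; 0, -1] = !![1, 0; 0, -1] * _
  ext i j
  fin_cases i <;> fin_cases j <;> simp [Matrix.mul_apply, Fin.sum_univ_two, h1, h2]

lemma torus_irr {Γ F : Type} [Group Γ] [Field F] (δ : F) (hδ : ¬ IsSquare δ)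
    (ρ : Γ →* GL (Fin 2) F) (hρ : ∀ γ, ρ γ ∈ torus δ) (γ : Γ) (hγ : (ρ γ).val 1 0 ≠ 0) :
    IsIrreducibleRep ρ := by
  intro W hW
  by_cases hb : W = ⊥
  · exact Or.inl hb
  right
  obtain ⟨v, hv, hv0⟩ := Submodule.exists_mem_ne_zero_of_ne_bot hb
  refine top_of_det W _ _ hv (hW γ v hv) ?_
  obtain ⟨h1, h2, -⟩ := torus_mem.1 (hρ γ)
  simp only [Matrix.mulVec, dotProduct, Fin.sum_univ_two, h2, ← h1]
  intro h
  have h3 : v 0 ^ 2 = δ * v 1 ^ 2 := by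
    apply mul_left_cancel₀ hγ
    linear_combination h
  by_cases hy : v 1 = 0
  · rw [hy] at h3
    have hx : v 0 = 0 := by simpa using h3
    apply hv0
    ext i
    fin_cases i
    · exact hx
    · exact hy
  · apply hδ
    refine ⟨v 0 / v 1, ?_⟩
    field_simp
    linear_combination - h3

lemma torus_not_abs {Γ F : Type} [Group Γ] [Field F] (δ : F)
    (ρ : Γ →* GL (Fin 2) F) (hρ : ∀ γ, ρ γ ∈ torus δ) :
    ¬ IsAbsolutelyIrreducibleRep ρ := by
  intro h
  obtain ⟨w, hw⟩ := IsAlgClosed.exists_pow_nat_eq (algebraMap F (AlgebraicClosure F) δ)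
    (n := 2) (by norm_num)
  let W : Submodule (AlgebraicClosure F) (Fin 2 → AlgebraicClosure F) :=
    { carrier := {u | u 0 = w * u 1}
      zero_mem' := by simp
      add_mem' := by
        intro a b ha hb
        simp only [Set.mem_ofPred_eq, Pi.add_apply] at *
        linear_combination ha + hb
      smul_mem' := by
        intro c a ha
        simp only [Set.mem_ofPred_eq, Pi.smul_apply, smul_eq_mul] at *
        linear_combination c * ha }
  have hW : ∀ u, u ∈ W ↔ u 0 = w * u 1 := fun _ => Iff.rfl
  rcases h W (by
    intro γ v hv
    obtain ⟨h1, h2, -⟩ := torus_mem.1 (hρ γ)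
    rw [hW] at hv ⊢
    simp only [Matrix.mulVec, dotProduct, Fin.sum_univ_two, Matrix.map_apply, h2, ← h1, map_mul]
    rw [hv, ← hw]; ring) with h1 | h1
  · have : (![w, 1] : Fin 2 → AlgebraicClosure F) ∈ W := by rw [hW]; simp
    rw [h1, Submodule.mem_bot] at this
    have e1 := congrFun this 1
    simp at e1
  · have e1 : (![1, 0] : Fin 2 → AlgebraicClosure F) ∈ W := by rw [h1]; trivial
    rw [hW] at e1
    simp at e1

lemma card_two_to_one {X Y : Type} [Finite X] (f : X → Y) (hf : Function.Surjective f)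
    (i : X → X) (hi : ∀ x, i x ≠ x) (h : ∀ x y, f x = f y ↔ (y = x ∨ y = i x)) :
    Nat.card X = 2 * Nat.card Y := by
  classical
  have : Finite Y := Finite.of_surjective f hf
  have := Fintype.ofFinite X
  have := Fintype.ofFinite Y
  rw [Nat.card_eq_fintype_card, Nat.card_eq_fintype_card, ← Finset.card_univ,
    Finset.card_eq_sum_card_fiberwise (f := f) (t := Finset.univ) (by simp)]
  have : ∀ y ∈ (Finset.univ : Finset Y), (Finset.univ.filter (fun x => f x = y)).card = 2 := by
    intro y _
    obtain ⟨x, rfl⟩ := hf y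
    rw [Finset.card_eq_two]
    refine ⟨x, i x, (hi x).symm, ?_⟩
    ext z
    simp only [Finset.mem_filter, Finset.mem_univ, true_and, Finset.mem_insert,
      Finset.mem_singleton]
    rw [eq_comm, h]
  rw [Finset.sum_congr rfl this]
  simp [mul_comm]

lemma card_self_inv (Γ : Type) [Group Γ] (n : ℕ) [NeZero n] (hn : 2 ∣ n) :
    Nat.card {A : Γ →* Multiplicative (ZMod n) // A⁻¹ = A} =
      Nat.card (Γ →* Multiplicative (ZMod 2)) := by
  let C := Multiplicative (ZMod n)
  let H : Subgroup C := (powMonoidHom 2).ker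
  have hH : Nat.card H = 2 := by
    rw [IsCyclic.card_powMonoidHom_ker]
    rw [Nat.card_congr Multiplicative.toAdd, Nat.card_zmod]
    exact Nat.gcd_eq_right hn
  have : IsCyclic H := inferInstance
  let e : H ≃* Multiplicative (ZMod 2) := mulEquivOfCyclicCardEq (by
    rw [hH, Nat.card_congr Multiplicative.toAdd, Nat.card_zmod])
  have hmem : ∀ c : C, c ∈ H ↔ c⁻¹ = c := by
    intro c
    rw [MonoidHom.mem_ker, powMonoidHom_apply, pow_two, inv_eq_iff_mul_eq_one]
  refine Nat.card_congr
    { toFun := fun A => e.toMonoidHom.comp (A.1.codRestrict H (fun γ => by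
        rw [hmem, ← MonoidHom.inv_apply, A.2]))
      invFun := fun B => ⟨H.subtype.comp (e.symm.toMonoidHom.comp B), by
        ext γ
        exact congrArg _ ((hmem _).1 (e.symm (B γ)).2)⟩
      left_inv := ?_
      right_inv := ?_ }
  · intro A
    apply Subtype.ext
    ext γ
    simp
  · intro B
    ext γ
    simp

lemma irr_conj {Γ F : Type} [Group Γ] [Field F] (ρ ρ' : Γ →* GL (Fin 2) F) (g : GL (Fin 2) F)
    (h : ∀ γ, ρ' γ = g * ρ γ * g⁻¹) (hirr : IsIrreducibleRep ρ) : IsIrreducibleRep ρ' := by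
  intro W hW
  have hinv : ∀ v, g.val.mulVec ((g⁻¹).val.mulVec v) = v := by
    intro v
    rw [Matrix.mulVec_mulVec, Units.mul_inv, Matrix.one_mulVec]
  have hinv' : ∀ v, (g⁻¹).val.mulVec (g.val.mulVec v) = v := by
    intro v
    rw [Matrix.mulVec_mulVec, Units.inv_mul, Matrix.one_mulVec]
  have hV : ∀ v, v ∈ W.comap (Matrix.mulVecLin g.val) ↔ g.val.mulVec v ∈ W := fun _ => Iff.rfl
  rcases hirr (W.comap (Matrix.mulVecLin g.val)) (by
    intro γ v hv
    rw [hV] at hv ⊢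
    have := hW γ _ hv
    rw [h γ] at this
    rw [Units.val_mul, Units.val_mul, ← Matrix.mulVec_mulVec, hinv', ← Matrix.mulVec_mulVec] at this
    exact this) with h1 | h1
  · left
    rw [eq_bot_iff]
    intro v hv
    have : (g⁻¹).val.mulVec v ∈ W.comap (Matrix.mulVecLin g.val) := by rw [hV, hinv]; exact hv
    rw [h1, Submodule.mem_bot] at this
    rw [Submodule.mem_bot, ← hinv v, this, Matrix.mulVec_zero]
  · right
    rw [eq_top_iff]
    intro v _
    have : (g⁻¹).val.mulVec v ∈ W.comap (Matrix.mulVecLin g.val) := by rw [h1]; trivial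
    rw [hV, hinv] at this
    exact this

/-- Let `q` be an odd prime power and `Γ` a finitely generated group. With
`m_j` the number of homomorphisms `Γ → ℤ/jℤ`, the number of isomorphism classes (i.e.
`GL₂(𝔽_q)`-conjugacy classes) of irreducible-but-not-absolutely-irreducible `2`-dimensional
representations of `Γ` over `𝔽_q` with trivial determinant equals `(m_{q+1} − m₂)/2`. -/
theorem stmt17 (Γ : Type) [Group Γ] (hΓ : Group.FG Γ)
    (F : Type) [Field F] [Fintype F] (q : ℕ) (hq : Fintype.card F = q) (hodd : Odd q)
    (m : ℕ → ℕ) (hm : ∀ j : ℕ, m j = Nat.card (Γ →* Multiplicative (ZMod j))) :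
    (Nat.card (Quot (fun ρ₁ ρ₂ :
        {ρ : Γ →* GL (Fin 2) F //
          (∀ γ, ((ρ γ).val).det = 1) ∧ IsIrreducibleRep ρ ∧ ¬ IsAbsolutelyIrreducibleRep ρ} =>
          ∃ g : GL (Fin 2) F, ∀ γ, ρ₂.val γ = g * ρ₁.val γ * g⁻¹)) : ℚ) =
      ((m (q + 1) : ℚ) - m 2) / 2 := by
  classical
  subst hq
  obtain ⟨δ, hδ⟩ := FiniteField.exists_nonsquare (aux_ringChar F hodd)
  have h0 : δ ≠ 0 := by rintro rfl; exact hδ (IsSquare.zero)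
  have h2 : (2 : F) ≠ 0 := Ring.two_ne_zero (aux_ringChar F hodd)
  obtain ⟨hcyc, hcard⟩ := torus_cyclic F (AlgebraicClosure F) hodd δ hδ
  let e : Multiplicative (ZMod (Fintype.card F + 1)) ≃* torus δ := mulEquivOfCyclicCardEq (by
    rw [hcard, Nat.card_congr Multiplicative.toAdd, Nat.card_zmod])
  have hfin : Finite (Γ →* Multiplicative (ZMod (Fintype.card F + 1))) :=
    aux_finite_hom Γ hΓ _
  let R : (Γ →* Multiplicative (ZMod (Fintype.card F + 1))) → (Γ →* GL (Fin 2) F) :=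
    fun A => ((torus δ).subtype.comp e.toMonoidHom).comp A
  have hR : ∀ A γ, R A γ = (e (A γ)).val := fun _ _ => rfl
  have hRmem : ∀ A γ, R A γ ∈ torus δ := fun A γ => (e (A γ)).2
  have hRinj : ∀ A B, (∀ γ, R A γ = R B γ) → A = B := by
    intro A B h
    ext γ
    have := h γ
    rw [hR, hR] at this
    exact congrArg _ (e.injective (Subtype.ext this))
  have hRinv : ∀ A γ, R A⁻¹ γ = (R A γ)⁻¹ := by
    intro A γ
    rw [hR, hR, MonoidHom.inv_apply, map_inv]
    rfl
  have hRb : ∀ A, A⁻¹ ≠ A → ∃ γ, (R A γ).val 1 0 ≠ 0 := by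
    intro A hA
    by_contra! hc
    apply hA
    apply hRinj
    intro γ
    rw [hRinv]
    refine torus_ext ((torus δ).inv_mem (hRmem A γ)) (hRmem A γ) ?_ ?_
    · rw [torus_inv (hRmem A γ)]; simp
    · rw [torus_inv (hRmem A γ)]; simp [hc γ]
  set r := (fun ρ₁ ρ₂ :
        {ρ : Γ →* GL (Fin 2) F //
          (∀ γ, ((ρ γ).val).det = 1) ∧ IsIrreducibleRep ρ ∧ ¬ IsAbsolutelyIrreducibleRep ρ} =>
          ∃ g : GL (Fin 2) F, ∀ γ, ρ₂.val γ = g * ρ₁.val γ * g⁻¹) with hr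
  have hequiv : Equivalence r := by
    refine ⟨fun ρ => ⟨1, by simp⟩, ?_, ?_⟩
    · rintro ρ₁ ρ₂ ⟨g, hg⟩
      refine ⟨g⁻¹, fun γ => ?_⟩
      rw [hg γ]; group
    · rintro ρ₁ ρ₂ ρ₃ ⟨g, hg⟩ ⟨k, hk⟩
      refine ⟨k * g, fun γ => ?_⟩
      rw [hk γ, hg γ]; group
  let f : {A : Γ →* Multiplicative (ZMod (Fintype.card F + 1)) // ¬ A⁻¹ = A} → Quot r :=
    fun A => Quot.mk r ⟨R A.1, fun γ => (torus_mem.1 (hRmem A.1 γ)).2.2,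
      (hRb A.1 A.2).elim fun γ hγ => torus_irr δ hδ (R A.1) (hRmem A.1) γ hγ,
      torus_not_abs δ (R A.1) (hRmem A.1)⟩
  have hmain : Nat.card {A : Γ →* Multiplicative (ZMod (Fintype.card F + 1)) // ¬ A⁻¹ = A} =
      2 * Nat.card (Quot r) := by
    refine card_two_to_one f ?_ (fun A => ⟨A.1⁻¹, by rw [inv_inv]; exact fun h => A.2 h.symm⟩)
      (fun A h => A.2 (congrArg Subtype.val h)) ?_
    · intro y
      obtain ⟨⟨ρ, hdet, hirr, habs⟩, rfl⟩ := Quot.exists_rep y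
      obtain ⟨g, hg⟩ := exists_conj_torus hodd δ hδ ρ hdet hirr habs
      let B : Γ →* torus δ := ((MulAut.conj g).toMonoidHom.comp ρ).codRestrict (torus δ)
        (fun γ => hg γ)
      let A := e.symm.toMonoidHom.comp B
      have hRA : ∀ γ, R A γ = g * ρ γ * g⁻¹ := by
        intro γ
        rw [hR]
        change (e (e.symm (B γ))).val = _
        rw [MulEquiv.apply_symm_apply]
        rfl
      have hA : ¬ A⁻¹ = A := by
        intro hA
        refine not_irr_of_line (R A) 1 0 (Or.inl one_ne_zero) ?_ ?_
        · intro γ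
          have h1 := hRinv A γ
          rw [hA] at h1
          have h3 := congrArg (fun x : GL (Fin 2) F => x.val 1 0) h1
          simp only [torus_inv (hRmem A γ)] at h3
          have : (R A γ).val 1 0 = 0 := by
            apply mul_left_cancel₀ h2
            simp at h3
            linear_combination h3
          simp [this]
        · exact irr_conj ρ (R A) g hRA hirr
      refine ⟨⟨A, hA⟩, ?_⟩
      apply Quot.sound
      refine ⟨g⁻¹, fun γ => ?_⟩
      change ρ γ = g⁻¹ * R A γ * g⁻¹⁻¹
      rw [hRA]; group
    · rintro ⟨A, hA⟩ ⟨B, hB⟩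
      constructor
      · intro h
        obtain ⟨g, hg⟩ := (hequiv.eqvGen_iff).1 (Quot.eqvGen_exact h)
        rcases torus_conj h2 δ h0 (R A) (R B) (hRmem A) (hRmem B) g hg with h | h
        · left
          exact Subtype.ext (hRinj _ _ h)
        · right
          refine Subtype.ext (hRinj _ _ ?_)
          intro γ
          rw [h γ, hRinv]
      · rintro (h | h)
        · rw [h]
        · obtain rfl : B = A⁻¹ := congrArg Subtype.val h
          obtain ⟨g, hg⟩ := torus_conj_inv δ
          apply Quot.sound
          refine ⟨g, fun γ => ?_⟩
          change R A⁻¹ γ = g * R A γ * g⁻¹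
          rw [hRinv]
          exact hg _ (hRmem A γ)
  have hsum := Nat.card_congr (Equiv.sumCompl
    (fun A : Γ →* Multiplicative (ZMod (Fintype.card F + 1)) => A⁻¹ = A))
  rw [Nat.card_sum, hmain, card_self_inv Γ _ (even_iff_two_dvd.1 hodd.add_one),
    ← hm, ← hm] at hsum
  rw [← hsum]
  push_cast
  ring
end
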